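/- There exists a finitely generated, recursively presented group G (with a distinguished finite generating set) containing an element of infinite order (hence a subgroup isomorphic to ℤ) such that S(G, 3) ⊊ S(G, 4). -/

import Mathlib

open Classical in
/-- Characteristic sequence of a set of naturals. -/
noncomputable def charSeq (A : Set ℕ) : ℕ → Bool := fun i => decide (i ∈ A)

/-- The length-`m` prefix of the characteristic sequence of `A`. -/
noncomputable def charPrefix (A : Set ℕ) (m : ℕ) : List Bool :=
  (List.range m).map (charSeq A)

/-- `A` is Σ⁰₁ (recursively enumerable). -/
def IsSigma01 (A : Set ℕ) : Prop :=
  ∃ f : ℕ →. ℕ, Partrec f ∧ ∀ n, n ∈ A ↔ (f n).Dom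

/-- `A` many-one reduces to `B`. -/
def ManyOneRed (A B : Set ℕ) : Prop :=
  ∃ f : ℕ → ℕ, Computable f ∧ ∀ n, n ∈ A ↔ f n ∈ B

/-- `A` is `φ`-impredictable with witness `ψ`. -/
def ImpredictableWith (φ : ℕ → ℕ) (A : Set ℕ) (ψ : ℕ → ℕ) : Prop :=
  ∀ χ : ℕ × List Bool →. ℕ, Partrec χ →
    ∀ N : ℕ, ∃ p : ℕ, N ≤ p ∧ (ψ p ∈ A ↔ (χ (p, charPrefix A (φ p))).Dom)

/-- `A` is `φ`-impredictable. -/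
def Impredictable (φ : ℕ → ℕ) (A : Set ℕ) : Prop :=
  ∃ ψ : ℕ → ℕ, Computable ψ ∧ ImpredictableWith φ A ψ

/-- Bitwise comparison of binary strings of equal length. -/
def bitLE (u v : List Bool) : Prop := List.Forall₂ (· ≤ ·) u v

/-- `B` wtt-reduces to `A` with rate `β`. -/
def WttRedRate (B A : Set ℕ) (β : ℕ → ℕ) : Prop :=
  Computable β ∧ Monotone β ∧ Filter.Tendsto β Filter.atTop Filter.atTop ∧
  ∃ g : List Bool →. List Bool, Partrec g ∧
    ∀ m : ℕ, ∃ out : List Bool, out ∈ g (charPrefix A m) ∧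
      out = charPrefix B out.length ∧ β m ≤ out.length

/-- `B` conjunctively reduces to `A` with rate `β`. -/
def ConjRedRate (B A : Set ℕ) (β : ℕ → ℕ) : Prop :=
  Computable β ∧ Monotone β ∧ Filter.Tendsto β Filter.atTop Filter.atTop ∧
  ∃ g : List Bool → List Bool, Computable g ∧
    (∀ w : List Bool, (g w).length = β w.length) ∧
    (∀ u v : List Bool, bitLE u v → bitLE (g u) (g v)) ∧
    (∀ m : ℕ, g (charPrefix A m) = charPrefix B (β m)) ∧
    ∃ w : ℕ → ℕ → List Bool, Computable₂ w ∧ (∀ i m, (w i m).length = m) ∧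
      ∀ (u v : List Bool) (i : ℕ), u.length = v.length →
        (bitLE (w i u.length) u ↔ bitLE (w i u.length) v) →
        (g u).getD i false = (g v).getD i false

/-- Evaluation of a word over the generators (`true` = generator, `false` = inverse). -/
def evalWord {K : Type*} [Group K] {m : ℕ} (gen : Fin m → K) (w : List (Fin m × Bool)) : K :=
  (w.map fun l => if l.2 then gen l.1 else (gen l.1)⁻¹).prod

/-- Index of a word in the length-then-lexicographic enumeration of all words
(bijective base-`2m` numeration). -/
def wordCode {m : ℕ} (w : List (Fin m × Bool)) : ℕ :=
  w.foldl (fun acc l => acc * (2 * m) + (2 * l.1.val + (if l.2 then 1 else 0) + 1)) 0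

/-- The word problem of a group with distinguished generators. -/
def WordProblem {K : Type*} [Group K] {m : ℕ} (gen : Fin m → K) : Set ℕ :=
  { n | ∃ w : List (Fin m × Bool), wordCode w = n ∧ evalWord gen w = 1 }

/-- Word norm with respect to the distinguished generators. -/
noncomputable def wordNorm {K : Type*} [Group K] {m : ℕ} (gen : Fin m → K) (g : K) : ℕ :=
  sInf { ℓ | ∃ w : List (Fin m × Bool), w.length = ℓ ∧ evalWord gen w = g }

/-- The torsion function of a group with distinguished generators. -/
noncomputable def torsionFn {K : Type*} [Group K] {m : ℕ} (gen : Fin m → K) (n : ℕ) : ℕ :=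
  sSup { k | ∃ g : K, wordNorm gen g ≤ n ∧ orderOf g = k }

/-- Shift action on configurations. -/
def shiftC {G : Type*} [Group G] {α : Type*} (g : G) (x : G → α) : G → α :=
  fun k => x (g⁻¹ * k)

/-- A head configuration: a configuration with at most one non-`none` coordinate
(`none` plays the role of the symbol `0`). -/
def HeadOK {G : Type*} {q : ℕ} (y : G → Option (Fin q)) : Prop :=
  ∀ a b : G, y a ≠ none → y b ≠ none → a = b

/-- The space `Y = ∏ᵢ X¹_{Qᵢ}` of head configurations of a `k`-headed automaton. -/
def YS (G : Type*) [Group G] (k : ℕ) (q : Fin k → ℕ) : Type _ :=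
  { y : ∀ i : Fin k, G → Option (Fin (q i)) // ∀ i, HeadOK (y i) }

/-- Diagonal shift action on head configurations. -/
def yshift {G : Type*} [Group G] {k : ℕ} {q : Fin k → ℕ} (g : G) (y : YS G k q) :
    YS G k q :=
  ⟨fun i => shiftC g (y.1 i), fun i a b ha hb => mul_left_cancel (y.2 i _ _ ha hb)⟩

/-- Product topology where each factor is discrete (prodiscrete topology). -/
def piBot (ι α : Type*) : TopologicalSpace (ι → α) :=
  @Pi.topologicalSpace ι (fun _ => α) (fun _ => ⊥)

/-- The topology on the space of head configurations. -/
def ysTop (G : Type*) [Group G] (k : ℕ) (q : Fin k → ℕ) : TopologicalSpace (YS G k q) :=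
  TopologicalSpace.induced Subtype.val
    (@Pi.topologicalSpace (Fin k) (fun i => G → Option (Fin (q i)))
      (fun i => piBot G (Option (Fin (q i)))))

/-- A `k`-headed group-walking automaton on the full shift `(Fin s)^G`. -/
structure GWA (G : Type*) [Group G] (s k : ℕ) where
  /-- numbers of states of the heads -/
  q : Fin k → ℕ
  /-- the transition cellular automaton -/
  f : (G → Fin s) × YS G k q → (G → Fin s) × YS G k q
  cont : @Continuous _ _
      (@instTopologicalSpaceProd _ _ (piBot G (Fin s)) (ysTop G k q))
      (@instTopologicalSpaceProd _ _ (piBot G (Fin s)) (ysTop G k q)) f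
  fst_eq : ∀ p, (f p).1 = p.1
  equivar : ∀ (g : G) (p : (G → Fin s) × YS G k q),
      f (shiftC g p.1, yshift g p.2) = (shiftC g (f p).1, yshift g (f p).2)
  vanish : ∀ (p : (G → Fin s) × YS G k q) (i : Fin k),
      ((f p).2.1 i = fun _ => none) ↔ (p.2.1 i = fun _ => none)
  /-- the initial clopen set -/
  Ini : Set (YS G k q)
  /-- the final (rejecting) clopen set -/
  Fini : Set (YS G k q)
  clopen_Ini : @IsClopen _ (ysTop G k q) Ini
  clopen_Fini : @IsClopen _ (ysTop G k q) Fini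

/-- The subshift `S(A)` defined by a group-walking automaton `A`. -/
def autSet {G : Type*} [Group G] {s k : ℕ} (aut : GWA G s k) : Set (G → Fin s) :=
  { x | ∀ (g h : G) (y : YS G k aut.q) (n : ℕ), y ∈ aut.Ini →
      yshift h ((aut.f^[n] (shiftC g x, y)).2) ∉ aut.Fini }

/-- Membership in the class `S(G,k)` of subshifts defined by `k`-headed
group-walking automata, for alphabet `Fin s`. -/
def InS (G : Type*) [Group G] (k s : ℕ) (X : Set (G → Fin s)) : Prop :=
  ∃ aut : GWA G s k, X = autSet aut

/-- `S(G,k₁) ⊊ S(G,k₂)`. -/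
def headsLT (G : Type*) [Group G] (k₁ k₂ : ℕ) : Prop :=
  (∀ (s : ℕ) (X : Set (G → Fin s)), InS G k₁ s X → InS G k₂ s X) ∧
  ∃ (s : ℕ) (X : Set (G → Fin s)), InS G k₂ s X ∧ ¬ InS G k₁ s X



namespace FH

/-! ### The Gupta–Sidki group -/

/-- rotation of the first letter -/
def alphaF (e : Fin 3) : List (Fin 3) → List (Fin 3)
  | [] => []
  | x :: l => (x + e) :: l

/-- the recursively defined generator, with exponent `e` -/
def betaF (e : Fin 3) : List (Fin 3) → List (Fin 3)
  | [] => []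
  | x :: l => if x = 0 then x :: betaF e l else x :: alphaF (x * e) l

theorem alphaF_add (e f : Fin 3) (l : List (Fin 3)) :
    alphaF e (alphaF f l) = alphaF (f + e) l := by
  cases l <;> simp [alphaF, add_assoc]

theorem alphaF_zero (l : List (Fin 3)) : alphaF 0 l = l := by
  cases l <;> simp [alphaF]

theorem betaF_add (e f : Fin 3) (l : List (Fin 3)) :
    betaF e (betaF f l) = betaF (f + e) l := by
  induction l with
  | nil => simp [betaF]
  | cons x l ih =>
    by_cases hx : x = 0
    · simp [betaF, hx, ih]
    · have : x * f + x * e = x * (f + e) := by clear hx ih; revert x e f; decide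
      simp [betaF, hx, alphaF_add, this]

theorem betaF_zero (l : List (Fin 3)) : betaF 0 l = l := by
  induction l with
  | nil => simp [betaF]
  | cons x l ih =>
    by_cases hx : x = 0
    · simp [betaF, hx, ih]
    · simp [betaF, hx, alphaF_zero]

/-- `α ^ e` as a permutation -/
def alphaP (e : Fin 3) : Equiv.Perm (List (Fin 3)) where
  toFun := alphaF e
  invFun := alphaF (-e)
  left_inv l := by rw [alphaF_add, add_neg_cancel, alphaF_zero]
  right_inv l := by rw [alphaF_add, neg_add_cancel, alphaF_zero]

/-- `β` as a permutation -/
def betaP : Equiv.Perm (List (Fin 3)) where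
  toFun := betaF 1
  invFun := betaF 2
  left_inv l := by rw [betaF_add]; exact betaF_zero l
  right_inv l := by rw [betaF_add]; exact betaF_zero l

theorem alphaP_mul (e f : Fin 3) : alphaP e * alphaP f = alphaP (e + f) := by
  ext1 l
  simp [alphaP, alphaF_add, add_comm]

theorem alphaP_zero : alphaP 0 = 1 := by
  ext1 l
  simp [alphaP, alphaF_zero]

theorem alphaP_inv (e : Fin 3) : (alphaP e)⁻¹ = alphaP (-e) := by
  rw [inv_eq_iff_mul_eq_one, alphaP_mul, add_neg_cancel, alphaP_zero]

theorem betaP_cube : betaP ^ 3 = 1 := by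
  ext1 l
  have : (betaP ^ 3) l = betaF 1 (betaF 1 (betaF 1 l)) := by
    simp [pow_succ, betaP]
  rw [this, betaF_add, betaF_add]
  exact betaF_zero l

/-- conjugate `α^i β α^{-i}` -/
def bP (i : Fin 3) : Equiv.Perm (List (Fin 3)) := alphaP i * betaP * alphaP (-i)

theorem bP_cube (i : Fin 3) : bP i ^ 3 = 1 := by
  have : bP i = alphaP i * betaP * (alphaP i)⁻¹ := by rw [alphaP_inv]; rfl
  rw [this, conj_pow, betaP_cube]; simp

/-- sections of `bP` -/
def secP (y : Fin 3) : Equiv.Perm (List (Fin 3)) := if y = 0 then betaP else alphaP y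

theorem bP_cons (i x : Fin 3) (l : List (Fin 3)) : bP i (x :: l) = x :: secP (x - i) l := by
  have h1 : bP i (x :: l) = alphaF i (betaF 1 (alphaF (-i) (x :: l))) := rfl
  rw [h1]
  have h2 : x + -i = x - i := (sub_eq_add_neg _ _).symm
  by_cases h : x - i = 0
  · have : x = i := sub_eq_zero.1 h
    subst this
    simp [alphaF, betaF, secP, betaP]
  · simp [alphaF, betaF, secP, h2, h, alphaP]

/-- product of conjugates -/
def pP (L : List (Fin 3)) : Equiv.Perm (List (Fin 3)) := (L.map bP).prod

theorem pP_nil : pP [] = 1 := rfl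
theorem pP_cons (i : Fin 3) (L) : pP (i :: L) = bP i * pP L := rfl
theorem pP_append (L M) : pP (L ++ M) = pP L * pP M := by simp [pP]

theorem pP_cons_apply (L : List (Fin 3)) (x : Fin 3) (l : List (Fin 3)) :
    pP L (x :: l) = x :: (L.map fun i => secP (x - i)).prod l := by
  induction L with
  | nil => rfl
  | cons i L ih => rw [pP_cons, Equiv.Perm.mul_apply, ih, bP_cons]; rfl

/-- normal form of sections; accumulator `e` -/
def sec (x : Fin 3) : Fin 3 → List (Fin 3) → List (Fin 3) × Fin 3
  | e, [] => ([], e)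
  | e, i :: L => if i = x then (e :: (sec x e L).1, (sec x e L).2) else sec x (e + (x - i)) L

theorem alphaP_betaP (e : Fin 3) : alphaP e * betaP = bP e * alphaP e := by
  rw [bP, mul_assoc, alphaP_mul, neg_add_cancel, alphaP_zero, mul_one]

theorem sec_spec (x e : Fin 3) (L : List (Fin 3)) :
    alphaP e * (L.map fun i => secP (x - i)).prod = pP (sec x e L).1 * alphaP (sec x e L).2 := by
  induction L generalizing e with
  | nil => simp [sec, pP]
  | cons i L ih =>
    by_cases h : i = x
    · subst h
      simp only [List.map_cons, List.prod_cons, sec, if_true, sub_self, pP_cons]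
      rw [mul_assoc, ← ih e, ← mul_assoc, ← mul_assoc]
      simp [secP, alphaP_betaP]
    · have hx : x - i ≠ 0 := fun h' => h (sub_eq_zero.1 h').symm
      simp only [List.map_cons, List.prod_cons, sec, h, if_false]
      rw [← ih, ← mul_assoc, secP, if_neg hx, alphaP_mul]

theorem sec_length (x e : Fin 3) (L : List (Fin 3)) : (sec x e L).1.length = L.count x := by
  induction L generalizing e with
  | nil => simp [sec]
  | cons i L ih =>
    by_cases h : i = x
    · simp [sec, h, ih]
    · simp [sec, h, ih]

theorem sec_exp (x e : Fin 3) (L : List (Fin 3)) :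
    (sec x e L).2 = e + (L.map fun i => x - i).sum := by
  induction L generalizing e with
  | nil => simp [sec]
  | cons i L ih =>
    by_cases h : i = x
    · simp [sec, h, ih]
    · simp [sec, h, ih, add_assoc]

/-- the section element -/
def sE (x : Fin 3) (L : List (Fin 3)) : Equiv.Perm (List (Fin 3)) :=
  pP (sec x 0 L).1 * alphaP (sec x 0 L).2

theorem pP_apply (L : List (Fin 3)) (x : Fin 3) (l : List (Fin 3)) :
    pP L (x :: l) = x :: sE x L l := by
  rw [pP_cons_apply, sE, ← sec_spec, alphaP_zero, one_mul]

theorem pP_pow_apply (L : List (Fin 3)) (n : ℕ) (x : Fin 3) (l : List (Fin 3)) :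
    (pP L ^ n) (x :: l) = x :: (sE x L ^ n) l := by
  induction n with
  | zero => rfl
  | succ n ih => rw [pow_succ', pow_succ', Equiv.Perm.mul_apply, ih, pP_apply]; rfl

theorem perm_nil_pow (L : List (Fin 3)) (n : ℕ) : (pP L ^ n) [] = [] := by
  have h : ∀ L : List (Fin 3), pP L [] = [] := by
    intro L
    induction L with
    | nil => rfl
    | cons i L ih => rw [pP_cons, Equiv.Perm.mul_apply, ih]; rfl
  induction n with
  | zero => rfl
  | succ n ih => rw [pow_succ', Equiv.Perm.mul_apply, ih, h]

theorem finOrder_of_sections (L : List (Fin 3)) (h : ∀ x, IsOfFinOrder (sE x L)) :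
    IsOfFinOrder (pP L) := by
  rw [isOfFinOrder_iff_pow_eq_one]
  have h' := fun x => isOfFinOrder_iff_pow_eq_one.1 (h x)
  choose n hn hn1 using h'
  refine ⟨n 0 * n 1 * n 2, Nat.mul_pos (Nat.mul_pos (hn 0) (hn 1)) (hn 2), ?_⟩
  ext1 l
  cases l with
  | nil => rw [perm_nil_pow]; rfl
  | cons x l =>
    rw [pP_pow_apply]
    have : sE x L ^ (n 0 * n 1 * n 2) = 1 := by
      have hd : n x ∣ n 0 * n 1 * n 2 := by
        fin_cases x
        · exact Dvd.dvd.mul_right (Dvd.intro _ rfl) _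
        · exact Dvd.dvd.mul_right (Dvd.intro_left _ rfl) _
        · exact Dvd.intro_left _ rfl
      obtain ⟨k, hk⟩ := hd
      rw [hk, pow_mul, hn1, one_pow]
    rw [this]; rfl

theorem alphaP_conj_pP (e : Fin 3) (L : List (Fin 3)) :
    alphaP e * pP L = pP (L.map (e + ·)) * alphaP e := by
  induction L with
  | nil => simp [pP]
  | cons i L ih =>
    simp only [List.map_cons, pP_cons]
    rw [mul_assoc, ← ih, ← mul_assoc, ← mul_assoc]
    congr 1
    rw [bP, bP, ← mul_assoc, ← mul_assoc, alphaP_mul, mul_assoc (alphaP (e + i) * betaP), alphaP_mul]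
    congr 2; abel

theorem eq_replicate_of_count {x : Fin 3} {L : List (Fin 3)} (h : L.count x = L.length) :
    L = List.replicate L.length x := by
  rw [List.eq_replicate_iff]
  exact ⟨rfl, fun b hb => (List.count_eq_length.1 h b hb).symm⟩

theorem torsion_aux : ∀ (n : ℕ) (L : List (Fin 3)) (e : Fin 3),
    2 * L.length + (if e = 0 then 0 else 1) ≤ n → IsOfFinOrder (pP L * alphaP e) := by
  intro n
  induction n using Nat.strong_induction_on with
  | _ n IH =>
  intro L e hn
  by_cases he : e = 0
  · subst he
    rw [alphaP_zero, mul_one]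
    by_cases hc : ∃ x, L.count x = L.length
    · obtain ⟨x, hx⟩ := hc
      rw [eq_replicate_of_count hx]
      rw [pP, List.map_replicate, List.prod_replicate]
      apply IsOfFinOrder.pow
      exact isOfFinOrder_iff_pow_eq_one.2 ⟨3, by norm_num, bP_cube x⟩
    · push Not at hc
      apply finOrder_of_sections
      intro x
      have h1 : L.count x < L.length := lt_of_le_of_ne List.count_le_length (hc x)
      refine IH (n - 1) (by simp at hn; omega) _ _ ?_
      rw [sec_length]
      simp at hn
      split_ifs <;> omega
  · simp only [he, if_false] at hn
    set M := L ++ L.map (e + ·) ++ L.map (e + e + ·) with hM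
    have h3 : (pP L * alphaP e) ^ 3 = pP M := by
      have e3 : e + e + e = 0 := by clear * -; revert e; decide
      calc (pP L * alphaP e) ^ 3
          = pP L * (alphaP e * pP L) * (alphaP e * pP L) * alphaP e := by
            simp [pow_succ, mul_assoc]
        _ = pP L * pP (L.map (e + ·)) * (alphaP (e + e) * pP L) * alphaP e := by
            rw [alphaP_conj_pP]
            simp only [← alphaP_mul, mul_assoc]
            rw [← mul_assoc (alphaP e) (pP L), alphaP_conj_pP, mul_assoc]
        _ = _ := by
            rw [alphaP_conj_pP, hM, pP_append, pP_append]
            simp only [mul_assoc]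
            rw [alphaP_mul, e3, alphaP_zero, mul_one]
    have h4 : IsOfFinOrder (pP M) := by
      apply finOrder_of_sections
      intro x
      refine IH (n - 1) (by omega) _ _ ?_
      have hz : (sec x 0 M).2 = 0 := by
        rw [sec_exp, hM]
        clear * -
        induction L with
        | nil => simp
        | cons i L ih =>
          simp only [List.map_append, List.sum_append, List.map_cons, List.sum_cons, zero_add] at ih ⊢
          generalize (L.map fun i => x - i).sum = p at *
          generalize ((L.map (e + ·)).map fun i => x - i).sum = q at *
          generalize ((L.map (e + e + ·)).map fun i => x - i).sum = r at *
          have h : ∀ x e i : Fin 3, (x - i) + (x - (e + i)) + (x - (e + e + i)) = 0 := by decide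
          have h := h x e i
          calc _ = ((x - i) + (x - (e + i)) + (x - (e + e + i))) + (p + q + r) := by abel
            _ = 0 := by rw [h, ih, add_zero]
      rw [hz, sec_length]
      have hcount : M.count x = L.length := by
        rw [hM]
        clear * - he
        induction L with
        | nil => simp
        | cons i L ih =>
          simp only [List.count_append, List.map_cons, List.count_cons, List.length_cons] at ih ⊢
          have h : ∀ x e i : Fin 3, e ≠ 0 → (if (i == x) = true then 1 else 0) +
            (if (e + i == x) = true then 1 else 0) + (if (e + e + i == x) = true then 1 else 0) = 1 := by
              decide
          have h := h x e i he
          omega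
      rw [hcount]
      simp; omega
    rw [← h3] at h4
    exact (isOfFinOrder_pow.1 h4).resolve_right (by norm_num)

theorem torsion_pP (L : List (Fin 3)) (e : Fin 3) : IsOfFinOrder (pP L * alphaP e) :=
  torsion_aux _ L e le_rfl

/-! words: `false` is `α`, `true` is `β` -/

/-- generator -/
def gP (b : Bool) : Equiv.Perm (List (Fin 3)) := if b then betaP else alphaP 1

/-- evaluation of positive words -/
def evP (w : List Bool) : Equiv.Perm (List (Fin 3)) := (w.map gP).prod

theorem evP_append (u v) : evP (u ++ v) = evP u * evP v := by simp [evP]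

/-- one step of normal form -/
def nfS (s : List (Fin 3) × Fin 3) (b : Bool) : List (Fin 3) × Fin 3 :=
  if b then (s.1 ++ [s.2], s.2) else (s.1, s.2 + 1)

/-- normal form -/
def nf (w : List Bool) : List (Fin 3) × Fin 3 := w.foldl nfS ([], 0)

/-- value of normal form -/
def nfE (s : List (Fin 3) × Fin 3) : Equiv.Perm (List (Fin 3)) := pP s.1 * alphaP s.2

theorem nf_aux (w : List Bool) (s) : nfE (w.foldl nfS s) = nfE s * evP w := by
  induction w generalizing s with
  | nil => simp [evP]
  | cons b w ih =>
    rw [List.foldl_cons, ih]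
    have : nfE (nfS s b) = nfE s * gP b := by
      cases b
      · simp [nfE, nfS, gP, mul_assoc, alphaP_mul]
      · simp only [nfE, nfS, gP, if_true, pP_append, mul_assoc]
        rw [alphaP_betaP]; simp [pP]
    rw [this, mul_assoc]; simp [evP]

theorem nf_spec (w : List Bool) : evP w = nfE (nf w) := by
  rw [nf, nf_aux]; simp [nfE, pP, alphaP_zero]

theorem torsion_evP (w : List Bool) : IsOfFinOrder (evP w) := by
  rw [nf_spec]; exact torsion_pP _ _

/-- section step -/
def secs (s : List (Fin 3) × Fin 3) : List (List (Fin 3) × Fin 3) :=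
  [sec 0 0 s.1, sec 1 0 s.1, sec 2 0 s.1]

/-- level of sections -/
def lev (s : List (Fin 3) × Fin 3) (n : ℕ) : List (List (Fin 3) × Fin 3) :=
  (fun l => l.flatMap secs)^[n] [s]

theorem iter_append (n : ℕ) (l m : List (List (Fin 3) × Fin 3)) :
    (fun l => l.flatMap secs)^[n] (l ++ m) =
     (fun l => l.flatMap secs)^[n] l ++ (fun l => l.flatMap secs)^[n] m := by
  induction n generalizing l m with
  | zero => rfl
  | succ n ih => simp only [Function.iterate_succ_apply, List.flatMap_append, ih]

theorem mem_lev_succ (s t : List (Fin 3) × Fin 3) (n : ℕ) :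
    t ∈ lev s (n + 1) ↔ ∃ x, t ∈ lev (sec x 0 s.1) n := by
  have : lev s (n + 1) = lev (sec 0 0 s.1) n ++ (lev (sec 1 0 s.1) n ++ lev (sec 2 0 s.1) n) := by
    rw [lev, Function.iterate_succ_apply]
    simp only [List.flatMap_cons, List.flatMap_nil, List.append_nil, secs]
    rw [show [sec 0 0 s.1, sec 1 0 s.1, sec 2 0 s.1] = [sec 0 0 s.1] ++ ([sec 1 0 s.1] ++ [sec 2 0 s.1]) from rfl,
      iter_append, iter_append]
    rfl
  rw [this]
  simp only [List.mem_append]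
  constructor
  · rintro (h | h | h)
    exacts [⟨0, h⟩, ⟨1, h⟩, ⟨2, h⟩]
  · rintro ⟨x, h⟩
    fin_cases x
    exacts [Or.inl h, Or.inr (Or.inl h), Or.inr (Or.inr h)]

theorem pP_nil_apply (L : List (Fin 3)) : pP L [] = [] := by
  simpa using perm_nil_pow L 1

theorem nfE_eq_one_iff (s : List (Fin 3) × Fin 3) :
    nfE s = 1 ↔ s.2 = 0 ∧ ∀ x, nfE (sec x 0 s.1) = 1 := by
  constructor
  · intro h
    have h0 : s.2 = 0 := by
      have := congrArg (fun p : Equiv.Perm (List (Fin 3)) => p [0]) h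
      simp only [nfE, Equiv.Perm.mul_apply, alphaP, Equiv.coe_fn_mk, alphaF, pP_apply,
        Equiv.Perm.one_apply] at this
      simpa using (List.cons.inj this).1
    refine ⟨h0, fun x => ?_⟩
    ext1 l
    have := congrArg (fun p : Equiv.Perm (List (Fin 3)) => p (x :: l)) h
    simp only [nfE, h0, alphaP_zero, mul_one, pP_apply, Equiv.Perm.one_apply] at this
    simpa [sE, nfE] using this
  · rintro ⟨h0, h⟩
    ext1 l
    rw [nfE, h0, alphaP_zero, mul_one]
    cases l with
    | nil => rw [pP_nil_apply]; rfl
    | cons x l => rw [pP_apply]; have := h x; rw [nfE] at this; rw [sE, this]; rfl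

theorem lev_of_one (n : ℕ) : ∀ s, nfE s = 1 → ∀ t ∈ lev s n, t.2 = 0 := by
  induction n with
  | zero =>
    intro s hs t ht
    simp [lev] at ht; subst ht; exact ((nfE_eq_one_iff _).1 hs).1
  | succ n ih =>
    intro s hs t ht
    obtain ⟨x, hx⟩ := (mem_lev_succ _ _ _).1 ht
    exact ih _ (((nfE_eq_one_iff _).1 hs).2 x) t hx

theorem one_of_lev : ∀ (n : ℕ) (s : List (Fin 3) × Fin 3), s.1.length ≤ n →
    (∀ j < n + 2, ∀ t ∈ lev s j, t.2 = 0) → nfE s = 1 := by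
  intro n
  induction n with
  | zero =>
    intro s hs h
    have h0 := h 0 (by norm_num) s (by simp [lev])
    have : s.1 = [] := List.length_eq_zero_iff.1 (by omega)
    simp [nfE, h0, this, alphaP_zero, pP]
  | succ n ih =>
    intro s hs h
    have h0 := h 0 (by omega) s (by simp [lev])
    by_cases hc : ∃ x, s.1.count x = s.1.length
    · obtain ⟨x, hx⟩ := hc
      have hr := eq_replicate_of_count hx
      have h1 := h 1 (by omega) (sec (x + 1) 0 s.1) (by
        rw [mem_lev_succ]; exact ⟨x + 1, by simp [lev]⟩)
      rw [sec_exp, hr] at h1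
      simp only [List.map_replicate, List.sum_replicate, zero_add, add_sub_cancel_left] at h1
      have h3 : 3 ∣ s.1.length := by
        generalize s.1.length = m at h1
        have : (m • (1 : Fin 3)).val = m % 3 := by
          induction m with
          | zero => rfl
          | succ m ih =>
            have : ∀ k : ℕ, (k • (1 : Fin 3)).val = k % 3 := by
              intro k
              induction k with
              | zero => rfl
              | succ k ih => rw [succ_nsmul, Fin.val_add, ih]; simp
            exact this _
        rw [h1] at this
        exact Nat.dvd_of_mod_eq_zero this.symm
      obtain ⟨k, hk⟩ := h3
      rw [nfE, h0, alphaP_zero, mul_one, hr, pP, List.map_replicate, List.prod_replicate, hk, pow_mul,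
        bP_cube, one_pow]
    · push Not at hc
      rw [nfE_eq_one_iff]
      refine ⟨h0, fun x => ih _ ?_ ?_⟩
      · have h1 : s.1.count x < s.1.length := lt_of_le_of_ne List.count_le_length (hc x)
        rw [sec_length]; omega
      · intro j hj t ht
        exact h (j + 1) (by omega) t ((mem_lev_succ _ _ _).2 ⟨x, ht⟩)

theorem evP_eq_one_iff (w : List Bool) :
    evP w = 1 ↔ ∀ j < (nf w).1.length + 2, ∀ t ∈ lev (nf w) j, t.2 = 0 := by
  rw [nf_spec]
  exact ⟨fun h j _ => lev_of_one j _ h, one_of_lev _ _ le_rfl⟩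

/-! computability -/

theorem primrec_fin_add : Primrec₂ (fun a b : Fin 3 => a + b) := Primrec.dom_finite _
theorem primrec_nfS : Primrec₂ nfS := by
  unfold nfS
  refine Primrec.ite (PrimrecRel.comp Primrec.eq Primrec.snd (Primrec.const true)) ?_ ?_
  · exact Primrec.pair (Primrec.list_append.comp (Primrec.fst.comp Primrec.fst)
      (Primrec.list_cons.comp (Primrec.snd.comp Primrec.fst) (Primrec.const [])))
      (Primrec.snd.comp Primrec.fst)
  · exact Primrec.pair (Primrec.fst.comp Primrec.fst)
      (primrec_fin_add.comp (Primrec.snd.comp Primrec.fst) (Primrec.const 1))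

theorem primrec_nf : Primrec nf := by
  unfold nf
  exact Primrec.list_foldl Primrec.id (Primrec.const _) (primrec_nfS.comp
    (Primrec.fst.comp Primrec.snd) (Primrec.snd.comp Primrec.snd)).to₂

/-- fold version of `sec` -/
def secS (x : Fin 3) (s : List (Fin 3) × Fin 3) (i : Fin 3) : List (Fin 3) × Fin 3 :=
  if i = x then (s.1 ++ [s.2], s.2) else (s.1, s.2 + (x - i))

theorem sec_eq_foldl (x : Fin 3) (L : List (Fin 3)) (M e) :
    L.foldl (secS x) (M, e) = (M ++ (sec x e L).1, (sec x e L).2) := by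
  induction L generalizing M e with
  | nil => simp [sec]
  | cons i L ih =>
    by_cases h : i = x
    · simp [secS, sec, h]; simpa using ih (M ++ [e]) e
    · simp [secS, sec, h]; simpa using ih M (e + (x - i))

theorem primrec_secS (x : Fin 3) : Primrec₂ (secS x) := by
  unfold secS
  refine Primrec.ite (PrimrecRel.comp Primrec.eq Primrec.snd (Primrec.const x)) ?_ ?_
  · exact Primrec.pair (Primrec.list_append.comp (Primrec.fst.comp Primrec.fst)
      (Primrec.list_cons.comp (Primrec.snd.comp Primrec.fst) (Primrec.const [])))
      (Primrec.snd.comp Primrec.fst)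
  · exact Primrec.pair (Primrec.fst.comp Primrec.fst)
      (primrec_fin_add.comp (Primrec.snd.comp Primrec.fst)
        ((Primrec.dom_finite (fun i : Fin 3 => x - i)).comp Primrec.snd))

theorem primrec_sec (x : Fin 3) : Primrec (sec x 0) := by
  have : Primrec fun L : List (Fin 3) => L.foldl (secS x) ([], 0) :=
    Primrec.list_foldl Primrec.id (Primrec.const _) ((primrec_secS x).comp
    (Primrec.fst.comp Primrec.snd) (Primrec.snd.comp Primrec.snd)).to₂
  refine this.of_eq fun L => ?_
  rw [sec_eq_foldl]; simp

theorem primrec_secs : Primrec secs := by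
  unfold secs
  exact Primrec.list_cons.comp ((primrec_sec 0).comp Primrec.fst)
    (Primrec.list_cons.comp ((primrec_sec 1).comp Primrec.fst)
    (Primrec.list_cons.comp ((primrec_sec 2).comp Primrec.fst) (Primrec.const [])))

theorem primrec_lev : Primrec₂ lev := by
  unfold lev
  refine Primrec.nat_iterate Primrec.snd
    (Primrec.list_cons.comp Primrec.fst (Primrec.const [])) ?_
  exact Primrec.list_flatMap Primrec.snd (primrec_secs.comp Primrec.snd)

theorem primrecPred_one : PrimrecPred fun w : List Bool => evP w = 1 := by
  simp only [evP_eq_one_iff]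
  have h1 : PrimrecRel fun (l : List (List (Fin 3) × Fin 3)) (_ : Unit) => ∀ t ∈ l, t.2 = 0 :=
    PrimrecRel.forall_mem_list (R := fun (t : List (Fin 3) × Fin 3) (_ : Unit) => t.2 = 0)
      (PrimrecRel.comp Primrec.eq (Primrec.snd.comp Primrec.fst) (Primrec.const 0))
  have h2 : PrimrecRel fun (j : ℕ) (w : List Bool) => ∀ t ∈ lev (nf w) j, t.2 = 0 :=
    h1.comp (primrec_lev.comp (primrec_nf.comp Primrec.snd) Primrec.fst) (Primrec.const ())
  have h3 := PrimrecRel.forall_mem_list h2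
  refine PrimrecPred.of_eq (h3.comp (Primrec.list_range.comp (Primrec.nat_add.comp (Primrec.list_length.comp (Primrec.fst.comp primrec_nf))
    (Primrec.const 2))) Primrec.id) fun w => by simp


/-! an infinite computable sequence of distinct elements -/

/-- the substitution -/
def phi (w : List Bool) : List Bool :=
  w.flatMap fun b => if b then [true] else [false, false, true, false]

/-- the sequence of words -/
def gw (n : ℕ) : List Bool := phi^[n] [false]

theorem phi_letter (b : Bool) (x : Fin 3) (l : List (Fin 3)) :
    ∃ l', evP (phi [b]) (x :: l) = x :: l' ∧ (x = 0 → l' = evP [b] l) := by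
  cases b
  · have : evP (phi [false]) = bP 2 := by
      have : evP (phi [false]) = alphaP 1 * (alphaP 1 * (betaP * alphaP 1)) := by
        simp [evP, phi, gP]
      rw [this, ← mul_assoc, alphaP_mul]; rw [bP, mul_assoc]; rfl
    rw [this, bP_cons]
    refine ⟨_, rfl, ?_⟩
    rintro rfl
    simp only [secP, evP, gP, List.map_cons, List.map_nil, List.prod_cons, List.prod_nil, mul_one]
    rfl
  · refine ⟨if x = 0 then betaF 1 l else alphaF (x * 1) l, ?_, ?_⟩
    · have : evP (phi [true]) = betaP := by simp [evP, phi, gP]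
      rw [this]
      change betaF 1 (x :: l) = _
      rw [betaF]
      split_ifs <;> rfl
    · rintro rfl
      have : evP [true] = betaP := by simp [evP, gP]
      rw [this]; simp [betaP]

theorem phi_word (w : List Bool) (x : Fin 3) (l : List (Fin 3)) :
    ∃ l', evP (phi w) (x :: l) = x :: l' ∧ (x = 0 → l' = evP w l) := by
  induction w with
  | nil => exact ⟨l, rfl, fun _ => rfl⟩
  | cons b w ih =>
    obtain ⟨l1, h1, h2⟩ := ih
    have e1 : phi (b :: w) = phi [b] ++ phi w := by simp [phi]
    have e2 : b :: w = [b] ++ w := rfl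
    obtain ⟨l2, h3, h4⟩ := phi_letter b x l1
    refine ⟨l2, ?_, ?_⟩
    · rw [e1, evP_append, Equiv.Perm.mul_apply, h1, h3]
    · intro hx
      rw [h4 hx, h2 hx, e2, evP_append]; rfl

theorem gw_succ (n : ℕ) : gw (n + 1) = phi (gw n) := by
  rw [gw, Function.iterate_succ_apply']; rfl

theorem gw_zeros (k n : ℕ) (l : List (Fin 3)) :
    evP (gw (n + k)) (List.replicate n 0 ++ l) = List.replicate n 0 ++ evP (gw k) l := by
  induction n with
  | zero => simp
  | succ n ih =>
    obtain ⟨l', h1, h2⟩ := phi_word (gw (n + k)) 0 (List.replicate n 0 ++ l)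
    rw [show n + 1 + k = (n + k) + 1 by omega, gw_succ, List.replicate_succ, List.cons_append, h1, h2 rfl,
      ih]; rfl

theorem gw_lt_ne (m n : ℕ) (h : n < m) : evP (gw n) ≠ evP (gw m) := by
  intro he
  obtain ⟨k, rfl⟩ : ∃ k, m = n + (k + 1) := ⟨m - n - 1, by omega⟩
  have h1 := gw_zeros 0 n [0]
  have h2 := gw_zeros (k + 1) n [0]
  rw [← he] at h2
  rw [add_zero, h2] at h1
  have h3 := List.append_cancel_left h1
  obtain ⟨l', h4, _⟩ := phi_word (gw k) 0 []
  rw [gw_succ, h4] at h3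
  have : evP (gw 0) [0] = [1] := by decide
  rw [this] at h3
  simp at h3

theorem gw_injective : Function.Injective fun n => evP (gw n) := by
  intro m n h
  rcases lt_trichotomy m n with h' | h' | h'
  · exact absurd h (gw_lt_ne _ _ h')
  · exact h'
  · exact absurd h.symm (gw_lt_ne _ _ h')

theorem primrec_gw : Primrec gw := by
  unfold gw
  refine Primrec.nat_iterate Primrec.id (Primrec.const _) ?_
  exact Primrec.list_flatMap Primrec.snd ((Primrec.dom_finite
    (fun b : Bool => if b then [true] else [false, false, true, false])).comp Primrec.snd).to₂

/-- inverse word -/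
def winv (w : List Bool) : List Bool := w.reverse.flatMap fun b => [b, b]

theorem winv_spec (w : List Bool) : evP (winv w) = (evP w)⁻¹ := by
  have h : ∀ b, gP b * gP b = (gP b)⁻¹ := by
    intro b
    rw [eq_inv_iff_mul_eq_one]
    cases b
    · simp only [gP, Bool.false_eq_true, if_false, alphaP_mul]; exact alphaP_zero
    · simp only [gP, if_true]; rw [← betaP_cube]; rfl
  induction w with
  | nil => rfl
  | cons b w ih =>
    have e1 : winv (b :: w) = winv w ++ [b, b] := by simp [winv]
    have e2 : evP (b :: w) = gP b * evP w := rfl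
    rw [e1, evP_append, ih, e2, mul_inv_rev, ← h]; simp [evP]

theorem primrec_winv : Primrec winv := by
  unfold winv
  exact Primrec.list_flatMap Primrec.list_reverse ((Primrec.dom_finite (fun b : Bool => [b, b])).comp Primrec.snd).to₂

theorem primrecRel_evP_eq : PrimrecRel fun u v : List Bool => evP u = evP v := by
  have : PrimrecRel fun u v : List Bool => evP (u ++ winv v) = 1 :=
    primrecPred_one.comp (Primrec.list_append.comp Primrec.fst (primrec_winv.comp Primrec.snd))
  refine this.of_eq fun u v => ?_
  rw [evP_append, winv_spec, mul_inv_eq_one]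

/-- the Gupta–Sidki group -/
def KG : Subgroup (Equiv.Perm (List (Fin 3))) where
  carrier := Set.range evP
  mul_mem' := by rintro _ _ ⟨u, rfl⟩ ⟨v, rfl⟩; exact ⟨u ++ v, evP_append u v⟩
  one_mem' := ⟨[], rfl⟩
  inv_mem' := by rintro _ ⟨u, rfl⟩; exact ⟨winv u, winv_spec u⟩

/-- evaluation into the group -/
def ev (w : List Bool) : KG := ⟨evP w, w, rfl⟩

theorem ev_append (u v) : ev (u ++ v) = ev u * ev v := Subtype.ext (evP_append u v)
theorem ev_nil : ev [] = 1 := rfl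
theorem ev_inv (u) : ev (winv u) = (ev u)⁻¹ := Subtype.ext (winv_spec u)
theorem ev_surj (k : KG) : ∃ w, ev w = k := by
  obtain ⟨_, w, rfl⟩ := k; exact ⟨w, rfl⟩
theorem ev_eq_iff (u v) : ev u = ev v ↔ evP u = evP v := Subtype.ext_iff
theorem KG_torsion (k : KG) : IsOfFinOrder k := by
  obtain ⟨w, rfl⟩ := ev_surj k
  exact Submonoid.isOfFinOrder_coe.1 (torsion_evP w)
theorem ev_gw_injective : Function.Injective fun n => ev (gw n) := fun _ _ h =>
  gw_injective ((ev_eq_iff _ _).1 h)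
theorem primrecRel_ev_eq : PrimrecRel fun u v : List Bool => ev u = ev v :=
  primrecRel_evP_eq.of_eq fun _ _ => (ev_eq_iff _ _).symm

end FH


namespace FH

open MonoidAlgebra

/-- The group ring. -/
abbrev RK := MonoidAlgebra (ZMod 2) KG

theorem RK_two (r : RK) : r + r = 0 := by
  have : (2 : ZMod 2) = 0 := rfl
  rw [← two_smul (ZMod 2) r, this, zero_smul]

theorem RK_neg (r : RK) : -r = r := by
  rw [neg_eq_iff_add_eq_zero, RK_two]

/-- group elements in the group ring -/
noncomputable abbrev ofK (k : KG) : RK := MonoidAlgebra.of (ZMod 2) KG k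

theorem ofK_one : ofK 1 = 1 := map_one _

/-- The triangular matrix group. -/
@[ext] structure HH where
  s : RK
  k : KG
  t : RK
  c : RK

namespace HH

noncomputable instance : Mul HH :=
  ⟨fun x y => ⟨y.s + x.s * ofK y.k, x.k * y.k, ofK x.k * y.t + x.t, y.c + x.s * y.t + x.c⟩⟩
noncomputable instance : One HH := ⟨⟨0, 1, 0, 0⟩⟩
noncomputable instance : Inv HH :=
  ⟨fun x => ⟨-(x.s * ofK x.k⁻¹), x.k⁻¹, -(ofK x.k⁻¹ * x.t), -x.c + x.s * ofK x.k⁻¹ * x.t⟩⟩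

theorem mul_def (x y : HH) : x * y =
  ⟨y.s + x.s * ofK y.k, x.k * y.k, ofK x.k * y.t + x.t, y.c + x.s * y.t + x.c⟩ := rfl
theorem one_def : (1 : HH) = ⟨0, 1, 0, 0⟩ := rfl
theorem inv_def (x : HH) : x⁻¹ =
  ⟨-(x.s * ofK x.k⁻¹), x.k⁻¹, -(ofK x.k⁻¹ * x.t), -x.c + x.s * ofK x.k⁻¹ * x.t⟩ := rfl

noncomputable instance : Group HH := Group.ofLeftAxioms
  (by
    intro x y z
    simp only [mul_def, map_mul]
    ext1
    · simp only; rw [add_mul, mul_assoc, add_assoc]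
    · simp only [mul_assoc]
    · simp only; rw [mul_add, mul_assoc, add_assoc]
    · simp only; rw [add_mul, mul_add, mul_assoc]; abel)
  (by
    intro x
    simp only [mul_def, one_def, map_one]
    ext1 <;> simp)
  (by
    intro x
    simp only [mul_def, one_def, inv_def]
    have : ofK x.k⁻¹ * ofK x.k = 1 := by rw [← map_mul, inv_mul_cancel, map_one]
    ext1
    · simp only; rw [neg_mul, mul_assoc, this]; simp
    · simp
    · simp
    · simp only; rw [neg_mul]; abel)

theorem torsion (x : HH) : IsOfFinOrder x := by
  obtain ⟨n, hn, hk⟩ := isOfFinOrder_iff_pow_eq_one.1 (KG_torsion x.k)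
  have hpk : ∀ m : ℕ, (x ^ m).k = x.k ^ m := by
    intro m
    induction m with
    | zero => rfl
    | succ m ih => rw [pow_succ, pow_succ, ← ih]; rfl
  have h1 : (x ^ n).k = 1 := by rw [hpk, hk]
  refine isOfFinOrder_iff_pow_eq_one.2 ⟨n * 2 * 2, by omega, ?_⟩
  rw [pow_mul, pow_mul]
  generalize x ^ n = y at h1
  have h2 : y ^ 2 = ⟨0, 1, 0, y.s * y.t⟩ := by
    rw [pow_two, mul_def, h1, ofK_one]
    ext1
    · simp only; rw [mul_one, RK_two]
    · simp
    · simp only; rw [one_mul, RK_two]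
    · simp only; rw [add_right_comm, RK_two, zero_add]
  rw [h2, pow_two, mul_def, one_def]
  ext1 <;> simp [RK_two]

/-- the central subgroup -/
noncomputable def Z : Subgroup HH where
  carrier := {x | x.s = 0 ∧ x.k = 1 ∧ x.t = 0}
  mul_mem' := by
    rintro x y ⟨h1, h2, h3⟩ ⟨h4, h5, h6⟩
    refine ⟨?_, ?_, ?_⟩ <;> simp [mul_def, *]
  one_mem' := ⟨rfl, rfl, rfl⟩
  inv_mem' := by
    rintro x ⟨h1, h2, h3⟩
    refine ⟨?_, ?_, ?_⟩ <;> simp [inv_def, *]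

theorem mem_Z (x : HH) : x ∈ Z ↔ x.s = 0 ∧ x.k = 1 ∧ x.t = 0 := Iff.rfl

theorem Z_comm (z x : HH) (hz : z ∈ Z) : z * x = x * z := by
  obtain ⟨h1, h2, h3⟩ := hz
  rw [mul_def, mul_def, h1, h2, h3, ofK_one]
  ext1 <;> simp [add_comm]

/-- central elements -/
noncomputable def zz (c : RK) : HH := ⟨0, 1, 0, c⟩

theorem zz_mem (c : RK) : zz c ∈ Z := ⟨rfl, rfl, rfl⟩
theorem zz_mul (c d : RK) : zz c * zz d = zz (c + d) := by
  rw [mul_def]; ext1 <;> simp [zz, add_comm]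

end HH

theorem finite_closure_of_central {H : Type*} [Group H] (ht : ∀ x : H, IsOfFinOrder x)
    (X : Set H) (hX : X.Finite) (hc : ∀ z ∈ X, ∀ x : H, z * x = x * z) :
    ((Subgroup.closure X : Subgroup H) : Set H).Finite := by
  have hcen : Subgroup.closure X ≤ Subgroup.center H := by
    rw [Subgroup.closure_le]
    intro z hz
    exact Subgroup.mem_center_iff.2 fun x => (hc z hz x).symm
  let _ : CommGroup (Subgroup.closure X) :=
    { (inferInstance : Group (Subgroup.closure X)) with
      mul_comm := fun a b => Subtype.ext (Subgroup.mem_center_iff.1 (hcen b.2) a.1) }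
  have : Group.FG (Subgroup.closure X) := by
    have := (Subgroup.fg_iff (Subgroup.closure X)).2 ⟨X, rfl, hX⟩
    exact (Group.fg_iff_subgroup_fg _).2 this
  have hfin : Finite (Subgroup.closure X) := by
    apply CommGroup.finite_of_fg_isMulTorsion
    intro x
    exact Submonoid.isOfFinOrder_coe.1 (ht x.1)
  exact Set.toFinite _

/-- The big group. -/
abbrev PG := HH × Multiplicative ℤ

/-- central subgroup of the big group -/
noncomputable def ZP : Subgroup PG := HH.Z.prod ⊥

theorem mem_ZP (x : PG) : x ∈ ZP ↔ x.1 ∈ HH.Z ∧ x.2 = 1 := by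
  simp [ZP, Subgroup.mem_prod]

theorem ZP_comm (z x : PG) (hz : z ∈ ZP) : z * x = x * z := by
  rw [mem_ZP] at hz
  ext1
  · exact HH.Z_comm _ _ hz.1
  · simp [hz.2]

/-- the central elements `u n` -/
noncomputable def uu (n : ℕ) : PG := (HH.zz (ofK (ev (gw n))), 1)

theorem uu_mem (n : ℕ) : uu n ∈ ZP := (mem_ZP _).2 ⟨HH.zz_mem _, rfl⟩

theorem uu_sq (n : ℕ) : uu n * uu n = 1 := by
  ext1
  · change HH.zz _ * HH.zz _ = 1
    rw [HH.zz_mul, RK_two]; rfl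
  · rfl

/-- The subgroups `N_B`. -/
noncomputable def NN (B : Set ℕ) : Subgroup PG := Subgroup.closure (uu '' B)

theorem NN_le (B : Set ℕ) : NN B ≤ ZP := by
  rw [NN, Subgroup.closure_le]
  rintro _ ⟨n, _, rfl⟩
  exact uu_mem n

theorem NN_mono {B C : Set ℕ} (h : B ⊆ C) : NN B ≤ NN C :=
  Subgroup.closure_mono (Set.image_mono h)

theorem NN_supp (B : Set ℕ) (x : PG) (hx : x ∈ NN B) (n : ℕ) (hn : n ∉ B) :
    x.1.c.coeff (ev (gw n)) = 0 := by
  have : x ∈ ZP ∧ x.1.c.coeff (ev (gw n)) = 0 := by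
    induction hx using Subgroup.closure_induction with
    | mem x hx =>
      obtain ⟨m, hm, rfl⟩ := hx
      refine ⟨uu_mem m, ?_⟩
      have : ev (gw m) ≠ ev (gw n) := fun h => hn (ev_gw_injective h ▸ hm)
      simp [uu, HH.zz, this]
    | one => exact ⟨ZP.one_mem, by simp [HH.one_def]⟩
    | mul x y _ _ hx hy =>
      refine ⟨ZP.mul_mem hx.1 hy.1, ?_⟩
      have h1 := (mem_ZP _).1 hx.1
      have h2 := h1.1.1
      simp [HH.mul_def, h2, hx.2, hy.2]
    | inv x _ hx =>
      refine ⟨ZP.inv_mem hx.1, ?_⟩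
      have h1 := (mem_ZP _).1 hx.1
      have h2 := h1.1.1
      simp [HH.inv_def, h2, hx.2]
  exact this.2

theorem uu_mem_NN (B : Set ℕ) (n : ℕ) : uu n ∈ NN B ↔ n ∈ B := by
  constructor
  · intro h
    by_contra hn
    have := NN_supp B _ h n hn
    simp [uu, HH.zz] at this
  · intro h
    exact Subgroup.subset_closure ⟨n, h, rfl⟩

theorem NN_list (B : Set ℕ) (x : PG) :
    x ∈ NN B ↔ ∃ l : List ℕ, (∀ n ∈ l, n ∈ B) ∧ x * (l.map uu).prod = 1 := by
  constructor
  · intro hx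
    induction hx using Subgroup.closure_induction with
    | mem x hx =>
      obtain ⟨m, hm, rfl⟩ := hx
      exact ⟨[m], by simpa using hm, by simpa using uu_sq m⟩
    | one => exact ⟨[], by simp, by simp⟩
    | mul x y hx hy ihx ihy =>
      obtain ⟨l, hl, h1⟩ := ihx
      obtain ⟨m, hm, h2⟩ := ihy
      refine ⟨m ++ l, ?_, ?_⟩
      · intro n hn
        rcases List.mem_append.1 hn with h | h
        exacts [hm n h, hl n h]
      · rw [List.map_append, List.prod_append, mul_assoc x y, ← mul_assoc y, h2, one_mul, h1]
    | inv x hx ih =>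
      obtain ⟨l, hl, h1⟩ := ih
      refine ⟨l.reverse, by simpa using hl, ?_⟩
      have h3 : ∀ l : List ℕ, (l.map uu).prod * (l.reverse.map uu).prod = 1 := by
        intro l
        induction l with
        | nil => simp
        | cons a l ih =>
          simp only [List.map_cons, List.prod_cons, List.reverse_cons, List.map_append,
            List.prod_append, List.map_nil, List.prod_nil, mul_one]
          rw [mul_assoc, ← mul_assoc (l.map uu).prod, ih, one_mul, uu_sq]
      have h4 := h3 l
      rw [mul_eq_one_iff_inv_eq] at h1
      rw [h1, h4]
  · rintro ⟨l, hl, h⟩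
    rw [mul_eq_one_iff_eq_inv] at h
    rw [h]
    apply Subgroup.inv_mem
    apply Subgroup.list_prod_mem
    intro y hy
    obtain ⟨n, hn, rfl⟩ := List.mem_map.1 hy
    exact (uu_mem_NN B n).2 (hl n hn)

theorem NN_finite_sub (A : Set ℕ) (X : Set PG) (hX : X.Finite) :
    ∃ B : Set ℕ, B.Finite ∧ B ⊆ A ∧ ∀ x ∈ X, x ∈ NN A → x ∈ NN B := by
  have : ∀ x : PG, ∃ B : Set ℕ, B.Finite ∧ B ⊆ A ∧ (x ∈ NN A → x ∈ NN B) := by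
    intro x
    by_cases hx : x ∈ NN A
    · obtain ⟨l, hl, h⟩ := (NN_list A x).1 hx
      exact ⟨{n | n ∈ l}, List.finite_toSet l, hl, fun _ => (NN_list _ x).2 ⟨l, fun _ h => h, h⟩⟩
    · exact ⟨∅, Set.finite_empty, Set.empty_subset _, fun h => absurd h hx⟩
  choose B h1 h2 h3 using this
  refine ⟨⋃ x ∈ X, B x, hX.biUnion fun x _ => h1 x, Set.iUnion₂_subset fun x _ => h2 x, ?_⟩
  intro x hx hxA
  exact NN_mono (Set.subset_biUnion_of_mem hx) (h3 x hxA)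

theorem NN_finite (B : Set ℕ) (hB : B.Finite) : (NN B : Set PG).Finite := by
  have h := finite_closure_of_central HH.torsion ((fun n => (uu n).1) '' B) (hB.image _) (by
    rintro _ ⟨n, _, rfl⟩ x
    exact HH.Z_comm _ _ (HH.zz_mem _))
  refine (h.image fun x => ((x, 1) : PG)).subset ?_
  intro x hx
  have h2 := ((mem_ZP _).1 (NN_le B hx)).2
  refine ⟨x.1, ?_, by rw [← h2]⟩
  change x.1 ∈ Subgroup.closure _
  rw [NN] at hx
  have : (uu '' B : Set PG) ⊆
      ((Subgroup.closure ((fun n => (uu n).1) '' B)).comap (MonoidHom.fst _ _) : Subgroup PG) := by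
    rintro _ ⟨n, hn, rfl⟩
    exact Subgroup.subset_closure ⟨n, hn, rfl⟩
  exact (Subgroup.closure_le _).2 this hx

theorem NN_infinite (A : Set ℕ) (hA : ∀ n, 2 * n + 1 ∉ A) (X : Set PG) (hX : X.Finite) :
    ∃ z ∈ ZP, ∀ x ∈ X, x⁻¹ * z ∉ NN A := by
  by_contra hcon
  push Not at hcon
  have h1 := fun n : ℕ => hcon (uu (2 * n + 1)) (uu_mem _)
  choose f hf hf2 using h1
  have : ∃ m n, m ≠ n ∧ f m = f n := by
    by_contra hc
    push Not at hc
    have hinj : Function.Injective f := fun m n h => by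
      by_contra hmn; exact hc m n hmn h
    exact Set.infinite_of_injective_forall_mem hinj hf hX
  obtain ⟨m, n, hmn, he⟩ := this
  have h2 := (NN A).mul_mem ((NN A).inv_mem (hf2 m)) (hf2 n)
  rw [he] at h2
  have h3 : (uu (2 * m + 1))⁻¹ * uu (2 * n + 1) ∈ NN A := by
    convert h2 using 1; group
  have h4 : (uu (2 * m + 1))⁻¹ = uu (2 * m + 1) := inv_eq_of_mul_eq_one_right (uu_sq _)
  rw [h4] at h3
  have h5 := NN_supp A _ h3 _ (hA m)
  have h6 : ev (gw (2 * n + 1)) ≠ ev (gw (2 * m + 1)) := fun h => by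
    have := ev_gw_injective h; omega
  simp [uu, HH.mul_def, HH.zz, h6] at h5

end FH


namespace FH

/-- words in the generators of the big group -/
abbrev W5 := List (Fin 5 × Bool)

/-- the generators of the big group -/
noncomputable def genP : Fin 5 → PG :=
  ![(⟨1, 1, 0, 0⟩, 1), (⟨0, 1, 1, 0⟩, 1), (⟨0, ev [false], 0, 0⟩, 1), (⟨0, ev [true], 0, 0⟩, 1),
    (1, Multiplicative.ofAdd 1)]

/-- evaluation of words -/
noncomputable def evW (w : W5) : PG := evalWord genP w

theorem evalWord_append {K : Type*} [Group K] {m : ℕ} (gen : Fin m → K) (u v) :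
    evalWord gen (u ++ v) = evalWord gen u * evalWord gen v := by
  simp [evalWord]

theorem evW_append (u v : W5) : evW (u ++ v) = evW u * evW v := evalWord_append _ _ _

/-- formal inverse of a word -/
def inv5 (w : W5) : W5 := w.reverse.map fun l => (l.1, !l.2)

theorem evW_inv (w : W5) : evW (inv5 w) = (evW w)⁻¹ := by
  have h : ∀ l : Fin 5 × Bool, evW [(l.1, !l.2)] = (evW [l])⁻¹ := by
    rintro ⟨i, b⟩
    cases b <;> simp [evW, evalWord]
  induction w with
  | nil => simp [inv5, evW, evalWord]
  | cons l w ih =>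
    have e1 : inv5 (l :: w) = inv5 w ++ [(l.1, !l.2)] := by simp [inv5]
    have e2 : l :: w = [l] ++ w := rfl
    rw [e1, e2, evW_append, evW_append, ih, h, mul_inv_rev]

/-- states of the evaluation procedure -/
abbrev WS := List (List Bool) × List (List Bool) × List (List Bool) × List Bool × ℕ × ℕ

/-- multiply by an element of `KG` -/
def wsK (s : WS) (v : List Bool) : WS :=
  (s.1.map (· ++ v), s.2.1, s.2.2.1, s.2.2.2.1 ++ v, s.2.2.2.2)

/-- step of the evaluation procedure -/
def wsStep (s : WS) (l : Fin 5 × Bool) : WS :=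
  if l.1 = 0 then ([] :: s.1, s.2) else
  if l.1 = 1 then (s.1, s.2.2.2.1 :: s.2.1, s.1 ++ s.2.2.1, s.2.2.2) else
  if l.1 = 2 then wsK s (if l.2 then [false] else [false, false]) else
  if l.1 = 3 then wsK s (if l.2 then [true] else [true, true]) else
  (s.1, s.2.1, s.2.2.1, s.2.2.2.1, if l.2 then (s.2.2.2.2.1 + 1, s.2.2.2.2.2) else
    (s.2.2.2.2.1, s.2.2.2.2.2 + 1))

/-- value of a list of group elements -/
noncomputable def vL (L : List (List Bool)) : RK := (L.map fun v => ofK (ev v)).sum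

theorem vL_cons (v L) : vL (v :: L) = ofK (ev v) + vL L := rfl
theorem vL_append (L M) : vL (L ++ M) = vL L + vL M := by simp [vL]
theorem vL_map (L v) : vL (L.map (· ++ v)) = vL L * ofK (ev v) := by
  induction L with
  | nil => simp [vL]
  | cons u L ih => rw [List.map_cons, vL_cons, vL_cons, ih, add_mul, ev_append, ofK, map_mul]

/-- value of a state -/
noncomputable def vS (s : WS) : PG :=
  (⟨vL s.1, ev s.2.2.2.1, vL s.2.1, vL s.2.2.1⟩,
    Multiplicative.ofAdd ((s.2.2.2.2.1 : ℤ) - s.2.2.2.2.2))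

theorem vS_K (s : WS) (v : List Bool) : vS (wsK s v) = vS s * (⟨0, ev v, 0, 0⟩, 1) := by
  ext1
  · simp only [vS, wsK, HH.mul_def, Prod.mk_mul_mk, vL_map, ev_append]
    ext1 <;> simp
  · simp [vS, wsK]

theorem kk_inv (k : KG) : (⟨0, k, 0, 0⟩ : HH)⁻¹ = ⟨0, k⁻¹, 0, 0⟩ := by
  rw [HH.inv_def]; ext1 <;> simp

theorem vS_step (s : WS) (l : Fin 5 × Bool) : vS (wsStep s l) = vS s * evW [l] := by
  obtain ⟨i, b⟩ := l
  have hev : evW [(i, b)] = if b then genP i else (genP i)⁻¹ := by simp [evW, evalWord]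
  rw [hev]
  fin_cases i
  · have h1 : (⟨1, 1, 0, 0⟩ : HH)⁻¹ = ⟨1, 1, 0, 0⟩ := by
      rw [inv_eq_iff_mul_eq_one, HH.mul_def, HH.one_def, ofK_one]; ext1 <;> simp [RK_two]
    have h2 : (if b then genP 0 else (genP 0)⁻¹) = (⟨1, 1, 0, 0⟩, 1) := by
      cases b
      · exact Prod.ext h1 inv_one
      · simp [genP]
    refine Eq.trans ?_ (congrArg (vS s * ·) h2.symm)
    simp only [wsStep, vS]
    ext1
    · simp only [HH.mul_def, Prod.mk_mul_mk, ofK_one]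
      ext1
      · simp [vL_cons, ev_nil, ← MonoidAlgebra.one_def]
      all_goals simp
    · simp
  · have h1 : (⟨0, 1, 1, 0⟩ : HH)⁻¹ = ⟨0, 1, 1, 0⟩ := by
      rw [inv_eq_iff_mul_eq_one, HH.mul_def, HH.one_def, ofK_one]; ext1 <;> simp [RK_two]
    have h2 : (if b then genP 1 else (genP 1)⁻¹) = (⟨0, 1, 1, 0⟩, 1) := by
      cases b
      · exact Prod.ext h1 inv_one
      · simp [genP]
    refine Eq.trans ?_ (congrArg (vS s * ·) h2.symm)
    simp only [wsStep, vS]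
    ext1
    · simp only [HH.mul_def, Prod.mk_mul_mk, ofK_one]
      ext1 <;> simp [vL_cons, vL_append]
    · simp
  · have h2 : (if b then genP 2 else (genP 2)⁻¹) =
        (⟨0, ev (if b then [false] else [false, false]), 0, 0⟩, 1) := by
      cases b
      · simp only [genP]
        refine Prod.ext ((kk_inv _).trans ?_) (by simp)
        rw [← ev_inv]; rfl
      · simp [genP]
    refine Eq.trans ?_ (congrArg (vS s * ·) h2.symm)
    exact vS_K _ _
  · have h2 : (if b then genP 3 else (genP 3)⁻¹) =
        (⟨0, ev (if b then [true] else [true, true]), 0, 0⟩, 1) := by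
      cases b
      · simp only [genP]
        refine Prod.ext ((kk_inv _).trans ?_) (by simp)
        rw [← ev_inv]; rfl
      · simp [genP]
    refine Eq.trans ?_ (congrArg (vS s * ·) h2.symm)
    exact vS_K _ _
  · have h2 : (if b then genP 4 else (genP 4)⁻¹) =
        (1, Multiplicative.ofAdd (if b then 1 else -1)) := by
      cases b <;> simp [genP]
    refine Eq.trans ?_ (congrArg (vS s * ·) h2.symm)
    cases b
    · ext1
      · simp [vS, wsStep]
      · exact congrArg Multiplicative.ofAdd (by
          simp [wsStep, vS]
          ring)
    · ext1
      · simp [vS, wsStep]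
      · exact congrArg Multiplicative.ofAdd (by
          simp [wsStep, vS]
          ring)

/-- evaluation -/
def wsEval (w : W5) : WS := w.foldl wsStep ([], [], [], [], 0, 0)

theorem wsEval_spec (w : W5) : evW w = vS (wsEval w) := by
  have h : ∀ (w : W5) s, vS (w.foldl wsStep s) = vS s * evW w := by
    intro w
    induction w with
    | nil => intro s; simp [evW, evalWord]
    | cons l w ih =>
      intro s
      rw [List.foldl_cons, ih, vS_step, mul_assoc, ← evW_append]; rfl
  rw [wsEval, h]
  have : vS ([], [], [], [], 0, 0) = 1 := by
    ext1
    · simp [vS, vL, ev_nil, HH.one_def]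
    · simp [vS]
  rw [this, one_mul]

theorem primrec_wsK : Primrec₂ wsK := by
  unfold wsK
  refine Primrec.pair (Primrec.list_map (Primrec.fst.comp Primrec.fst)
    (Primrec.list_append.comp Primrec.snd (Primrec.snd.comp Primrec.fst)).to₂) ?_
  have h2 : Primrec fun p : WS × List Bool => p.1.2 := Primrec.snd.comp Primrec.fst
  have h22 := Primrec.snd.comp h2
  have h222 := Primrec.snd.comp h22
  exact Primrec.pair (Primrec.fst.comp h2) (Primrec.pair (Primrec.fst.comp h22)
    (Primrec.pair (Primrec.list_append.comp (Primrec.fst.comp h222) Primrec.snd)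
      (Primrec.snd.comp h222)))

theorem primrec_wsStep : Primrec₂ wsStep := by
  unfold wsStep
  have h2 : Primrec fun p : WS × (Fin 5 × Bool) => p.1.2 := Primrec.snd.comp Primrec.fst
  have h1 : Primrec fun p : WS × (Fin 5 × Bool) => p.1.1 := Primrec.fst.comp Primrec.fst
  have h22 := Primrec.snd.comp h2
  have h222 := Primrec.snd.comp h22
  have h2222 := Primrec.snd.comp h222
  have hi : Primrec fun p : WS × (Fin 5 × Bool) => p.2.1 := Primrec.fst.comp Primrec.snd
  have hb : Primrec fun p : WS × (Fin 5 × Bool) => p.2.2 := Primrec.snd.comp Primrec.snd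
  have heq : ∀ c : Fin 5, PrimrecPred fun p : WS × (Fin 5 × Bool) => p.2.1 = c := fun c =>
    PrimrecRel.comp Primrec.eq hi (Primrec.const c)
  have hbt : PrimrecPred fun p : WS × (Fin 5 × Bool) => p.2.2 = true :=
    PrimrecRel.comp Primrec.eq hb (Primrec.const true)
  refine Primrec.ite (heq 0) ?_ (Primrec.ite (heq 1) ?_ (Primrec.ite (heq 2) ?_
    (Primrec.ite (heq 3) ?_ ?_)))
  · exact Primrec.pair (Primrec.list_cons.comp (Primrec.const []) h1) h2
  · exact Primrec.pair h1 (Primrec.pair (Primrec.list_cons.comp (Primrec.fst.comp h222)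
      (Primrec.fst.comp h2)) (Primrec.pair (Primrec.list_append.comp h1 (Primrec.fst.comp h22)) h222))
  · exact primrec_wsK.comp Primrec.fst (Primrec.ite hbt (Primrec.const _) (Primrec.const _))
  · exact primrec_wsK.comp Primrec.fst (Primrec.ite hbt (Primrec.const _) (Primrec.const _))
  · refine Primrec.pair h1 (Primrec.pair (Primrec.fst.comp h2) (Primrec.pair (Primrec.fst.comp h22)
      (Primrec.pair (Primrec.fst.comp h222) (Primrec.ite hbt ?_ ?_))))
    · exact Primrec.pair (Primrec.succ.comp (Primrec.fst.comp h2222)) (Primrec.snd.comp h2222)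
    · exact Primrec.pair (Primrec.fst.comp h2222) (Primrec.succ.comp (Primrec.snd.comp h2222))

theorem primrec_wsEval : Primrec wsEval := by
  unfold wsEval
  exact Primrec.list_foldl Primrec.id (Primrec.const _) (primrec_wsStep.comp
    (Primrec.fst.comp Primrec.snd) (Primrec.snd.comp Primrec.snd)).to₂

open Classical in
/-- parity -/
noncomputable def par (v : List Bool) (L : List (List Bool)) : Bool :=
  L.foldl (fun acc u => if ev u = ev v then !acc else acc) false

open Classical in
theorem par_spec (v : List Bool) (L : List (List Bool)) :
    (vL L).coeff (ev v) = cond (par v L) 1 0 := by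
  have h : ∀ (L : List (List Bool)) (acc : Bool), (vL L).coeff (ev v) + (cond acc 1 0) =
      cond (L.foldl (fun acc u => if ev u = ev v then !acc else acc) acc) 1 0 := by
    intro L
    induction L with
    | nil => intro acc; simp [vL]
    | cons u L ih =>
      intro acc
      rw [List.foldl_cons, ← ih, vL_cons]
      by_cases hu : ev u = ev v
      · have h11 : (1 : ZMod 2) + 1 = 0 := rfl
        cases acc
        · simp [hu, add_comm]
        · simp only [hu, if_true]
          simp
          rw [add_right_comm, h11, zero_add]
      · simp [hu]
  have := h L false
  simpa [par] using this

theorem vL_zero_iff (L : List (List Bool)) : vL L = 0 ↔ ∀ v ∈ L, par v L = false := by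
  classical
  constructor
  · intro h v _
    have := par_spec v L
    rw [h] at this
    by_contra hc
    simp at hc
    simp [hc] at this
  · intro h
    ext k
    by_cases hk : ∃ v ∈ L, ev v = k
    · obtain ⟨v, hv, rfl⟩ := hk
      rw [par_spec, h v hv]; simp
    · push Not at hk
      obtain ⟨v, rfl⟩ := ev_surj k
      have : ∀ L : List (List Bool), (∀ u ∈ L, ev u ≠ ev v) → (vL L).coeff (ev v) = 0 := by
        intro L
        induction L with
        | nil => intro _; simp [vL]
        | cons u L ih =>
          intro h
          have h1 := h u (by simp)
          rw [vL_cons]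
          simp [h1, ih fun w hw => h w (List.mem_cons_of_mem _ hw)]
      rw [this L hk]; simp

theorem primrec_par : Primrec₂ par := by
  classical
  have : Primrec₂ fun (v : List Bool) (L : List (List Bool)) =>
      L.foldl (fun acc u => if ev u = ev v then !acc else acc) false := by
    refine Primrec.list_foldl (f := fun p : List Bool × List (List Bool) => p.2)
      (g := fun _ => false) (h := fun p x => if ev x.2 = ev p.1 then !x.1 else x.1)
      Primrec.snd (Primrec.const _) ?_
    have hr : PrimrecPred fun a : (List Bool × List (List Bool)) × (Bool × List Bool) =>
        ev a.2.2 = ev a.1.1 := primrecRel_ev_eq.comp (Primrec.snd.comp Primrec.snd)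
      (Primrec.fst.comp Primrec.fst)
    have hf : Primrec fun a : (List Bool × List (List Bool)) × (Bool × List Bool) =>
        a.2.1 := Primrec.fst.comp Primrec.snd
    exact Primrec.to₂ (Primrec.ite hr (Primrec.not.comp hf) hf)
  refine this.of_eq fun v L => ?_
  unfold par
  congr!

theorem primrecPred_vL : PrimrecPred fun L : List (List Bool) => vL L = 0 := by
  have h1 : PrimrecRel fun (v : List Bool) (L : List (List Bool)) => par v L = false :=
    PrimrecRel.comp (Primrec.eq (α := Bool)) primrec_par (Primrec.const false)
  have h2 := PrimrecRel.forall_mem_list h1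
  exact (h2.comp (Primrec.id (α := List (List Bool))) Primrec.id).of_eq fun L =>
    (vL_zero_iff L).symm

theorem primrecPred_Z : PrimrecPred fun w : W5 => (evW w).1 ∈ HH.Z := by
  have h2 := Primrec.snd.comp primrec_wsEval
  have h222 := Primrec.snd.comp (Primrec.snd.comp h2)
  have := (primrecPred_vL.comp (Primrec.fst.comp primrec_wsEval)).and
    (((primrecRel_ev_eq.comp (Primrec.fst.comp h222) (Primrec.const ([] : List Bool)))).and
      (primrecPred_vL.comp (Primrec.fst.comp h2)))
  refine this.of_eq fun w => ?_
  rw [HH.mem_Z, wsEval_spec]; rfl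

theorem primrecPred_evW : PrimrecPred fun w : W5 => evW w = 1 := by
  have h2 := Primrec.snd.comp primrec_wsEval
  have h22 := Primrec.snd.comp h2
  have h222 := Primrec.snd.comp (Primrec.snd.comp h2)
  have h2222 := Primrec.snd.comp h222
  have := primrecPred_Z.and ((primrecPred_vL.comp (Primrec.fst.comp h22)).and
    (PrimrecRel.comp Primrec.eq (Primrec.fst.comp h2222) (Primrec.snd.comp h2222)))
  refine this.of_eq fun w => ?_
  rw [HH.mem_Z, wsEval_spec]
  simp only [vS, Prod.ext_iff, HH.ext_iff, HH.one_def, Prod.fst_one, Prod.snd_one]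
  have : Multiplicative.ofAdd (((wsEval w).2.2.2.2.1 : ℤ) - (wsEval w).2.2.2.2.2) = 1 ↔
      (wsEval w).2.2.2.2.1 = (wsEval w).2.2.2.2.2 := by
    rw [ofAdd_eq_one]; omega
  rw [this]; tauto

theorem primrecRel_height : PrimrecRel fun (w : W5) (d : ℕ) =>
    (evW w).2 = Multiplicative.ofAdd (d : ℤ) := by
  have h2222 := Primrec.snd.comp (Primrec.snd.comp (Primrec.snd.comp
    (Primrec.snd.comp primrec_wsEval)))
  have : PrimrecRel fun (w : W5) (d : ℕ) =>
      (wsEval w).2.2.2.2.1 = (wsEval w).2.2.2.2.2 + d :=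
    PrimrecRel.comp Primrec.eq ((Primrec.fst.comp h2222).comp (Primrec.fst (α := W5) (β := ℕ)))
    (Primrec.nat_add.comp ((Primrec.snd.comp h2222).comp Primrec.fst) Primrec.snd)
  refine PrimrecRel.of_eq this fun w d => ?_
  rw [wsEval_spec]
  simp only [vS]
  rw [Multiplicative.ofAdd.injective.eq_iff]
  omega

open Classical in
/-- the configurations on the big group -/
noncomputable def env (d : ℕ) (x : PG) : Fin 3 :=
  if x.1 ∈ HH.Z then if x.2 = Multiplicative.ofAdd ((0 : ℕ) : ℤ) then 1 else
    if x.2 = Multiplicative.ofAdd (d : ℤ) then 2 else 0 else 0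

theorem primrec_env : Primrec₂ fun (d : ℕ) (w : W5) => env d (evW w) := by
  classical
  unfold env
  refine Primrec.ite (primrecPred_Z.comp Primrec.snd) (Primrec.ite ?_ (Primrec.const _)
    (Primrec.ite ?_ (Primrec.const _) (Primrec.const _))) (Primrec.const _)
  · exact primrecRel_height.comp Primrec.snd (Primrec.const 0)
  · exact primrecRel_height.comp Primrec.snd Primrec.fst

theorem evW_surj (x : PG) : ∃ w : W5, evW w = x := by
  have hK : ∀ k : KG, ∃ w : W5, evW w = (⟨0, k, 0, 0⟩, 1) := by
    intro k
    obtain ⟨v, rfl⟩ := ev_surj k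
    induction v with
    | nil => exact ⟨[], rfl⟩
    | cons b v ih =>
      obtain ⟨w, hw⟩ := ih
      refine ⟨(if b then 3 else 2, true) :: w, ?_⟩
      have : ((if b then 3 else 2, true) :: w : W5) = [(if b then 3 else 2, true)] ++ w := rfl
      rw [this, evW_append, hw]
      have h2 : evW [(if b then 3 else 2, true)] = (⟨0, ev [b], 0, 0⟩, 1) := by
        cases b <;> simp [evW, evalWord, genP]
      rw [h2]
      ext1
      · simp only [Prod.mk_mul_mk, HH.mul_def, ← ev_append]
        ext1 <;> simp
      · simp
  have hmul : ∀ x y : PG, (∃ w, evW w = x) → (∃ w, evW w = y) → ∃ w, evW w = x * y := by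
    rintro _ _ ⟨u, rfl⟩ ⟨v, rfl⟩
    exact ⟨u ++ v, evW_append u v⟩
  have cvt : ∀ x y : PG, x = y → (∃ w, evW w = y) → ∃ w, evW w = x := by
    rintro x _ rfl h; exact h
  have hinv : ∀ x : PG, (∃ w, evW w = x) → ∃ w, evW w = x⁻¹ := by
    rintro _ ⟨u, rfl⟩
    exact ⟨inv5 u, evW_inv u⟩
  have ha : ∃ w, evW w = (⟨1, 1, 0, 0⟩, 1) := ⟨[(0, true)], by simp [evW, evalWord, genP]⟩
  have hb : ∃ w, evW w = (⟨0, 1, 1, 0⟩, 1) := ⟨[(1, true)], by simp [evW, evalWord, genP]⟩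
  have hRK : ∀ (p : RK → Prop), p 0 → (∀ k, p (ofK k)) → (∀ x y, p x → p y → p (x + y)) → ∀ x, p x := by
    intro p h0 h1 h2 x
    induction x using MonoidAlgebra.induction_on with
    | of k => exact h1 k
    | add x y hx hy => exact h2 x y hx hy
    | smul r x hx =>
      have : r = 0 ∨ r = 1 := by revert r; decide
      rcases this with rfl | rfl
      · simpa using h0
      · simpa using hx
  have hT : ∀ t : RK, ∃ w, evW w = (⟨0, 1, t, 0⟩, 1) := by
    apply hRK
    · exact ⟨[], rfl⟩
    · intro k
      refine cvt _ _ ?_ (hmul _ _ (hmul _ _ (hK k) hb) (hK k⁻¹))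
      ext1
      · simp only [Prod.mk_mul_mk, HH.mul_def]
        ext1 <;> simp
      · simp
    · intro x y hx hy
      refine cvt _ _ ?_ (hmul _ _ hx hy)
      ext1
      · simp only [Prod.mk_mul_mk, HH.mul_def]
        ext1 <;> simp [← MonoidAlgebra.one_def, add_comm]
      · simp
  have hS : ∀ s : RK, ∃ w, evW w = (⟨s, 1, 0, 0⟩, 1) := by
    apply hRK
    · exact ⟨[], rfl⟩
    · intro k
      refine cvt _ _ ?_ (hmul _ _ (hmul _ _ (hK k⁻¹) ha) (hK k))
      ext1
      · simp only [Prod.mk_mul_mk, HH.mul_def]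
        ext1 <;> simp
      · simp
    · intro x y hx hy
      refine cvt _ _ ?_ (hmul _ _ hx hy)
      ext1
      · simp only [Prod.mk_mul_mk, HH.mul_def]
        ext1 <;> simp [← MonoidAlgebra.one_def, add_comm]
      · simp
  have hC : ∀ c : RK, ∃ w, evW w = (⟨0, 1, 0, c⟩, 1) := by
    intro c
    refine cvt _ _ ?_ (hmul _ _ (hmul _ _ (hmul _ _ (hS 1) (hT c)) (hS 1)) (hT c))
    ext1
    · simp only [Prod.mk_mul_mk, HH.mul_def]
      ext1 <;> simp [← MonoidAlgebra.one_def, RK_two]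
    · simp
  have hz : ∀ z : ℤ, ∃ w, evW w = (1, Multiplicative.ofAdd z) := by
    have ht : ∃ w, evW w = (1, Multiplicative.ofAdd 1) := ⟨[(4, true)], by simp [evW, evalWord, genP]⟩
    intro z
    induction z with
    | zero => exact ⟨[], rfl⟩
    | succ n ih =>
      refine cvt _ _ ?_ (hmul _ _ ih ht)
      exact Prod.ext (one_mul 1).symm rfl
    | pred n ih =>
      refine cvt _ _ ?_ (hmul _ _ ih (hinv _ ht))
      exact Prod.ext (by simp) rfl
  obtain ⟨⟨s, k, t, c⟩, z⟩ := x
  refine cvt _ _ ?_ (hmul _ _ (hmul _ _ (hmul _ _ (hmul _ _ (hC c) (hT t)) (hK k)) (hS s))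
    (hz z.toAdd))
  ext1
  · simp only [Prod.mk_mul_mk, HH.mul_def]
    ext1 <;> simp [← MonoidAlgebra.one_def, HH.one_def]
  · simp

/-- word for `u n` -/
def uw (n : ℕ) : W5 :=
  let g : W5 := (gw n).map fun b => (if b then 3 else 2, true)
  let h : W5 := (winv (gw n)).map fun b => (if b then 3 else 2, true)
  (0, true) :: (g ++ (1, true) :: (h ++ (0, true) :: (g ++ (1, true) :: h)))

theorem evW_K (v : List Bool) : evW (v.map fun b => (if b then 3 else 2, true)) =
    (⟨0, ev v, 0, 0⟩, 1) := by
  induction v with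
  | nil => rfl
  | cons b v ih =>
    have e : (List.map (fun b : Bool => ((if b then 3 else 2, true) : Fin 5 × Bool)) (b :: v)) =
       [(if b then 3 else 2, true)] ++ (List.map (fun b => (if b then 3 else 2, true)) v) := rfl
    rw [e, evW_append, ih]
    have h2 : evW [(if b then 3 else 2, true)] = (⟨0, ev [b], 0, 0⟩, 1) := by
      cases b <;> simp [evW, evalWord, genP]
    rw [h2]
    ext1
    · simp only [Prod.mk_mul_mk, HH.mul_def, ← ev_append]
      ext1 <;> simp
    · simp

theorem evW_uw (n : ℕ) : evW (uw n) = uu n := by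
  have hc : ∀ (l : Fin 5 × Bool) (w : W5), evW (l :: w) = evW [l] * evW w := fun l w =>
    evW_append [l] w
  have ha : evW [(0, true)] = (⟨1, 1, 0, 0⟩, 1) := by simp [evW, evalWord, genP]
  have hb : evW [(1, true)] = (⟨0, 1, 1, 0⟩, 1) := by simp [evW, evalWord, genP]
  simp only [uw]
  rw [hc (0, true) (_ ++ _), evW_append, hc (1, true) (_ ++ _), evW_append, hc (0, true) (_ ++ _),
    evW_append, hc (1, true) (List.map _ _), evW_K, evW_K,
    ha, hb, ev_inv, uu]
  ext1
  · simp only [Prod.mk_mul_mk, HH.mul_def, HH.zz]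
    ext1 <;> simp [← MonoidAlgebra.one_def, RK_two]
  · simp

theorem primrec_uw : Primrec uw := by
  unfold uw
  have hg : ∀ f : ℕ → List Bool, Primrec f →
      Primrec fun n => ((f n).map fun b => ((if b then 3 else 2, true) : Fin 5 × Bool)) := fun f hf =>
    Primrec.list_map hf ((Primrec.dom_finite
      (fun b : Bool => ((if b then 3 else 2, true) : Fin 5 × Bool))).comp Primrec.snd).to₂
  have h1 := hg gw primrec_gw
  have h2 := hg (fun n => winv (gw n)) (primrec_winv.comp primrec_gw)
  exact Primrec.list_cons.comp (Primrec.const _) (Primrec.list_append.comp h1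
    (Primrec.list_cons.comp (Primrec.const _) (Primrec.list_append.comp h2
    (Primrec.list_cons.comp (Primrec.const _) (Primrec.list_append.comp h1
    (Primrec.list_cons.comp (Primrec.const _) h2))))))

theorem primrec_inv5 : Primrec inv5 := by
  unfold inv5
  exact Primrec.list_map Primrec.list_reverse (Primrec.pair (Primrec.fst.comp Primrec.snd)
    (Primrec.not.comp (Primrec.snd.comp Primrec.snd))).to₂

theorem primrecPred_finite (X : Set PG) (hX : X.Finite) : PrimrecPred fun w : W5 => evW w ∈ X := by
  induction X, hX using Set.Finite.induction_on with
  | empty => exact (PrimrecPred.of_eq (p := fun w : W5 => (0 : ℕ) = 1)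
      (PrimrecRel.comp Primrec.eq (Primrec.const 0) (Primrec.const 1)) (by simp))
  | @insert x X _ _ ih =>
    obtain ⟨v, hv⟩ := evW_surj x⁻¹
    have := (primrecPred_evW.comp (Primrec.list_append.comp (Primrec.id) (Primrec.const v))).or ih
    refine this.of_eq fun w => ?_
    simp only [id, evW_append, hv, mul_inv_eq_one, Set.mem_insert_iff]

end FH


namespace FH

open Pointwise

section seq
variable {H : Type*} [Group H]

/-- displacement -/
def dsp (h : ℕ → H) (s t : ℕ) : H := (h s)⁻¹ * h t

theorem dsp_mul (h : ℕ → H) (s t u : ℕ) : dsp h s t * dsp h t u = dsp h s u := by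
  simp [dsp, mul_assoc]

theorem dsp_self (h : ℕ → H) (s : ℕ) : dsp h s s = 1 := by simp [dsp]

/-- the next bounding set -/
def nextS (S0 S : Set H) : Set H :=
  S ∪ ((S * (S0 * S)) ∪ ⋃ c ∈ S0 * S, S * (((Subgroup.zpowers c : Subgroup H) : Set H) * (S0 * S)))

theorem nextS_finite (ht : ∀ x : H, IsOfFinOrder x) {S0 S : Set H} (h0 : S0.Finite) (h : S.Finite) :
    (nextS S0 S).Finite := by
  refine h.union ((h.mul (h0.mul h)).union ?_)
  refine (h0.mul h).biUnion fun c _ => h.mul (Set.Finite.mul ?_ (h0.mul h))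
  exact (finite_zpowers (a := c)).2 (ht c)

/-- the bounding sequence -/
def itS (S0 S : Set H) (n : ℕ) : Set H := (nextS S0)^[n] S

theorem itS_finite (ht : ∀ x : H, IsOfFinOrder x) {S0 S : Set H} (h0 : S0.Finite) (h : S.Finite)
    (n : ℕ) : (itS S0 S n).Finite := by
  induction n with
  | zero => exact h
  | succ n ih => rw [itS, Function.iterate_succ_apply']; exact nextS_finite ht h0 ih

theorem lemmaR_step (S0 S : Set H) (h : ℕ → H) (P : ℕ → Prop) (Rl : ℕ → ℕ → Prop)
    (b : ℕ) (a : ℕ)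
    (h0 : ∀ τ, a ≤ τ → τ < b → dsp h τ (τ + 1) ∈ S0)
    (hS : ∀ s t, a ≤ s → s ≤ t → t ≤ b → (∀ τ, s ≤ τ → τ < t → ¬ P τ) → dsp h s t ∈ S)
    (hP : ∀ τ τ', a ≤ τ → a ≤ τ' → τ < b → τ' < b → P τ → P τ' → Rl τ τ')
    (hR : ∀ τ τ', a ≤ τ → a ≤ τ' → τ < b → τ' < b → Rl τ τ' →
      dsp h τ (τ + 1) = dsp h τ' (τ' + 1) ∧ (τ + 1 < b → τ' + 1 < b → Rl (τ + 1) (τ' + 1))) :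
    ∀ s t, a ≤ s → s ≤ t → t ≤ b → dsp h s t ∈ nextS S0 S := by
  classical
  intro s t has hst htb
  by_cases hex : ∃ τ, s ≤ τ ∧ τ < t ∧ P τ
  swap
  · push Not at hex
    exact Or.inl (hS s t has hst htb hex)
  obtain ⟨τ1, ⟨h1s, h1t, h1P⟩, hmin⟩ : ∃ τ, (s ≤ τ ∧ τ < t ∧ P τ) ∧ ∀ σ, s ≤ σ → σ < τ → ¬ P σ := by
    refine ⟨Nat.find hex, Nat.find_spec hex, fun σ h1 h2 h3 => ?_⟩
    exact Nat.find_min hex h2 ⟨h1, h2.trans (Nat.find_spec hex).2.1, h3⟩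
  right
  have hfirst : dsp h s τ1 ∈ S := hS s τ1 has h1s (by omega) hmin
  have hone : ∀ u, τ1 < u → u ≤ b → (∀ σ, τ1 < σ → σ < u → ¬ P σ) → dsp h τ1 u ∈ S0 * S := by
    intro u hu hub hno
    rw [← dsp_mul h τ1 (τ1 + 1) u]
    exact Set.mul_mem_mul (h0 _ (by omega) (by omega))
      (hS _ _ (by omega) (by omega) hub fun σ h1 h2 => hno σ (by omega) h2)
  by_cases hex2 : ∃ τ, τ1 < τ ∧ τ < t ∧ P τ
  swap
  · push Not at hex2
    left
    rw [← dsp_mul h s τ1 t]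
    exact Set.mul_mem_mul hfirst (hone t h1t htb hex2)
  obtain ⟨τ2, ⟨h2s, h2t, h2P⟩, hmin2⟩ : ∃ τ, (τ1 < τ ∧ τ < t ∧ P τ) ∧
      ∀ σ, τ1 < σ → σ < τ → ¬ P σ := by
    refine ⟨Nat.find hex2, Nat.find_spec hex2, fun σ h1 h2 h3 => ?_⟩
    exact Nat.find_min hex2 h2 ⟨h1, h2.trans (Nat.find_spec hex2).2.1, h3⟩
  right
  obtain ⟨p, rfl⟩ : ∃ p, τ2 = τ1 + p := ⟨τ2 - τ1, by omega⟩
  have hper : ∀ n, (τ1 + p + n < b → Rl (τ1 + n) (τ1 + p + n)) ∧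
      (τ1 + p + n ≤ b → dsp h τ1 (τ1 + n) = dsp h (τ1 + p) (τ1 + p + n)) := by
    intro n
    induction n with
    | zero => exact ⟨fun hb => hP _ _ (by omega) (by omega) (by omega) (by omega) h1P h2P,
        fun _ => by rw [add_zero, add_zero, dsp_self, dsp_self]⟩
    | succ n ih =>
      have key := fun hb : τ1 + p + n < b => hR (τ1 + n) (τ1 + p + n) (by omega) (by omega) (by omega) hb (ih.1 hb)
      refine ⟨fun hb => (key (by omega)).2 (by omega) (by omega), fun hb => ?_⟩
      rw [← dsp_mul h τ1 (τ1 + n), ← dsp_mul h (τ1 + p) (τ1 + p + n), ih.2 (by omega)]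
      congr 1
      exact (key (by omega)).1
  set c := dsp h τ1 (τ1 + p) with hc
  have hcm : c ∈ S0 * S := hone _ h2s (by omega) hmin2
  have main : ∀ n, 0 < n → τ1 + n ≤ b → ∃ q : ℕ, ∃ x ∈ S0 * S, dsp h τ1 (τ1 + n) = c ^ q * x := by
    intro n
    induction n using Nat.strong_induction_on with
    | _ n ih =>
      intro hn hnb
      by_cases hle : n ≤ p
      · exact ⟨0, _, hone _ (by omega) hnb fun σ h1 h2 => hmin2 σ h1 (by omega), by simp⟩
      · obtain ⟨k, rfl⟩ : ∃ k, n = p + k := ⟨n - p, by omega⟩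
        obtain ⟨q, x, hx, e⟩ := ih k (by omega) (by omega) (by omega)
        refine ⟨q + 1, x, hx, ?_⟩
        rw [← dsp_mul h τ1 (τ1 + p), ← hc, show τ1 + (p + k) = τ1 + p + k by omega,
          ← (hper k).2 (by omega), e, pow_succ', mul_assoc]
  obtain ⟨q, x, hx, e⟩ := main (t - τ1) (by omega) (by omega)
  rw [show τ1 + (t - τ1) = t by omega] at e
  refine Set.mem_biUnion hcm ?_
  rw [← dsp_mul h s τ1 t, e]
  exact Set.mul_mem_mul hfirst (Set.mul_mem_mul (Subgroup.npow_mem_zpowers c q) hx)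

/-- Lemma R. -/
theorem lemmaR (S0 S : Set H) {E : Type*} [Fintype E] (h : ℕ → H) (lab : ℕ → Option E)
    (Rl : ℕ → ℕ → Prop) (b : ℕ) (a : ℕ)
    (h0 : ∀ τ, a ≤ τ → τ < b → dsp h τ (τ + 1) ∈ S0)
    (hS : ∀ s t, a ≤ s → s ≤ t → t ≤ b → (∀ τ, s ≤ τ → τ < t → lab τ = none) → dsp h s t ∈ S)
    (hP : ∀ τ τ', a ≤ τ → a ≤ τ' → τ < b → τ' < b → lab τ ≠ none → lab τ = lab τ' → Rl τ τ')
    (hR : ∀ τ τ', a ≤ τ → a ≤ τ' → τ < b → τ' < b → Rl τ τ' →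
      dsp h τ (τ + 1) = dsp h τ' (τ' + 1) ∧ (τ + 1 < b → τ' + 1 < b → Rl (τ + 1) (τ' + 1))) :
    ∀ s t, a ≤ s → s ≤ t → t ≤ b → dsp h s t ∈ itS S0 S (Fintype.card E) := by
  classical
  have key : ∀ U : Finset E, ∀ s t, a ≤ s → s ≤ t → t ≤ b →
      (∀ τ, s ≤ τ → τ < t → ∀ e, lab τ = some e → e ∈ U) → dsp h s t ∈ itS S0 S U.card := by
    intro U
    induction U using Finset.induction_on with
    | empty =>
      intro s t h1 h2 h3 h4
      refine hS s t h1 h2 h3 fun τ h5 h6 => ?_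
      cases hl : lab τ with
      | none => rfl
      | some e => exact absurd (h4 τ h5 h6 e hl) (by simp)
    | insert e U he ih =>
      intro s t h1 h2 h3 h4
      rw [Finset.card_insert_of_notMem he, itS, Function.iterate_succ_apply']
      refine lemmaR_step S0 _ h (fun τ => lab τ = some e) Rl t s (fun τ h5 h6 => h0 τ (by omega) (by omega))
        ?_ ?_ ?_ s t le_rfl h2 le_rfl
      · intro s' t' h5 h6 h7 h8
        refine ih s' t' (by omega) h6 (by omega) fun τ h9 h10 e' he' => ?_
        have := h4 τ (by omega) (by omega) e' he'
        rcases Finset.mem_insert.1 this with rfl | h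
        · exact absurd he' (h8 τ h9 h10)
        · exact h
      · intro τ τ' h5 h6 h7 h8 h9 h10
        exact hP τ τ' (by omega) (by omega) (by omega) (by omega) (by rw [h9]; simp) (h9.trans h10.symm)
      · intro τ τ' h5 h6 h7 h8 h9
        have := hR τ τ' (by omega) (by omega) (by omega) (by omega) h9
        exact ⟨this.1, fun _ _ => this.2 (by omega) (by omega)⟩
  intro s t h1 h2 h3
  exact key Finset.univ s t h1 h2 h3 fun _ _ _ _ _ => Finset.mem_univ _

/-- bounding set in the anchor lemma -/
def anchS (Z : Subgroup H) (S0 S S3 : Set H) : Set H :=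
  S ∪ S * ((S3⁻¹ * ((Subgroup.closure ((Z : Set H) ∩ (S3 * (S0 * S) * S3⁻¹)) : Subgroup H) : Set H)
    * S3) * (S0 * S ∪ {1}))

theorem anchS_finite (ht : ∀ x : H, IsOfFinOrder x) (Z : Subgroup H)
    (hZ : ∀ z ∈ Z, ∀ x, z * x = x * z) {S0 S S3 : Set H}
    (h0 : S0.Finite) (h : S.Finite) (h3 : S3.Finite) : (anchS Z S0 S S3).Finite := by
  refine h.union (h.mul (((h3.inv.mul ?_).mul h3).mul ((h0.mul h).union (Set.finite_singleton 1))))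
  refine finite_closure_of_central ht _ ?_ ?_
  · exact ((h3.mul (h0.mul h)).mul h3.inv).subset Set.inter_subset_right
  · intro z hz; exact hZ z hz.1

theorem anch (Z : Subgroup H) (hZ : ∀ z ∈ Z, ∀ x, z * x = x * z) (S0 S S3 : Set H)
    (h : ℕ → H) (An : ℕ → Prop) (a b : ℕ)
    (h0 : ∀ τ, a ≤ τ → τ < b → dsp h τ (τ + 1) ∈ S0)
    (hS : ∀ s t, a ≤ s → s ≤ t → t ≤ b → (∀ τ, s ≤ τ → τ < t → ¬ An τ) → dsp h s t ∈ S)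
    (h3 : ∀ τ, a ≤ τ → τ < b → An τ → ∃ z ∈ Z, ∃ x ∈ S3, h τ = z * x) :
    ∀ s t, a ≤ s → s ≤ t → t ≤ b → dsp h s t ∈ anchS Z S0 S S3 := by
  classical
  intro s t has hst htb
  by_cases hex : ∃ τ, s ≤ τ ∧ τ < t ∧ An τ
  swap
  · push Not at hex
    exact Or.inl (hS s t has hst htb hex)
  obtain ⟨τ1, ⟨h1s, h1t, h1P⟩, hmin⟩ : ∃ τ, (s ≤ τ ∧ τ < t ∧ An τ) ∧ ∀ σ, s ≤ σ → σ < τ → ¬ An σ := by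
    refine ⟨Nat.find hex, Nat.find_spec hex, fun σ h1 h2 h3 => ?_⟩
    exact Nat.find_min hex h2 ⟨h1, h2.trans (Nat.find_spec hex).2.1, h3⟩
  right
  rw [← dsp_mul h s τ1 t]
  refine Set.mul_mem_mul (hS s τ1 has h1s (by omega) hmin) ?_
  set Γ := Subgroup.closure ((Z : Set H) ∩ (S3 * (S0 * S) * S3⁻¹)) with hΓ
  obtain ⟨z1, hz1, x1, hx1, e1⟩ := h3 τ1 (by omega) (by omega) h1P
  have hΓZ : ∀ γ ∈ Γ, γ ∈ Z := fun γ hγ => by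
    have : Γ ≤ Z := (Subgroup.closure_le _).2 Set.inter_subset_left
    exact this hγ
  have main : ∀ n, τ1 + n ≤ b → ∃ τ, τ1 ≤ τ ∧ τ ≤ τ1 + n ∧ (∀ σ, τ < σ → σ < τ1 + n → ¬ An σ) ∧
      ∃ γ ∈ Γ, ∃ x ∈ S3, h τ = z1 * γ * x := by
    intro n
    induction n with
    | zero => exact fun _ => ⟨τ1, le_rfl, le_rfl, fun σ _ _ => by omega, 1, Γ.one_mem, x1, hx1, by rw [e1, mul_one]⟩
    | succ n ih =>
      intro hn
      obtain ⟨τ, hτ1, hτ2, hno, γ, hγ, x, hx, e⟩ := ih (by omega)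
      by_cases hk : τ < τ1 + n ∧ An (τ1 + n)
      · obtain ⟨z, hz, y, hy, ey⟩ := h3 (τ1 + n) (by omega) (by omega) hk.2
        refine ⟨τ1 + n, by omega, by omega, fun σ _ _ => by omega, z1⁻¹ * z, ?_, y, hy, by rw [ey]; group⟩
        have hd : dsp h τ (τ1 + n) ∈ S0 * S := by
          rw [← dsp_mul h τ (τ + 1)]
          exact Set.mul_mem_mul (h0 _ (by omega) (by omega))
            (hS _ _ (by omega) (by omega) (by omega) fun σ h1 h2 => hno σ (by omega) h2)
        have hc := hZ _ (Z.mul_mem (Z.inv_mem (Z.mul_mem hz1 (hΓZ γ hγ))) hz)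
        have e2 : x * dsp h τ (τ1 + n) * y⁻¹ = (z1 * γ)⁻¹ * z := by
          rw [dsp, e, ey]
          calc x * ((z1 * γ * x)⁻¹ * (z * y)) * y⁻¹ = x * (x⁻¹ * ((z1 * γ)⁻¹ * z)) := by group
            _ = _ := by group
        have e3 : (z1 * γ)⁻¹ * z ∈ Γ := Subgroup.subset_closure
          ⟨Z.mul_mem (Z.inv_mem (Z.mul_mem hz1 (hΓZ γ hγ))) hz,
            e2 ▸ Set.mul_mem_mul (Set.mul_mem_mul hx hd) (Set.inv_mem_inv.2 hy)⟩
        have e4 : z1⁻¹ * z = γ * ((z1 * γ)⁻¹ * z) := by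
          rw [hZ γ (hΓZ γ hγ)]
          have := hZ γ (hΓZ γ hγ) z1
          rw [← this, mul_inv_rev, mul_assoc, mul_assoc, hZ z hz γ]
          group
        rw [e4]
        exact Γ.mul_mem hγ e3
      · refine ⟨τ, hτ1, by omega, fun σ h1 h2 => ?_, γ, hγ, x, hx, e⟩
        by_cases hσ : σ = τ1 + n
        · subst hσ; exact fun hh => hk ⟨h1, hh⟩
        · exact hno σ h1 (by omega)
  obtain ⟨τ, hτ1, hτ2, hno, γ, hγ, x, hx, e⟩ := main (t - τ1) (by omega)
  rw [show τ1 + (t - τ1) = t by omega] at *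
  rw [← dsp_mul h τ1 τ t]
  refine Set.mul_mem_mul ?_ ?_
  · have : dsp h τ1 τ = x1⁻¹ * γ * x := by rw [dsp, e, e1]; group
    rw [this]
    exact Set.mul_mem_mul (Set.mul_mem_mul (Set.inv_mem_inv.2 hx1) hγ) hx
  · by_cases hτ : τ = t
    · right; rw [hτ, dsp_self]; rfl
    · left
      rw [← dsp_mul h τ (τ + 1)]
      exact Set.mul_mem_mul (h0 _ (by omega) (by omega))
        (hS _ _ (by omega) (by omega) (by omega) fun σ h1 h2 => hno σ (by omega) h2)

end seq

end FH


namespace FH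

open Pointwise

/-- An abstract three-headed machine working on the big group. -/
structure Mach where
  M : ℕ
  w : ℕ
  W : Fin w → PG
  F : Fin 3 → Option (Fin M) → (Fin w → Fin 3) × (Fin 3 → Fin w → Option (Fin M)) →
    PG × Option (Fin M)

namespace Mach
variable (K : Mach)

/-- views -/
abbrev View := (Fin K.w → Fin 3) × (Fin 3 → Fin K.w → Option (Fin K.M))

/-- configurations -/
abbrev Cfg := Fin 3 → PG × Option (Fin K.M)

/-- visibility -/
def see (N : Subgroup PG) (κ : Fin 3 → Fin 3) (c : K.Cfg) (i j : Fin 3) (b : Fin K.w) : Prop :=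
  κ i = κ j ∧ (K.W b)⁻¹ * ((c i).1⁻¹ * (c j).1) ∈ N

open Classical in
/-- the view of a head -/
noncomputable def view (N : Subgroup PG) (κ : Fin 3 → Fin 3) (d : ℕ) (c : K.Cfg) (i : Fin 3) : K.View :=
  (fun b => env d ((c i).1 * K.W b), fun j b => if K.see N κ c i j b then (c j).2 else none)

/-- one step -/
noncomputable def step (N : Subgroup PG) (κ : Fin 3 → Fin 3) (d : ℕ) (c : K.Cfg) : K.Cfg := fun i =>
  ((c i).1 * (K.F i (c i).2 (K.view N κ d c i)).1, (K.F i (c i).2 (K.view N κ d c i)).2)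

/-- runs -/
noncomputable def run (N : Subgroup PG) (κ : Fin 3 → Fin 3) (d : ℕ) (c : K.Cfg) (t : ℕ) : K.Cfg :=
  (K.step N κ d)^[t] c

theorem run_succ (N : Subgroup PG) (κ : Fin 3 → Fin 3) (d : ℕ) (c : K.Cfg) (t : ℕ) :
    K.run N κ d c (t + 1) = K.step N κ d (K.run N κ d c t) :=
  Function.iterate_succ_apply' _ _ _

/-- a head sees nothing special -/
def blank (d : ℕ) (c : K.Cfg) (i : Fin 3) : Prop := ∀ b, env d ((c i).1 * K.W b) = 0

/-- two heads meet -/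
def meet (N : Subgroup PG) (κ : Fin 3 → Fin 3) (c : K.Cfg) (i j : Fin 3) : Prop :=
  ∃ b, K.see N κ c i j b ∨ K.see N κ c j i b

theorem meet_symm {N : Subgroup PG} {κ : Fin 3 → Fin 3} {c : K.Cfg} {i j : Fin 3} :
    K.meet N κ c i j ↔ K.meet N κ c j i := by
  unfold meet; simp only [or_comm]

/-- `H`-position -/
noncomputable def hp (N : Subgroup PG) (κ : Fin 3 → Fin 3) (d : ℕ) (c : K.Cfg) (i : Fin 3) (t : ℕ) : HH :=
  (K.run N κ d c t i).1.1

/-- the set of moves -/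
def S0 : Set HH := Set.range fun x : Fin 3 × Option (Fin K.M) × K.View => (K.F x.1 x.2.1 x.2.2).1.1

theorem S0_finite : K.S0.Finite := Set.finite_range _

/-- marks -/
def S3 : Set HH := Set.range fun b => (K.W b).1⁻¹

theorem S3_finite : K.S3.Finite := Set.finite_range _

/-- windows -/
def WW : Set HH := (Set.range fun b => (K.W b).1) ∪ (Set.range fun b => (K.W b).1)⁻¹

theorem WW_finite : K.WW.Finite := (Set.finite_range _).union (Set.finite_range _).inv

section
variable {N : Subgroup PG} {κ : Fin 3 → Fin 3} {d : ℕ} {c : K.Cfg}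

theorem dsp_one (i : Fin 3) (t : ℕ) : dsp (K.hp N κ d c i) t (t + 1) =
    (K.F i (K.run N κ d c t i).2 (K.view N κ d (K.run N κ d c t) i)).1.1 := by
  rw [dsp, hp, hp, run_succ]
  simp [step]

theorem dsp_mem_S0 (i : Fin 3) (t : ℕ) : dsp (K.hp N κ d c i) t (t + 1) ∈ K.S0 := by
  rw [dsp_one]
  exact ⟨(i, _, _), rfl⟩

theorem mark {c : K.Cfg} {i : Fin 3} (h : ¬ K.blank d c i) : ∃ z ∈ HH.Z, ∃ x ∈ K.S3, (c i).1.1 = z * x := by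
  unfold blank at h
  push Not at h
  obtain ⟨b, hb⟩ := h
  refine ⟨(c i).1.1 * (K.W b).1, ?_, _, ⟨b, rfl⟩, by simp⟩
  by_contra hc
  apply hb
  have : ((c i).1 * K.W b).1 ∉ HH.Z := hc
  exact if_neg this

theorem fst_mem_Z {N : Subgroup PG} (hN : N ≤ ZP) {n : PG} (h : n ∈ N) : n.1 ∈ HH.Z :=
  ((mem_ZP _).1 (hN h)).1

theorem comm_N {N : Subgroup PG} (hN : N ≤ ZP) {n : PG} (h : n ∈ N) (x : PG) : n * x = x * n :=
  ZP_comm _ x (hN h)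

/-- closeness -/
def nr (N : Subgroup PG) (S : Set HH) (x : PG) : Prop := ∃ n ∈ N, (x * n).1 ∈ S

/-- relative position -/
noncomputable def rel (c : K.Cfg) (i j : Fin 3) : PG := (c i).1⁻¹ * (c j).1

theorem nr_mul (hN : N ≤ ZP) {S T U : Set HH} {x y : PG} {a b : HH} (hx : nr N S x) (ha : a ∈ T) (hb : b ∈ U)
    (e : y.1 = a * x.1 * b) : nr N (T * S * U) y := by
  obtain ⟨n, hn, h⟩ := hx
  refine ⟨n, hn, a * (x * n).1, ⟨a, ha, _, h, rfl⟩, b, hb, ?_⟩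
  have hc : ∀ y : HH, n.1 * y = y * n.1 := fun y => HH.Z_comm _ y (fst_mem_Z hN hn)
  show a * (x.1 * n.1) * b = y.1 * n.1
  rw [e, mul_assoc, mul_assoc, mul_assoc, hc b]
  simp [mul_assoc]

theorem nr_trans (hN : N ≤ ZP) {S T : Set HH} {x y : PG} (hx : nr N S x) (hy : nr N T y) : nr N (S * T) (x * y) := by
  obtain ⟨n, hn, h⟩ := hx
  obtain ⟨m, hm, h'⟩ := hy
  refine ⟨n * m, N.mul_mem hn hm, _, h, _, h', ?_⟩
  show (x * n * (y * m)).1 = _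
  rw [mul_assoc x, ← mul_assoc n, comm_N hN hn y]; simp [mul_assoc]

theorem nr_inv (hN : N ≤ ZP) {S : Set HH} {x : PG} (hx : nr N S x) : nr N S⁻¹ x⁻¹ := by
  obtain ⟨n, hn, h⟩ := hx
  refine ⟨n⁻¹, N.inv_mem hn, ?_⟩
  rw [comm_N hN (N.inv_mem hn) x⁻¹ |>.symm, ← mul_inv_rev]
  simpa using h

theorem nr_mono {S T : Set HH} (h : S ⊆ T) {x : PG} (hx : nr N S x) : nr N T x := by
  obtain ⟨n, hn, hh⟩ := hx
  exact ⟨n, hn, h hh⟩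

theorem rel_inv (c : K.Cfg) (i j : Fin 3) : (K.rel c i j)⁻¹ = K.rel c j i := by simp [rel]

theorem meet_nr (hN : N ≤ ZP) {c : K.Cfg} {i j : Fin 3} (h : K.meet N κ c i j) : nr N K.WW (K.rel c i j) := by
  obtain ⟨b, h | h⟩ := h
  · refine ⟨_, N.inv_mem h.2, Or.inl ⟨b, ?_⟩⟩
    rw [rel, mul_inv_rev, inv_inv, ← mul_assoc, mul_inv_cancel, one_mul]
  · refine ⟨_, h.2, Or.inr ?_⟩
    have e : K.rel c i j * ((K.W b)⁻¹ * ((c j).1⁻¹ * (c i).1)) = (K.W b)⁻¹ := by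
      rw [← comm_N hN h.2, rel]; group
    rw [e]
    exact Set.inv_mem_inv.2 ⟨b, rfl⟩

end

end Mach

end FH


namespace FH

open Pointwise

namespace Mach
variable (K : Mach)

section
variable {N : Subgroup PG} {κ : Fin 3 → Fin 3} {d : ℕ} {c : K.Cfg}

theorem view_congr {N' : Subgroup PG} {κ' : Fin 3 → Fin 3} {c c' : K.Cfg} {i : Fin 3}
    (h1 : ∀ b, env d ((c i).1 * K.W b) = env d ((c' i).1 * K.W b))
    (h2 : ∀ j b, K.see N κ c i j b ↔ K.see N' κ' c' i j b)
    (h3 : ∀ j b, K.see N κ c i j b → (c j).2 = (c' j).2) :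
    K.view N κ d c i = K.view N' κ' d c' i := by
  classical
  refine Prod.ext (funext h1) (funext fun j => funext fun b => ?_)
  by_cases h : K.see N κ c i j b
  · simp only [view]
    rw [if_pos h, if_pos ((h2 j b).1 h), h3 j b h]
  · simp only [view]
    rw [if_neg h, if_neg (fun h' => h ((h2 j b).2 h'))]

theorem see_self {c c' : K.Cfg} {i : Fin 3} {b} : K.see N κ c i i b ↔ K.see N κ c' i i b := by
  simp [see]

theorem see_congr {c c' : K.Cfg} {i j : Fin 3} {b}
    (h : (K.rel c i j)⁻¹ * K.rel c' i j ∈ N) : K.see N κ c i j b ↔ K.see N κ c' i j b := by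
  have e : (K.W b)⁻¹ * ((c' i).1⁻¹ * (c' j).1) = (K.W b)⁻¹ * ((c i).1⁻¹ * (c j).1) *
      ((K.rel c i j)⁻¹ * K.rel c' i j) := by simp [rel, mul_assoc]
  unfold see
  rw [e, N.mul_mem_cancel_right h]

theorem rel_symm (hN : N ≤ ZP) {c c' : K.Cfg} {i j : Fin 3}
    (h : (K.rel c i j)⁻¹ * K.rel c' i j ∈ N) : (K.rel c j i)⁻¹ * K.rel c' j i ∈ N := by
  rw [← K.rel_inv c i j, ← K.rel_inv c' i j, inv_inv]
  have h2 := comm_N hN h (K.rel c i j)⁻¹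
  have e : K.rel c i j * (K.rel c' i j)⁻¹ = ((K.rel c i j)⁻¹ * K.rel c' i j)⁻¹ := by
    rw [mul_inv_rev, inv_inv]
    have h3 : (K.rel c i j)⁻¹ * K.rel c' i j = K.rel c' i j * (K.rel c i j)⁻¹ := by
      have := congrArg (K.rel c i j * · * (1 : PG)) h2
      simp only [mul_one] at this
      rw [mul_inv_cancel_left] at this
      rw [← mul_assoc, mul_inv_cancel_left] at this
      exact this.symm
    have := congrArg (·⁻¹) h3
    simpa using this.symm
  rw [e]
  exact N.inv_mem h

/-- bound for lonely heads away from marks -/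
def S1 : Set HH := itS K.S0 {1} (Fintype.card (Option (Fin K.M)))

theorem S1_finite : K.S1.Finite := itS_finite HH.torsion K.S0_finite (Set.finite_singleton 1) _

theorem S1_spec (i : Fin 3) (a b : ℕ)
    (hb : ∀ τ, a ≤ τ → τ < b → K.blank d (K.run N κ d c τ) i)
    (hl : ∀ τ, a ≤ τ → τ < b → ∀ j ≠ i, ∀ x, ¬ K.see N κ (K.run N κ d c τ) i j x) :
    ∀ s t, a ≤ s → s ≤ t → t ≤ b → dsp (K.hp N κ d c i) s t ∈ K.S1 := by
  refine lemmaR K.S0 {1} (K.hp N κ d c i) (fun τ => some (K.run N κ d c τ i).2)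
    (fun τ τ' => (K.run N κ d c τ i).2 = (K.run N κ d c τ' i).2) b a ?_ ?_ ?_ ?_
  · intro τ _ _; exact K.dsp_mem_S0 i τ
  · intro s t h1 h2 h3 h4
    have : s = t := by
      by_contra hne
      exact absurd (h4 s le_rfl (by omega)) (by simp)
    subst this
    exact dsp_self _ _
  · intro τ τ' _ _ _ _ _ h
    exact Option.some_injective _ h
  · intro τ τ' h1 h2 h3 h4 h5
    have hv : K.view N κ d (K.run N κ d c τ) i = K.view N κ d (K.run N κ d c τ') i := by
      apply view_congr
      · intro x; rw [hb τ h1 h3 x, hb τ' h2 h4 x]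
      · intro j x
        by_cases hj : j = i
        · subst hj; exact K.see_self
        · exact ⟨fun h => absurd h (hl τ h1 h3 j hj x), fun h => absurd h (hl τ' h2 h4 j hj x)⟩
      · intro j x h
        by_cases hj : j = i
        · subst hj; exact h5
        · exact absurd h (hl τ h1 h3 j hj x)
    refine ⟨by rw [dsp_one, dsp_one, h5, hv], fun _ _ => ?_⟩
    rw [run_succ, run_succ]
    simp only [step]
    rw [h5, hv]

/-- labels for pairs -/
abbrev E2 := Option (Fin K.M) × Option (Fin K.M) × (Fin K.w → Prop) × (Fin K.w → Prop)

open Classical in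
/-- bound for isolated pairs away from marks -/
noncomputable def S2 : Set HH := itS K.S0 K.S1 (Fintype.card K.E2)

theorem S2_finite : K.S2.Finite := itS_finite HH.torsion K.S0_finite K.S1_finite _

theorem S2_spec (hN : N ≤ ZP) (i k : Fin 3) (hik : i ≠ k) (a b : ℕ)
    (hbi : ∀ τ, a ≤ τ → τ < b → K.blank d (K.run N κ d c τ) i)
    (hbk : ∀ τ, a ≤ τ → τ < b → K.blank d (K.run N κ d c τ) k)
    (hli : ∀ τ, a ≤ τ → τ < b → ∀ j, j ≠ i → j ≠ k → ∀ x, ¬ K.see N κ (K.run N κ d c τ) i j x)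
    (hlk : ∀ τ, a ≤ τ → τ < b → ∀ j, j ≠ i → j ≠ k → ∀ x, ¬ K.see N κ (K.run N κ d c τ) k j x) :
    ∀ s t, a ≤ s → s ≤ t → t ≤ b → dsp (K.hp N κ d c i) s t ∈ K.S2 := by
  classical
  let lab : ℕ → Option K.E2 := fun τ =>
    if K.meet N κ (K.run N κ d c τ) i k then
      some ((K.run N κ d c τ i).2, (K.run N κ d c τ k).2, K.see N κ (K.run N κ d c τ) i k,
        K.see N κ (K.run N κ d c τ) k i) else none
  have := lemmaR K.S0 K.S1 (K.hp N κ d c i) lab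
    (fun τ τ' => (K.run N κ d c τ i).2 = (K.run N κ d c τ' i).2 ∧
      (K.run N κ d c τ k).2 = (K.run N κ d c τ' k).2 ∧
      (K.rel (K.run N κ d c τ) i k)⁻¹ * K.rel (K.run N κ d c τ') i k ∈ N) b a ?_ ?_ ?_ ?_
  · exact this
  · intro τ _ _; exact K.dsp_mem_S0 i τ
  · intro s t h1 h2 h3 h4
    refine K.S1_spec i s t (fun τ h5 h6 => hbi τ (by omega) (by omega)) ?_ s t le_rfl h2 le_rfl
    intro τ h5 h6 j hj x hx
    by_cases hjk : j = k
    · subst hjk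
      have hm : K.meet N κ (K.run N κ d c τ) i j := ⟨x, Or.inl hx⟩
      have := h4 τ h5 h6
      simp [lab, hm] at this
    · exact hli τ (by omega) (by omega) j hj hjk x hx
  · intro τ τ' h1 h2 h3 h4 h5 h6
    have hm : K.meet N κ (K.run N κ d c τ) i k := by
      by_contra hm; exact h5 (if_neg hm)
    have hm' : K.meet N κ (K.run N κ d c τ') i k := by
      by_contra hm'; exact h5 (h6.trans (if_neg hm'))
    have h7 := h6
    simp only [lab] at h7
    rw [if_pos hm, if_pos hm'] at h7
    have h8 := Option.some_injective _ h7
    simp only [Prod.mk.injEq] at h8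
    refine ⟨h8.1, h8.2.1, ?_⟩
    obtain ⟨x, hx | hx⟩ := hm
    · have hx' : K.see N κ (K.run N κ d c τ') i k x := h8.2.2.1 ▸ hx
      have := N.mul_mem (N.inv_mem hx.2) hx'.2
      simpa [rel, mul_assoc] using this
    · have hx' : K.see N κ (K.run N κ d c τ') k i x := h8.2.2.2 ▸ hx
      have h9 := N.mul_mem (N.inv_mem hx.2) hx'.2
      apply K.rel_symm hN
      simpa [rel, mul_assoc] using h9
  · rintro τ τ' h1 h2 h3 h4 ⟨h5, h6, h7⟩
    have h7' := K.rel_symm hN h7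
    have hv : K.view N κ d (K.run N κ d c τ) i = K.view N κ d (K.run N κ d c τ') i := by
      apply view_congr
      · intro x; rw [hbi τ h1 h3 x, hbi τ' h2 h4 x]
      · intro j x
        by_cases hj : j = i
        · subst hj; exact K.see_self
        by_cases hj' : j = k
        · subst hj'; exact K.see_congr h7
        · exact ⟨fun h => absurd h (hli τ h1 h3 j hj hj' x), fun h => absurd h (hli τ' h2 h4 j hj hj' x)⟩
      · intro j x h
        by_cases hj : j = i
        · subst hj; exact h5
        by_cases hj' : j = k
        · subst hj'; exact h6
        · exact absurd h (hli τ h1 h3 j hj hj' x)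
    have hv' : K.view N κ d (K.run N κ d c τ) k = K.view N κ d (K.run N κ d c τ') k := by
      apply view_congr
      · intro x; rw [hbk τ h1 h3 x, hbk τ' h2 h4 x]
      · intro j x
        by_cases hj : j = i
        · subst hj; exact K.see_congr h7'
        by_cases hj' : j = k
        · subst hj'; exact K.see_self
        · exact ⟨fun h => absurd h (hlk τ h1 h3 j hj hj' x), fun h => absurd h (hlk τ' h2 h4 j hj hj' x)⟩
      · intro j x h
        by_cases hj : j = i
        · subst hj; exact h5
        by_cases hj' : j = k
        · subst hj'; exact h6
        · exact absurd h (hlk τ h1 h3 j hj hj' x)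
    refine ⟨by rw [dsp_one, dsp_one, h5, hv], fun _ _ => ?_⟩
    rw [run_succ, run_succ]
    simp only [step, rel]
    rw [h5, hv, h6, hv']
    refine ⟨rfl, rfl, ?_⟩
    set mi := (K.F i (K.run N κ d c τ' i).2 (K.view N κ d (K.run N κ d c τ') i)).1
    set mk := (K.F k (K.run N κ d c τ' k).2 (K.view N κ d (K.run N κ d c τ') k)).1
    have e := comm_N hN h7 mk
    have e2 : (((K.run N κ d c τ i).1 * mi)⁻¹ * ((K.run N κ d c τ k).1 * mk))⁻¹ *
        (((K.run N κ d c τ' i).1 * mi)⁻¹ * ((K.run N κ d c τ' k).1 * mk)) =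
        mk⁻¹ * (((K.rel (K.run N κ d c τ) i k)⁻¹ * K.rel (K.run N κ d c τ') i k) * mk) := by
      simp [rel, mul_assoc]
    rw [e2, e, inv_mul_cancel_left]
    exact h7

/-- bound for lonely heads -/
def S1' : Set HH := anchS HH.Z K.S0 K.S1 K.S3

theorem S1'_finite : K.S1'.Finite :=
  anchS_finite HH.torsion HH.Z (fun z hz x => HH.Z_comm z x hz) K.S0_finite K.S1_finite K.S3_finite

theorem S1'_spec (i : Fin 3) (a b : ℕ)
    (hl : ∀ τ, a ≤ τ → τ < b → ∀ j ≠ i, ∀ x, ¬ K.see N κ (K.run N κ d c τ) i j x) :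
    ∀ s t, a ≤ s → s ≤ t → t ≤ b → dsp (K.hp N κ d c i) s t ∈ K.S1' := by
  refine anch HH.Z (fun z hz x => HH.Z_comm z x hz) K.S0 K.S1 K.S3 (K.hp N κ d c i)
    (fun τ => ¬ K.blank d (K.run N κ d c τ) i) a b ?_ ?_ ?_
  · intro τ _ _; exact K.dsp_mem_S0 i τ
  · intro s t h1 h2 h3 h4
    exact K.S1_spec i s t (fun τ h5 h6 => not_not.1 (h4 τ h5 h6))
      (fun τ h5 h6 => hl τ (by omega) (by omega)) s t le_rfl h2 le_rfl
  · intro τ _ _ h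
    exact K.mark h

/-- anchors for pairs -/
noncomputable def S3' : Set HH := K.S3 * (K.S0 * K.S2 ∪ {1}) * (K.WW ∪ {1})

theorem S3'_finite : K.S3'.Finite :=
  (K.S3_finite.mul ((K.S0_finite.mul K.S2_finite).union (Set.finite_singleton 1))).mul
    (K.WW_finite.union (Set.finite_singleton 1))

/-- bound for isolated pairs -/
noncomputable def S2' : Set HH := K.S2 ∪ K.S2 * anchS HH.Z K.S0 K.S1 K.S3'

theorem S2'_finite : K.S2'.Finite := K.S2_finite.union (K.S2_finite.mul
  (anchS_finite HH.torsion HH.Z (fun z hz x => HH.Z_comm z x hz) K.S0_finite K.S1_finite K.S3'_finite))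

theorem S2'_spec (hN : N ≤ ZP) (i k : Fin 3) (hik : i ≠ k) (a b : ℕ) (hab : a ≤ b)
    (hli : ∀ τ, a ≤ τ → τ < b → ∀ j, j ≠ i → j ≠ k → ∀ x, ¬ K.see N κ (K.run N κ d c τ) i j x)
    (hlk : ∀ τ, a ≤ τ → τ < b → ∀ j, j ≠ i → j ≠ k → ∀ x, ¬ K.see N κ (K.run N κ d c τ) k j x) :
    dsp (K.hp N κ d c i) a b ∈ K.S2' := by
  classical
  let Ev : ℕ → Prop := fun τ => ¬ K.blank d (K.run N κ d c τ) i ∨ ¬ K.blank d (K.run N κ d c τ) k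
  have hS2i : ∀ s t, a ≤ s → s ≤ t → t ≤ b → (∀ τ, s ≤ τ → τ < t → ¬ Ev τ) →
      dsp (K.hp N κ d c i) s t ∈ K.S2 := by
    intro s t h1 h2 h3 h4
    refine K.S2_spec hN i k hik s t ?_ ?_ (fun τ h5 h6 => hli τ (by omega) (by omega))
      (fun τ h5 h6 => hlk τ (by omega) (by omega)) s t le_rfl h2 le_rfl
    · intro τ h5 h6; by_contra hc; exact h4 τ h5 h6 (Or.inl hc)
    · intro τ h5 h6; by_contra hc; exact h4 τ h5 h6 (Or.inr hc)
  have hS2k : ∀ s t, a ≤ s → s ≤ t → t ≤ b → (∀ τ, s ≤ τ → τ < t → ¬ Ev τ) →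
      dsp (K.hp N κ d c k) s t ∈ K.S2 := by
    intro s t h1 h2 h3 h4
    refine K.S2_spec hN k i hik.symm s t ?_ ?_ (fun τ h5 h6 j hj hj' => hlk τ (by omega) (by omega) j hj' hj)
      (fun τ h5 h6 j hj hj' => hli τ (by omega) (by omega) j hj' hj) s t le_rfl h2 le_rfl
    · intro τ h5 h6; by_contra hc; exact h4 τ h5 h6 (Or.inr hc)
    · intro τ h5 h6; by_contra hc; exact h4 τ h5 h6 (Or.inl hc)
  by_cases hex : ∃ τ, a ≤ τ ∧ τ < b ∧ Ev τ
  swap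
  · push Not at hex
    exact Or.inl (hS2i a b le_rfl hab le_rfl hex)
  obtain ⟨e, ⟨h1s, h1t, h1P⟩, hmin⟩ : ∃ τ, (a ≤ τ ∧ τ < b ∧ Ev τ) ∧ ∀ σ, a ≤ σ → σ < τ → ¬ Ev σ := by
    refine ⟨Nat.find hex, Nat.find_spec hex, fun σ h1 h2 h3 => ?_⟩
    exact Nat.find_min hex h2 ⟨h1, h2.trans (Nat.find_spec hex).2.1, h3⟩
  right
  rw [← dsp_mul _ a e b]
  refine Set.mul_mem_mul (hS2i a e le_rfl h1s (by omega) hmin) ?_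
  -- position of one of the heads after an event
  have hlast : ∀ n, e + n ≤ b → ∃ τ, e ≤ τ ∧ τ ≤ e + n ∧ (∀ σ, τ < σ → σ < e + n → ¬ Ev σ) ∧ Ev τ := by
    intro n
    induction n with
    | zero => exact fun _ => ⟨e, le_rfl, le_rfl, fun σ _ _ => by omega, h1P⟩
    | succ n ih =>
      intro hn
      obtain ⟨τ, h2, h3, h4, h5⟩ := ih (by omega)
      by_cases hE : Ev (e + n)
      · exact ⟨e + n, by omega, by omega, fun σ _ _ => by omega, hE⟩
      · refine ⟨τ, h2, by omega, fun σ h6 h7 => ?_, h5⟩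
        by_cases hσ : σ = e + n
        · subst hσ; exact hE
        · exact h4 σ h6 (by omega)
  have hpos : ∀ t, e ≤ t → t < b → ∃ z ∈ HH.Z, ∃ x ∈ K.S3 * (K.S0 * K.S2 ∪ {1}),
      K.hp N κ d c i t = z * x ∨ K.hp N κ d c k t = z * x := by
    intro t het htb
    obtain ⟨τ, h2, h3, h4, h5⟩ := hlast (t - e) (by omega)
    rw [show e + (t - e) = t by omega] at h3 h4
    have hd : ∀ j, (∀ s t, a ≤ s → s ≤ t → t ≤ b → (∀ τ, s ≤ τ → τ < t → ¬ Ev τ) →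
        dsp (K.hp N κ d c j) s t ∈ K.S2) → dsp (K.hp N κ d c j) τ t ∈ K.S0 * K.S2 ∪ {1} := by
      intro j hj
      by_cases hτ : τ = t
      · right; rw [hτ, dsp_self]; rfl
      · left
        rw [← dsp_mul _ τ (τ + 1)]
        exact Set.mul_mem_mul (K.dsp_mem_S0 _ _)
          (hj _ _ (by omega) (by omega) (by omega) fun σ h6 h7 => h4 σ (by omega) h7)
    rcases h5 with h5 | h5
    · obtain ⟨z, hz, x, hx, e1⟩ := K.mark h5
      refine ⟨z, hz, x * dsp (K.hp N κ d c i) τ t, Set.mul_mem_mul hx (hd i hS2i), Or.inl ?_⟩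
      rw [← mul_assoc, ← e1, dsp]
      exact (mul_inv_cancel_left _ _).symm
    · obtain ⟨z, hz, x, hx, e1⟩ := K.mark h5
      refine ⟨z, hz, x * dsp (K.hp N κ d c k) τ t, Set.mul_mem_mul hx (hd k hS2k), Or.inr ?_⟩
      rw [← mul_assoc, ← e1, dsp]
      exact (mul_inv_cancel_left _ _).symm
  refine anch HH.Z (fun z hz x => HH.Z_comm z x hz) K.S0 K.S1 K.S3' (K.hp N κ d c i)
    (fun τ => ¬ K.blank d (K.run N κ d c τ) i ∨ K.meet N κ (K.run N κ d c τ) k i) e b ?_ ?_ ?_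
    e b le_rfl (by omega) le_rfl
  · intro τ _ _; exact K.dsp_mem_S0 i τ
  · intro s t h1 h2 h3 h4
    refine K.S1_spec i s t (fun τ h5 h6 => ?_) (fun τ h5 h6 j hj x hx => ?_) s t le_rfl h2 le_rfl
    · by_contra hc; exact h4 τ h5 h6 (Or.inl hc)
    · by_cases hjk : j = k
      · subst hjk; exact h4 τ h5 h6 (Or.inr ⟨x, Or.inr hx⟩)
      · exact hli τ (by omega) (by omega) j hj hjk x hx
  · intro τ h2 h3 h4
    rcases h4 with h4 | h4
    · obtain ⟨z, hz, x, hx, e1⟩ := K.mark h4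
      exact ⟨z, hz, x * 1 * 1, Set.mul_mem_mul (Set.mul_mem_mul hx (Or.inr rfl)) (Or.inr rfl), by
        rw [mul_one, mul_one]; exact e1⟩
    · obtain ⟨z, hz, x, hx, e1 | e1⟩ := hpos τ h2 h3
      · exact ⟨z, hz, x * 1, Set.mul_mem_mul hx (Or.inr rfl), by rw [mul_one]; exact e1⟩
      · obtain ⟨n, hn, hw⟩ := K.meet_nr hN h4
        have hnz := fst_mem_Z hN hn
        refine ⟨z * n.1⁻¹, HH.Z.mul_mem hz (HH.Z.inv_mem hnz), x * _,
          Set.mul_mem_mul hx (Or.inl hw), ?_⟩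
        have e3 : (K.rel (K.run N κ d c τ) k i * n).1 = (K.hp N κ d c k τ)⁻¹ * K.hp N κ d c i τ * n.1 := rfl
        rw [e3, e1]
        have hc := HH.Z_comm _ (x * ((z * x)⁻¹ * K.hp N κ d c i τ * n.1)) (HH.Z.inv_mem hnz)
        rw [mul_assoc z, hc]
        group

end

end Mach

end FH


namespace FH

open Pointwise

theorem env_ZP {z : PG} (hz : z ∈ ZP) (d : ℕ) (x : PG) : env d (z * x) = env d x := by
  obtain ⟨h1, h2⟩ := (mem_ZP z).1 hz
  unfold env
  have e1 : (z * x).1 ∈ HH.Z ↔ x.1 ∈ HH.Z := HH.Z.mul_mem_cancel_left h1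
  have e2 : (z * x).2 = x.2 := by rw [Prod.snd_mul, h2, one_mul]
  rw [e2]
  by_cases h : x.1 ∈ HH.Z
  · rw [if_pos h, if_pos (e1.2 h)]
  · rw [if_neg h, if_neg (fun h' => h (e1.1 h'))]

namespace Mach
variable (K : Mach)

/-- displacements in isolation -/
noncomputable def Siso : Set HH := K.S1' ∪ K.S2' ∪ {1}

theorem Siso_finite : K.Siso.Finite := (K.S1'_finite.union K.S2'_finite).union (Set.finite_singleton 1)

/-- auxiliary -/
noncomputable def Sf0 : Set HH := K.Siso * K.WW * K.Siso⁻¹ ∪ {1}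

theorem Sf0_finite : K.Sf0.Finite :=
  ((K.Siso_finite.mul K.WW_finite).mul K.Siso_finite.inv).union (Set.finite_singleton 1)

/-- if heads are not in this relation, they are never going to meet -/
noncomputable def Sfar : Set HH := K.Sf0 ∪ K.Sf0⁻¹

theorem Sfar_finite : K.Sfar.Finite := K.Sf0_finite.union K.Sf0_finite.inv

theorem Sfar_inv : K.Sfar⁻¹ = K.Sfar := by
  rw [Sfar, Set.union_inv, inv_inv, Set.union_comm]

theorem one_mem_Sfar : (1 : HH) ∈ K.Sfar := Or.inl (Or.inr rfl)

/-- short displacements -/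
def SA : Set HH := K.S0 * K.S1' ∪ {1}

theorem SA_finite : K.SA.Finite := (K.S0_finite.mul K.S1'_finite).union (Set.finite_singleton 1)

/-- auxiliary -/
noncomputable def SL0 : Set HH := (K.Sfar * K.Sfar)⁻¹ * (K.Sfar * K.Sfar) ∪ (K.WW ∪ (K.SA⁻¹ * K.WW * K.SA * K.WW ∪ {1}))

theorem SL0_finite : K.SL0.Finite :=
  ((K.Sfar_finite.mul K.Sfar_finite).inv.mul (K.Sfar_finite.mul K.Sfar_finite)).union
    (K.WW_finite.union ((((K.SA_finite.inv.mul K.WW_finite).mul K.SA_finite).mul K.WW_finite).union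
      (Set.finite_singleton 1)))

/-- initial closeness -/
noncomputable def SL1 : Set HH := K.SL0 ∪ K.SL0⁻¹

theorem SL1_finite : K.SL1.Finite := K.SL0_finite.union K.SL0_finite.inv

theorem SL1_inv : K.SL1⁻¹ = K.SL1 := by
  rw [SL1, Set.union_inv, inv_inv, Set.union_comm]

/-- closeness in the future -/
noncomputable def SL : Set HH := K.SL1 ∪ (K.S0 * K.Siso)⁻¹ * K.SL1 * (K.S0 * K.Siso)

theorem SL_finite : K.SL.Finite :=
  K.SL1_finite.union (((K.S0_finite.mul K.Siso_finite).inv.mul K.SL1_finite).mul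
    (K.S0_finite.mul K.Siso_finite))

section
variable {N : Subgroup PG} {κ : Fin 3 → Fin 3} {d : ℕ} {c : K.Cfg}

theorem rel_dsp (i j : Fin 3) (s t : ℕ) : (K.rel (K.run N κ d c t) i j).1 =
    (dsp (K.hp N κ d c i) s t)⁻¹ * (K.rel (K.run N κ d c s) i j).1 * dsp (K.hp N κ d c j) s t := by
  simp only [rel, dsp, hp, Prod.fst_mul, Prod.fst_inv]
  group

theorem rel_dsp' (i j : Fin 3) (s t : ℕ) : (K.rel (K.run N κ d c s) i j).1 =
    (dsp (K.hp N κ d c i) s t) * (K.rel (K.run N κ d c t) i j).1 * (dsp (K.hp N κ d c j) s t)⁻¹ := by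
  simp only [rel, dsp, hp, Prod.fst_mul, Prod.fst_inv]
  group

theorem far (hN : N ≤ ZP) (ρ : Fin 3 → Fin 3)
    (h : ∀ i j, ρ i ≠ ρ j → ¬ nr N K.Sfar (K.rel c i j)) (t : ℕ) :
    ∀ i j, ρ i ≠ ρ j → ¬ K.meet N κ (K.run N κ d c t) i j := by
  induction t using Nat.strong_induction_on with
  | _ t ih =>
    have hns : ∀ i j, ρ i ≠ ρ j → ∀ τ, 0 ≤ τ → τ < t → ∀ x, ¬ K.see N κ (K.run N κ d c τ) i j x :=
      fun i j hij τ _ hτ x hx => ih τ hτ i j hij ⟨x, Or.inl hx⟩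
    have hd : ∀ i j, ρ i ≠ ρ j → dsp (K.hp N κ d c i) 0 t ∈ K.Siso := by
      intro i j hij
      have hne : i ≠ j := fun e => hij (by rw [e])
      by_cases hk : ∃ k, k ≠ i ∧ ρ k = ρ i
      · obtain ⟨k, hki, hk⟩ := hk
        have hkj : k ≠ j := fun e => hij (by rw [← hk, e])
        have hl : ∀ l : Fin 3, l ≠ i → l ≠ k → l = j := by intro l h1 h2; omega
        refine Or.inl (Or.inr (K.S2'_spec hN i k hki.symm 0 t (Nat.zero_le _) ?_ ?_))
        · intro τ h1 h2 l h3 h4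
          rw [hl l h3 h4]; exact hns i j hij τ h1 h2
        · intro τ h1 h2 l h3 h4
          rw [hl l h3 h4]; exact hns k j (by rwa [hk]) τ h1 h2
      · push Not at hk
        exact Or.inl (Or.inl (K.S1'_spec i 0 t (fun τ h1 h2 l hl => hns i l (hk l hl).symm τ h1 h2) 0 t
          le_rfl (Nat.zero_le _) le_rfl))
    intro i j hij hm
    refine h i j hij ?_
    have h1 := K.meet_nr hN hm
    refine nr_mono (Set.subset_union_left.trans Set.subset_union_left) (nr_mul hN h1 (hd i j hij)
      (Set.inv_mem_inv.2 (hd j i hij.symm)) ?_)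
    exact K.rel_dsp' (N := N) (κ := κ) (d := d) (c := c) i j 0 t

theorem near_aux (hN : N ≤ ZP) (i j k : Fin 3) (hij : i ≠ j) (hik : i ≠ k) (hjk : j ≠ k) (a T : ℕ)
    (hno : ∀ τ, a ≤ τ → τ < T → ¬ nr N K.SL1 (K.rel (K.run N κ d c τ) i j)) :
    ∀ g, ∀ τ τ', τ' = τ + g → a ≤ τ → τ' < T → K.meet N κ (K.run N κ d c τ) i k →
      K.meet N κ (K.run N κ d c τ') k j → False := by
  intro g
  induction g using Nat.strong_induction_on with
  | _ g ih =>
    intro τ τ' hg ha hT hm hm'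
    by_cases h1 : ∃ σ, τ < σ ∧ σ < τ' ∧ K.meet N κ (K.run N κ d c σ) i k
    · obtain ⟨σ, h2, h3, h4⟩ := h1
      exact ih (τ' - σ) (by omega) σ τ' (by omega) (by omega) hT h4 hm'
    by_cases h1' : ∃ σ, τ < σ ∧ σ < τ' ∧ K.meet N κ (K.run N κ d c σ) k j
    · obtain ⟨σ, h2, h3, h4⟩ := h1'
      exact ih (σ - τ) (by omega) τ σ (by omega) (by omega) (by omega) hm h4
    push Not at h1 h1'
    have hnij : ∀ σ, a ≤ σ → σ < T → ¬ K.meet N κ (K.run N κ d c σ) i j := fun σ h2 h3 h4 =>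
      hno σ h2 h3 (nr_mono (fun x hx => Or.inl (Or.inr (Or.inl hx))) (K.meet_nr hN h4))
    have hdi : dsp (K.hp N κ d c i) τ τ' ∈ K.SA := by
      by_cases he : τ = τ'
      · right; rw [he, dsp_self]; rfl
      left
      rw [← dsp_mul _ τ (τ + 1)]
      refine Set.mul_mem_mul (K.dsp_mem_S0 _ _) (K.S1'_spec i (τ + 1) τ' ?_ _ _ le_rfl (by omega) le_rfl)
      intro σ h2 h3 l hl x hx
      rcases (show l = j ∨ l = k by omega) with rfl | rfl
      · exact hnij σ (by omega) (by omega) ⟨x, Or.inl hx⟩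
      · exact h1 σ (by omega) h3 ⟨x, Or.inl hx⟩
    have hdk : dsp (K.hp N κ d c k) τ τ' ∈ K.SA := by
      by_cases he : τ = τ'
      · right; rw [he, dsp_self]; rfl
      left
      rw [← dsp_mul _ τ (τ + 1)]
      refine Set.mul_mem_mul (K.dsp_mem_S0 _ _) (K.S1'_spec k (τ + 1) τ' ?_ _ _ le_rfl (by omega) le_rfl)
      intro σ h2 h3 l hl x hx
      rcases (show l = i ∨ l = j by omega) with rfl | rfl
      · exact h1 σ (by omega) h3 ⟨x, Or.inr hx⟩
      · exact h1' σ (by omega) h3 ⟨x, Or.inl hx⟩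
    have h5 := nr_mul hN (K.meet_nr hN hm) (Set.inv_mem_inv.2 hdi) hdk (K.rel_dsp i k τ τ')
    have h6 := nr_trans hN h5 (K.meet_nr hN hm')
    have e : K.rel (K.run N κ d c τ') i k * K.rel (K.run N κ d c τ') k j = K.rel (K.run N κ d c τ') i j := by
      simp [rel, mul_assoc]
    rw [e] at h6
    exact hno τ' (by omega) hT (nr_mono (fun x hx => Or.inl (Or.inr (Or.inr (Or.inl hx)))) h6)

theorem near (hN : N ≤ ZP) (i j : Fin 3) (h0 : nr N K.SL1 (K.rel c i j)) (T : ℕ) :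
    nr N K.SL (K.rel (K.run N κ d c T) i j) := by
  by_cases hij : i = j
  · subst hij
    refine ⟨1, N.one_mem, Or.inl (Or.inl (Or.inr (Or.inr (Or.inr ?_))))⟩
    simp [rel]
  obtain ⟨T0, hT0, hnr, hno⟩ : ∃ T0 ≤ T, nr N K.SL1 (K.rel (K.run N κ d c T0) i j) ∧
      ∀ τ, T0 < τ → τ ≤ T → ¬ nr N K.SL1 (K.rel (K.run N κ d c τ) i j) := by
    induction T with
    | zero => exact ⟨0, le_rfl, h0, fun τ _ _ => by omega⟩
    | succ T ih =>
      by_cases hc : nr N K.SL1 (K.rel (K.run N κ d c (T + 1)) i j)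
      · exact ⟨T + 1, le_rfl, hc, fun τ _ _ => by omega⟩
      · obtain ⟨T0, h1, h2, h3⟩ := ih
        refine ⟨T0, by omega, h2, fun τ h4 h5 => ?_⟩
        by_cases hτ : τ = T + 1
        · rw [hτ]; exact hc
        · exact h3 τ h4 (by omega)
  by_cases hTT : T0 = T
  · subst hTT; exact nr_mono Set.subset_union_left hnr
  have h3 : ∀ i j : Fin 3, ∃ k, k ≠ i ∧ k ≠ j := by decide
  obtain ⟨k, hki, hkj⟩ := h3 i j
  have hno' : ∀ τ, T0 + 1 ≤ τ → τ < T → ¬ nr N K.SL1 (K.rel (K.run N κ d c τ) j i) := by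
    intro τ h1 h2 h3
    have := nr_inv hN h3
    rw [SL1_inv, rel_inv] at this
    exact hno τ (by omega) (by omega) this
  have hnij : ∀ σ, T0 + 1 ≤ σ → σ < T → ¬ K.meet N κ (K.run N κ d c σ) i j := fun σ h2 h3 h4 =>
      hno σ (by omega) (by omega) (nr_mono (fun x hx => Or.inl (Or.inr (Or.inl hx))) (K.meet_nr hN h4))
  have hor : (∀ σ, T0 + 1 ≤ σ → σ < T → ¬ K.meet N κ (K.run N κ d c σ) i k) ∨
      (∀ σ, T0 + 1 ≤ σ → σ < T → ¬ K.meet N κ (K.run N κ d c σ) j k) := by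
    by_contra hc
    push Not at hc
    obtain ⟨⟨τ, h1, h2, h3⟩, ⟨τ', h1', h2', h3'⟩⟩ := hc
    by_cases hle : τ ≤ τ'
    · exact K.near_aux hN i j k hij hki.symm hkj.symm (T0 + 1) T
        (fun σ h4 h5 => hno σ (by omega) (by omega)) (τ' - τ) τ τ' (by omega) h1 h2' h3 (K.meet_symm.1 h3')
    · exact K.near_aux hN j i k (Ne.symm hij) hkj.symm hki.symm (T0 + 1) T hno' (τ - τ') τ' τ (by omega) h1' h2 h3' (K.meet_symm.1 h3)
  have hgen : ∀ i j : Fin 3, i ≠ j → k ≠ i → k ≠ j →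
      (∀ σ, T0 + 1 ≤ σ → σ < T → ¬ K.meet N κ (K.run N κ d c σ) i j) →
      (∀ σ, T0 + 1 ≤ σ → σ < T → ¬ K.meet N κ (K.run N κ d c σ) i k) →
      dsp (K.hp N κ d c i) T0 T ∈ K.S0 * K.Siso ∧ dsp (K.hp N κ d c j) T0 T ∈ K.S0 * K.Siso := by
    intro i j hij hki hkj h1 h2
    constructor
    · rw [← dsp_mul _ T0 (T0 + 1)]
      refine Set.mul_mem_mul (K.dsp_mem_S0 _ _) (Or.inl (Or.inl
        (K.S1'_spec i (T0 + 1) T ?_ _ _ le_rfl (by omega) le_rfl)))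
      intro σ h3 h4 l hl x hx
      rcases (show l = j ∨ l = k by omega) with rfl | rfl
      · exact h1 σ h3 h4 ⟨x, Or.inl hx⟩
      · exact h2 σ h3 h4 ⟨x, Or.inl hx⟩
    · rw [← dsp_mul _ T0 (T0 + 1)]
      refine Set.mul_mem_mul (K.dsp_mem_S0 _ _) (Or.inl (Or.inr
        (K.S2'_spec hN j k hkj.symm (T0 + 1) T (by omega) ?_ ?_)))
      · intro σ h3 h4 l hl hl' x hx
        obtain rfl : l = i := by omega
        exact h1 σ h3 h4 ⟨x, Or.inr hx⟩
      · intro σ h3 h4 l hl hl' x hx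
        obtain rfl : l = i := by omega
        exact h2 σ h3 h4 ⟨x, Or.inr hx⟩
  have hfin : dsp (K.hp N κ d c i) T0 T ∈ K.S0 * K.Siso ∧ dsp (K.hp N κ d c j) T0 T ∈ K.S0 * K.Siso := by
    rcases hor with h | h
    · exact hgen i j hij hki hkj hnij h
    · exact (hgen j i (Ne.symm hij) hkj hki (fun σ h1 h2 h3 => hnij σ h1 h2 (K.meet_symm.1 h3)) h).symm
  exact nr_mono Set.subset_union_right
    (nr_mul hN hnr (Set.inv_mem_inv.2 hfin.1) hfin.2 (K.rel_dsp i j T0 T))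

/-- shifting the heads by (central) elements -/
noncomputable def zc (z : Fin 3 → PG) (c : K.Cfg) : K.Cfg := fun i => (z i * (c i).1, (c i).2)

theorem rel_zc (z : Fin 3 → PG) (hz : ∀ i, z i ∈ ZP) (c : K.Cfg) (i j : Fin 3) :
    K.rel (K.zc z c) i j = (z i)⁻¹ * z j * K.rel c i j := by
  have h := ZP_comm ((z i)⁻¹ * z j) (c i).1⁻¹ (ZP.mul_mem (ZP.inv_mem (hz i)) (hz j))
  simp only [rel, zc]
  rw [← mul_assoc ((z i)⁻¹ * z j), h]
  simp [mul_assoc]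

/-- the main simulation -/
theorem sim {N' : Subgroup PG} (hN : N ≤ ZP) (hN' : N' ≤ N)
    (hB : ∀ b : Fin K.w, ∀ s ∈ K.SL, ((K.W b)⁻¹.1 * s, 1) ∈ N → ((K.W b)⁻¹.1 * s, 1) ∈ N')
    (z : Fin 3 → PG) (hz : ∀ i, z i ∈ ZP) (hz' : ∀ i j, κ i = κ j → (z i)⁻¹ * z j ∈ N)
    (hin : ∀ i j, κ i = κ j → (K.rel c i j).1 ∈ K.SL1)
    (hfar : ∀ i j, κ i ≠ κ j → ¬ nr N K.Sfar ((z i)⁻¹ * z j * K.rel c i j)) (t : ℕ) :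
    K.run N (fun _ => 0) d (K.zc z c) t = K.zc z (K.run N' κ d c t) ∧
    ∀ i, K.view N (fun _ => 0) d (K.zc z (K.run N' κ d c t)) i = K.view N' κ d (K.run N' κ d c t) i := by
  have hview : ∀ t, K.run N (fun _ => 0) d (K.zc z c) t = K.zc z (K.run N' κ d c t) →
      ∀ i, K.view N (fun _ => 0) d (K.zc z (K.run N' κ d c t)) i =
        K.view N' κ d (K.run N' κ d c t) i := by
    intro t ht i
    apply view_congr
    · intro b
      show env d (z i * _ * _) = _
      rw [mul_assoc, env_ZP (hz i)]
    · intro j b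
      by_cases hij : κ i = κ j
      · have e : (K.W b)⁻¹ * K.rel (K.zc z (K.run N' κ d c t)) i j =
            ((z i)⁻¹ * z j) * ((K.W b)⁻¹ * K.rel (K.run N' κ d c t) i j) := by
          rw [K.rel_zc z hz, ← mul_assoc (K.W b)⁻¹, ← comm_N hN (hz' i j hij) (K.W b)⁻¹, mul_assoc]
        have e2 : (K.W b)⁻¹ * K.rel (K.zc z (K.run N' κ d c t)) i j ∈ N ↔
            (K.W b)⁻¹ * K.rel (K.run N' κ d c t) i j ∈ N := by
          rw [e]; exact N.mul_mem_cancel_left (hz' i j hij)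
        have e3 : (K.W b)⁻¹ * K.rel (K.run N' κ d c t) i j ∈ N →
            (K.W b)⁻¹ * K.rel (K.run N' κ d c t) i j ∈ N' := by
          intro h
          obtain ⟨n, hn, hs⟩ := K.near (N := N') (κ := κ) (d := d) (hN'.trans hN) i j
            ⟨1, N'.one_mem, by rw [mul_one]; exact hin i j hij⟩ t
          have h1 : (K.W b)⁻¹ * (K.rel (K.run N' κ d c t) i j * n) ∈ N := by
            rw [← mul_assoc]; exact N.mul_mem h (hN' hn)
          have h2 : (K.W b)⁻¹ * (K.rel (K.run N' κ d c t) i j * n) =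
              ((K.W b)⁻¹.1 * (K.rel (K.run N' κ d c t) i j * n).1, 1) :=
            Prod.ext rfl ((mem_ZP _).1 (hN h1)).2
          have h3 := hB b _ hs (h2 ▸ h1)
          rw [← h2, ← mul_assoc] at h3
          exact (N'.mul_mem_cancel_right hn).1 h3
        constructor
        · rintro ⟨_, h⟩; exact ⟨hij, e3 (e2.1 h)⟩
        · rintro ⟨_, h⟩; exact ⟨rfl, e2.2 (hN' h)⟩
      · constructor
        · intro h
          have := K.far (N := N) (κ := fun _ => 0) (d := d) (c := K.zc z c) hN κ
            (fun i j h => by rw [K.rel_zc z hz]; exact hfar i j h) t i j hij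
          rw [ht] at this
          exact absurd ⟨b, Or.inl h⟩ this
        · rintro ⟨h, _⟩; exact absurd h hij
    · intro j b _; rfl
  induction t with
  | zero => exact ⟨rfl, hview 0 rfl⟩
  | succ t ih =>
    have h : K.run N (fun _ => 0) d (K.zc z c) (t + 1) = K.zc z (K.run N' κ d c (t + 1)) := by
      rw [run_succ, run_succ, ih.1]
      funext i
      refine Prod.ext ?_ ?_
      · simp only [step]
        rw [ih.2 i]
        simp [zc, step, mul_assoc]
      · simp only [step]
        rw [ih.2 i]
        simp [zc, step]
    exact ⟨h, hview _ h⟩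

end

end Mach

end FH


namespace FH

open Pointwise

theorem cluster (R : Fin 3 → Fin 3 → Prop) (hr : ∀ i, R i i) (hs : ∀ i j, R i j → R j i) :
    ∃ κ : Fin 3 → Fin 3, (∀ i, ∃ k, R (κ i) k ∧ R k i) ∧ ∀ i j, R i j → κ i = κ j := by
  have key : ∀ r : Fin 3 → Fin 3 → Bool, (∀ i, r i i = true) → (∀ i j, r i j = true → r j i = true) →
      ∃ κ : Fin 3 → Fin 3, (∀ i, ∃ k, r (κ i) k = true ∧ r k i = true) ∧ ∀ i j, r i j = true → κ i = κ j := by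
    intro r hr hs
    by_cases h01 : r 0 1 = true
    · by_cases h02 : r 0 2 = true
      · refine ⟨fun _ => 0, fun i => ⟨0, hr 0, ?_⟩, fun _ _ _ => rfl⟩
        fin_cases i <;> simp [*]
      · by_cases h12 : r 1 2 = true
        · refine ⟨fun _ => 1, fun i => ⟨1, hr 1, ?_⟩, fun _ _ _ => rfl⟩
          fin_cases i <;> simp [*]
        · refine ⟨![0, 0, 2], fun i => ⟨![0, 0, 2] i, hr _, ?_⟩, fun i j h => ?_⟩
          · fin_cases i <;> simp [*]
          · have h20 := fun h => h02 (hs 2 0 h)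
            have h21 := fun h => h12 (hs 2 1 h)
            fin_cases i <;> fin_cases j <;> simp_all
    · by_cases h02 : r 0 2 = true
      · by_cases h12 : r 1 2 = true
        · have := hs _ _ h02
          have := hs _ _ h12
          refine ⟨fun _ => 2, fun i => ⟨2, hr 2, ?_⟩, fun _ _ _ => rfl⟩
          fin_cases i <;> simp [*]
        · refine ⟨![0, 1, 0], fun i => ⟨![0, 1, 0] i, hr _, ?_⟩, fun i j h => ?_⟩
          · fin_cases i <;> simp [*]
          · have h20 := fun h => h01 (hs 1 0 h)
            have h21 := fun h => h12 (hs 2 1 h)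
            fin_cases i <;> fin_cases j <;> simp_all
      · by_cases h12 : r 1 2 = true
        · refine ⟨![0, 1, 1], fun i => ⟨![0, 1, 1] i, hr _, ?_⟩, fun i j h => ?_⟩
          · fin_cases i <;> simp [*]
          · have h20 := fun h => h01 (hs 1 0 h)
            have h21 := fun h => h02 (hs 2 0 h)
            fin_cases i <;> fin_cases j <;> simp_all
        · refine ⟨![0, 1, 2], fun i => ⟨![0, 1, 2] i, hr _, ?_⟩, fun i j h => ?_⟩
          · fin_cases i <;> simp [*]
          · have h20 := fun h => h01 (hs 1 0 h)
            have h21 := fun h => h02 (hs 2 0 h)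
            have h22 := fun h => h12 (hs 2 1 h)
            fin_cases i <;> fin_cases j <;> simp_all
  classical
  have := key (fun i j => decide (R i j)) (fun i => by simpa using hr i)
    (fun i j => by simpa using hs i j)
  simpa using this

namespace Mach
variable (K : Mach)

/-- everything the heads see -/
abbrev Obs := Fin 3 → Option (Fin K.M) × K.View

/-- everything the heads see -/
noncomputable def obs (N : Subgroup PG) (κ : Fin 3 → Fin 3) (d : ℕ) (c : K.Cfg) : K.Obs :=
  fun i => ((c i).2, K.view N κ d c i)

/-- existence of a rejecting run -/
def Rej (I Fi : K.Obs → Prop) (N : Subgroup PG) (d : ℕ) : Prop :=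
  ∃ (c : K.Cfg) (t : ℕ), I (K.obs N (fun _ => 0) d c) ∧
    Fi (K.obs N (fun _ => 0) d (K.run N (fun _ => 0) d c t))

/-- existence of a rejecting run, with clusters -/
def Rej' (I Fi : K.Obs → Prop) (N : Subgroup PG) (d : ℕ) : Prop :=
  ∃ (κ : Fin 3 → Fin 3) (c : K.Cfg) (t : ℕ), (∀ i j, κ i = κ j → (K.rel c i j).1 ∈ K.SL1) ∧
    I (K.obs N κ d c) ∧ Fi (K.obs N κ d (K.run N κ d c t))

theorem sep {A : Set ℕ} (hA : ∀ n, 2 * n + 1 ∉ A) (c : K.Cfg) (Y : Set PG) (hY : Y.Finite) (hYZ : Y ⊆ ZP) :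
    ∃ z ∈ ZP, ∀ y ∈ Y, (∀ i j, ¬ nr (NN A) K.Sfar (y⁻¹ * z * K.rel c i j)) ∧
      (∀ i j, ¬ nr (NN A) K.Sfar (z⁻¹ * y * K.rel c i j)) := by
  have hXf : ((fun p : PG × HH × Fin 3 × Fin 3 => p.1 * ((p.2.1 * (K.rel c p.2.2.1 p.2.2.2).1⁻¹, 1) : PG)) ''
    (Y ×ˢ (K.Sfar ×ˢ (Set.univ ×ˢ Set.univ)))).Finite :=
    (hY.prod (K.Sfar_finite.prod (Set.finite_univ.prod Set.finite_univ))).image _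
  obtain ⟨z, hz, h⟩ := NN_infinite A hA _ hXf
  refine ⟨z, hz, fun y hy => ?_⟩
  have h1 : ∀ i j, ¬ nr (NN A) K.Sfar (y⁻¹ * z * K.rel c i j) := by
    rintro i j ⟨n, hn, hs⟩
    refine h _ ⟨(y, _, i, j), ⟨hy, hs, trivial, trivial⟩, rfl⟩ ?_
    have e : ((((y⁻¹ * z * K.rel c i j * n).1 * (K.rel c i j).1⁻¹, 1) : PG)) = y⁻¹ * z * n := by
      have hyzn : y⁻¹ * z * n ∈ ZP := ZP.mul_mem (ZP.mul_mem (ZP.inv_mem (hYZ hy)) hz) (NN_le A hn)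
      refine Prod.ext ?_ ((mem_ZP _).1 hyzn).2.symm
      rw [mul_assoc _ _ n, ← comm_N (NN_le A) hn, ← mul_assoc]
      simp
    have : (y * (y⁻¹ * z * n))⁻¹ * z = n⁻¹ := by
      rw [← mul_assoc, mul_inv_cancel_left, mul_inv_rev]; simp
    rw [← e] at this
    exact this ▸ (NN A).inv_mem hn
  refine ⟨h1, fun i j hc => ?_⟩
  have h2 := nr_inv (NN_le A) hc
  rw [Sfar_inv, mul_inv_rev, mul_inv_rev, inv_inv, rel_inv, ← ZP_comm (y⁻¹ * z) _
    (ZP.mul_mem (ZP.inv_mem (hYZ hy)) hz)] at h2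
  exact h1 j i h2

theorem rej_iff {A B : Set ℕ} (hA : ∀ n, 2 * n + 1 ∉ A) (hBA : B ⊆ A)
    (hB : ∀ b : Fin K.w, ∀ s ∈ K.SL, ((K.W b)⁻¹.1 * s, 1) ∈ NN A → ((K.W b)⁻¹.1 * s, 1) ∈ NN B)
    (I Fi : K.Obs → Prop) (d : ℕ) : K.Rej I Fi (NN A) d ↔ K.Rej' I Fi (NN B) d := by
  have hN := NN_le A
  have hNN := NN_mono hBA
  constructor
  · rintro ⟨c, t, hI, hF⟩
    obtain ⟨κ, h1, h2⟩ := cluster (fun i j => nr (NN A) K.Sfar (K.rel c i j))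
      (fun i => ⟨1, (NN A).one_mem, by simpa [rel] using K.one_mem_Sfar⟩) (fun i j h => by
        have := nr_inv hN h
        rwa [Sfar_inv, rel_inv] at this)
    have h3 : ∀ i, nr (NN A) (K.Sfar * K.Sfar) (K.rel c (κ i) i) := by
      intro i
      obtain ⟨k, ha, hb⟩ := h1 i
      have := nr_trans hN ha hb
      rwa [show K.rel c (κ i) k * K.rel c k i = K.rel c (κ i) i by simp [rel, mul_assoc]] at this
    choose n hn hs using h3
    let c0 : K.Cfg := fun i => ((c i).1 * n i, (c i).2)
    let z : Fin 3 → PG := fun i => (n i)⁻¹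
    have hzN : ∀ i, z i ∈ NN A := fun i => (NN A).inv_mem (hn i)
    have hz : K.zc z c0 = c := by
      funext i
      refine Prod.ext ?_ rfl
      show (n i)⁻¹ * ((c i).1 * n i) = (c i).1
      rw [← comm_N hN (hn i)]; simp
    have hin : ∀ i j, κ i = κ j → (K.rel c0 i j).1 ∈ K.SL1 := by
      intro i j hij
      refine Or.inl (Or.inl ⟨_, Set.inv_mem_inv.2 (hs i), _, hs j, ?_⟩)
      simp only [rel, c0, hij, ← Prod.fst_mul, ← Prod.fst_inv]
      congr 1
      group
    have hS := K.sim (d := d) hN hNN hB z (fun i => hN (hzN i))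
      (fun i j _ => (NN A).mul_mem ((NN A).inv_mem (hzN i)) (hzN j)) hin (fun i j hij h => by
        rw [← K.rel_zc z (fun i => hN (hzN i)), hz] at h
        exact hij (h2 i j h))
    rw [hz] at hS
    have hobs : ∀ t, K.obs (NN A) (fun _ => 0) d (K.run (NN A) (fun _ => 0) d c t) =
        K.obs (NN B) κ d (K.run (NN B) κ d c0 t) := by
      intro t
      funext i
      refine Prod.ext ?_ ?_
      · show (K.run (NN A) (fun _ => 0) d c t i).2 = _
        rw [(hS t).1]; rfl
      · show K.view _ _ _ _ _ = K.view _ _ _ _ _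
        rw [(hS t).1, (hS t).2]
    exact ⟨κ, c0, t, hin, by rw [← hobs 0 |> fun h => (show K.obs _ _ d c = K.obs _ _ d c0 from h)]; exact hI,
      by rw [← hobs t]; exact hF⟩
  · rintro ⟨κ, c, t, hin, hI, hF⟩
    obtain ⟨y1, hy1, h1⟩ := K.sep hA c {1} (Set.finite_singleton 1) (by simpa using ZP.one_mem)
    obtain ⟨y2, hy2, h2⟩ := K.sep hA c {1, y1} (by simp) (by
      intro x hx
      rcases hx with rfl | rfl
      · exact ZP.one_mem
      · exact hy1)
    let y : Fin 3 → PG := ![1, y1, y2]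
    have hy : ∀ i, y i ∈ ZP := by
      intro i; fin_cases i
      · exact ZP.one_mem
      · exact hy1
      · exact hy2
    have hsep : ∀ a b, a ≠ b → ∀ i j, ¬ nr (NN A) K.Sfar ((y a)⁻¹ * y b * K.rel c i j) := by
      intro a b hab
      fin_cases a <;> fin_cases b
      · exact absurd rfl hab
      · exact (h1 1 rfl).1
      · exact (h2 1 (Or.inl rfl)).1
      · exact (h1 1 rfl).2
      · exact absurd rfl hab
      · exact (h2 y1 (Or.inr rfl)).1
      · exact (h2 1 (Or.inl rfl)).2
      · exact (h2 y1 (Or.inr rfl)).2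
      · exact absurd rfl hab
    have hS := K.sim (d := d) hN hNN hB (fun i => y (κ i)) (fun i => hy _)
      (fun i j h => by simp only [h]; simpa using (NN A).one_mem) hin (fun i j hij => hsep _ _ hij i j)
    have hobs : ∀ t, K.obs (NN A) (fun _ => 0) d (K.run (NN A) (fun _ => 0) d (K.zc (fun i => y (κ i)) c) t) =
        K.obs (NN B) κ d (K.run (NN B) κ d c t) := by
      intro t
      funext i
      refine Prod.ext ?_ ?_
      · show (K.run (NN A) (fun _ => 0) d _ t i).2 = _
        rw [(hS t).1]; rfl
      · show K.view _ _ _ _ _ = K.view _ _ _ _ _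
        rw [(hS t).1, (hS t).2]
    refine ⟨_, t, ?_, by rw [hobs t]; exact hF⟩
    have h0 : K.obs _ _ d (K.zc (fun i => y (κ i)) c) = K.obs _ _ d c := hobs 0
    rw [h0]; exact hI

theorem exists_B {A : Set ℕ} (hA : ∀ n, 2 * n + 1 ∉ A) : ∃ B : Set ℕ, B.Finite ∧ B ⊆ A ∧
    ∀ (I Fi : K.Obs → Prop) (d : ℕ), K.Rej I Fi (NN A) d ↔ K.Rej' I Fi (NN B) d := by
  have hf : ((fun p : Fin K.w × HH => (((K.W p.1)⁻¹.1 * p.2, 1) : PG)) '' (Set.univ ×ˢ K.SL)).Finite :=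
    (Set.finite_univ.prod K.SL_finite).image _
  obtain ⟨B, hB, hBA, h⟩ := NN_finite_sub A _ hf
  exact ⟨B, hB, hBA, fun I Fi d => K.rej_iff hA hBA
    (fun b s hs => h _ ⟨(b, s), ⟨trivial, hs⟩, rfl⟩) I Fi d⟩

end Mach

end FH


namespace FH

section Topo
variable {G : Type*} [Group G] {s k : ℕ} {q : Fin k → ℕ}

/-- the topology on total configurations -/
abbrev ptTop (G : Type*) [Group G] (s k : ℕ) (q : Fin k → ℕ) : TopologicalSpace ((G → Fin s) × YS G k q) :=
  @instTopologicalSpaceProd _ _ (piBot G (Fin s)) (ysTop G k q)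

/-- agreement on a finite set -/
def agree (D : Finset G) (p p' : (G → Fin s) × YS G k q) : Prop :=
  ∀ g ∈ D, p.1 g = p'.1 g ∧ ∀ i, p.2.1 i g = p'.2.1 i g

theorem agree.symm {D : Finset G} {p p' : (G → Fin s) × YS G k q} (h : agree D p p') : agree D p' p :=
  fun g hg => ⟨(h g hg).1.symm, fun i => ((h g hg).2 i).symm⟩

theorem agree.trans {D : Finset G} {p p' p'' : (G → Fin s) × YS G k q} (h : agree D p p') (h' : agree D p' p'') :
    agree D p p'' :=
  fun g hg => ⟨(h g hg).1.trans (h' g hg).1, fun i => ((h g hg).2 i).trans ((h' g hg).2 i)⟩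

theorem agree.mono {D D' : Finset G} (hD : D ⊆ D') {p p' : (G → Fin s) × YS G k q} (h : agree D' p p') :
    agree D p p' := fun g hg => h g (hD hg)

theorem open_piBot {ι α : Type*} {U : Set (ι → α)} (hU : @IsOpen _ (piBot ι α) U) {x : ι → α} (hx : x ∈ U) :
    ∃ D : Finset ι, ∀ x', (∀ g ∈ D, x g = x' g) → x' ∈ U := by
  let : TopologicalSpace α := ⊥
  obtain ⟨D, u, h1, h2⟩ := isOpen_pi_iff.1 hU x hx
  refine ⟨D, fun x' h => h2 ?_⟩
  intro g hg
  rw [← h g hg]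
  exact (h1 g hg).2

theorem open_ys {U : Set (YS G k q)} (hU : @IsOpen _ (ysTop G k q) U) {x : YS G k q} (hx : x ∈ U) :
    ∃ D : Finset G, ∀ x' : YS G k q, (∀ g ∈ D, ∀ i, x.1 i g = x'.1 i g) → x' ∈ U := by
  classical
  let := fun i : Fin k => piBot G (Option (Fin (q i)))
  obtain ⟨V, hV, rfl⟩ := isOpen_induced_iff.1 hU
  obtain ⟨J, u, h1, h2⟩ := isOpen_pi_iff.1 hV x.1 hx
  have : ∀ i : Fin k, ∃ D : Finset G, i ∈ J → ∀ x', (∀ g ∈ D, x.1 i g = x' g) → x' ∈ u i := by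
    intro i
    by_cases hi : i ∈ J
    · obtain ⟨D, hD⟩ := open_piBot (h1 i hi).1 (h1 i hi).2
      exact ⟨D, fun _ => hD⟩
    · exact ⟨∅, fun h => absurd h hi⟩
  choose D hD using this
  refine ⟨Finset.univ.biUnion D, fun x' h => h2 ?_⟩
  intro i hi
  exact hD i hi _ (fun g hg => h g (Finset.mem_biUnion.2 ⟨i, Finset.mem_univ _, hg⟩) i)

theorem open_pt {U : Set ((G → Fin s) × YS G k q)} (hU : @IsOpen _ (ptTop G s k q) U)
    {p : (G → Fin s) × YS G k q} (hp : p ∈ U) :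
    ∃ D : Finset G, ∀ p', agree D p p' → p' ∈ U := by
  classical
  let := piBot G (Fin s)
  let := ysTop G k q
  obtain ⟨u, v, hu, hv, hpu, hpv, huv⟩ := isOpen_prod_iff.1 hU p.1 p.2 hp
  obtain ⟨D1, h1⟩ := open_piBot hu hpu
  obtain ⟨D2, h2⟩ := open_ys hv hpv
  refine ⟨D1 ∪ D2, fun p' h => huv ⟨h1 _ fun g hg => (h g (Finset.mem_union_left _ hg)).1,
    h2 _ fun g hg => (h g (Finset.mem_union_right _ hg)).2⟩⟩

theorem cyl_open (D : Finset G) (p : (G → Fin s) × YS G k q) :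
    @IsOpen _ (ptTop G s k q) {p' | agree D p p'} := by
  let : TopologicalSpace (Fin s) := ⊥
  let : ∀ i, TopologicalSpace (Option (Fin (q i))) := fun i => ⊥
  have : ∀ i, DiscreteTopology (Option (Fin (q i))) := fun i => ⟨rfl⟩
  have : DiscreteTopology (Fin s) := ⟨rfl⟩
  let t1 : TopologicalSpace (YS G k q) := ysTop G k q
  let := ptTop G s k q
  have : {p' | agree D p p'} = ⋂ g ∈ D, ({p' : (G → Fin s) × YS G k q | p'.1 g ∈ ({p.1 g} : Set _)} ∩
      ⋂ i, {p' : (G → Fin s) × YS G k q | p'.2.1 i g ∈ ({p.2.1 i g} : Set _)}) := by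
    ext p'
    simp [agree, eq_comm]
  rw [this]
  refine isOpen_biInter_finset fun g _ => IsOpen.inter ?_ (isOpen_iInter_of_finite fun i => ?_)
  · refine (isOpen_discrete _).preimage ?_
    exact (continuous_apply g).comp (continuous_fst (X := G → Fin s) (Y := YS G k q))
  · refine (isOpen_discrete _).preimage ?_
    have h1 : Continuous fun y : YS G k q => y.1 := continuous_induced_dom
    have h2 : Continuous fun y : YS G k q => y.1 i := (continuous_apply i).comp h1
    have h3 : Continuous fun y : YS G k q => y.1 i g := (continuous_apply g).comp h2
    exact h3.comp (continuous_snd (X := G → Fin s) (Y := YS G k q))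

theorem isOpen_of_cyl {U : Set ((G → Fin s) × YS G k q)} (h : ∀ p ∈ U, ∃ D : Finset G, ∀ p', agree D p p' → p' ∈ U) :
    @IsOpen _ (ptTop G s k q) U := by
  let := ptTop G s k q
  rw [isOpen_iff_forall_mem_open]
  intro p hp
  obtain ⟨D, hD⟩ := h p hp
  exact ⟨_, fun p' hp' => hD p' hp', cyl_open D p, fun g hg => ⟨rfl, fun i => rfl⟩⟩

theorem isOpen_ys_of_cyl {U : Set (YS G k q)} (h : ∀ p ∈ U, ∃ D : Finset G, ∀ p' : YS G k q,
    (∀ g ∈ D, ∀ i, p.1 i g = p'.1 i g) → p' ∈ U) :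
    @IsOpen _ (ysTop G k q) U := by
  have h1 : @IsOpen _ (ptTop G 1 k q) {p : (G → Fin 1) × YS G k q | p.2 ∈ U} := by
    apply isOpen_of_cyl
    intro p hp
    obtain ⟨D, hD⟩ := h _ hp
    exact ⟨D, fun p' hp' => hD _ fun g hg => (hp' g hg).2⟩
  let : TopologicalSpace (G → Fin 1) := piBot G (Fin 1)
  let t1 : TopologicalSpace (YS G k q) := ysTop G k q
  have h2 : Continuous fun y : YS G k q => ((fun _ => 0 : G → Fin 1), y) := by fun_prop
  exact h1.preimage h2

theorem continuous_of_cyl (f : (G → Fin s) × YS G k q → (G → Fin s) × YS G k q) (h1 : ∀ p, (f p).1 = p.1)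
    (h2 : ∀ i g p, ∃ D : Finset G, ∀ p', agree D p p' → (f p').2.1 i g = (f p).2.1 i g) :
    @Continuous _ _ (ptTop G s k q) (ptTop G s k q) f := by
  let : TopologicalSpace (Fin s) := ⊥
  let : ∀ i, TopologicalSpace (Option (Fin (q i))) := fun i => ⊥
  have : ∀ i, DiscreteTopology (Option (Fin (q i))) := fun i => ⟨rfl⟩
  have : DiscreteTopology (Fin s) := ⟨rfl⟩
  let t1 : TopologicalSpace (YS G k q) := ysTop G k q
  let t2 := ptTop G s k q
  have e1 : Continuous fun p => (f p).1 := by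
    simp only [h1]
    exact continuous_fst (X := G → Fin s) (Y := YS G k q)
  have e2 : Continuous fun p => (f p).2 := by
    refine continuous_induced_rng.2 ?_
    refine continuous_pi fun i => ?_
    refine continuous_pi fun g => ?_
    refine continuous_def.2 fun S _ => isOpen_of_cyl fun p hp => ?_
    obtain ⟨D, hD⟩ := h2 i g p
    refine ⟨D, fun p' hp' => ?_⟩
    show (f p').2.1 i g ∈ S
    rw [hD p' hp']; exact hp
  exact Continuous.prodMk e1 e2

theorem compact_pt : @CompactSpace ((G → Fin s) × YS G k q) (ptTop G s k q) := by
  let : TopologicalSpace (Fin s) := ⊥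
  let : ∀ i, TopologicalSpace (Option (Fin (q i))) := fun i => ⊥
  have : ∀ i, DiscreteTopology (Option (Fin (q i))) := fun i => ⟨rfl⟩
  have : DiscreteTopology (Fin s) := ⟨rfl⟩
  let t1 : TopologicalSpace (YS G k q) := ysTop G k q
  have : CompactSpace (G → Fin s) := inferInstance
  have : CompactSpace (∀ i : Fin k, G → Option (Fin (q i))) := inferInstance
  have : CompactSpace (YS G k q) := by
    have hc : IsClosed {y : ∀ i : Fin k, G → Option (Fin (q i)) | ∀ i, HeadOK (y i)} := by
      have : {y : ∀ i : Fin k, G → Option (Fin (q i)) | ∀ i, HeadOK (y i)} =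
        ⋂ i, ⋂ a, ⋂ b, {y | (y i a, y i b) ∈ {z : Option (Fin (q i)) × Option (Fin (q i)) | z.1 ≠ none → z.2 ≠ none → a = b}} := by
        ext y; simp [HeadOK]
      rw [this]
      refine isClosed_iInter fun i => isClosed_iInter fun a => isClosed_iInter fun b => ?_
      refine (isClosed_discrete _).preimage ?_
      fun_prop
    exact isCompact_iff_compactSpace.1 hc.isCompact
  exact (inferInstance : CompactSpace ((G → Fin s) × YS G k q))

theorem finite_det {β : Type*} (φ : (G → Fin s) × YS G k q → β)
    (h : ∀ p, ∃ D : Finset G, ∀ p', agree D p p' → φ p' = φ p) :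
    ∃ D : Finset G, ∀ p p', agree D p p' → φ p' = φ p := by
  classical
  choose D hD using h
  let := ptTop G s k q
  have : CompactSpace ((G → Fin s) × YS G k q) := compact_pt
  obtain ⟨T, hT⟩ := isCompact_univ.elim_finite_subcover (fun p : (G → Fin s) × YS G k q => {p' | agree (D p) p p'})
    (fun p => cyl_open _ _) (fun p _ => Set.mem_iUnion.2 ⟨p, fun g hg => ⟨rfl, fun i => rfl⟩⟩)
  refine ⟨T.biUnion D, fun p p' hp => ?_⟩
  obtain ⟨r, hr, hpr⟩ := Set.mem_iUnion₂.1 (hT (Set.mem_univ p))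
  have h1 : agree (D r) p p' := hp.mono (Finset.subset_biUnion_of_mem D hr)
  rw [hD r p hpr, hD r p' (agree.trans hpr h1)]

theorem clopen_det {S : Set (YS G k q)} (hS : @IsClopen _ (ysTop G k q) S) :
    ∃ D : Finset G, ∀ y y' : YS G k q, (∀ g ∈ D, ∀ i, y.1 i g = y'.1 i g) → y ∈ S → y' ∈ S := by
  have hc : @IsOpen _ (ysTop G k q) Sᶜ := by
    let := ysTop G k q
    exact hS.compl.isOpen
  have ho : @IsOpen _ (ysTop G k q) S := by
    let := ysTop G k q
    exact hS.isOpen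
  obtain ⟨D, hD⟩ := finite_det (s := 1) (fun p : (G → Fin 1) × YS G k q => (p.2 ∈ S : Prop)) (by
    intro p
    by_cases hp : p.2 ∈ S
    · obtain ⟨D, hD⟩ := open_ys ho hp
      exact ⟨D, fun p' h => by simp [hp, hD p'.2 fun g hg => (h g hg).2]⟩
    · obtain ⟨D, hD⟩ := open_ys hc hp
      refine ⟨D, fun p' h => ?_⟩
      have : p'.2 ∉ S := hD p'.2 fun g hg => (h g hg).2
      simp [hp, this])
  refine ⟨D, fun y y' h hy => ?_⟩
  have := hD ((fun _ => 0), y) ((fun _ => 0), y') (fun g hg => ⟨rfl, h g hg⟩)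
  exact this.mpr hy

theorem clopen_of_det {S : Set (YS G k q)} (D : Finset G)
    (h : ∀ y y' : YS G k q, (∀ g ∈ D, ∀ i, y.1 i g = y'.1 i g) → y ∈ S → y' ∈ S) :
    @IsClopen _ (ysTop G k q) S := by
  have h1 : @IsOpen _ (ysTop G k q) S := isOpen_ys_of_cyl fun p hp => ⟨D, fun p' hp' => h p p' hp' hp⟩
  have h2 : @IsOpen _ (ysTop G k q) Sᶜ := isOpen_ys_of_cyl fun p hp => ⟨D, fun p' hp' hc =>
    hp (h p' p (fun g hg i => (hp' g hg i).symm) hc)⟩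
  let := ysTop G k q
  exact ⟨⟨h2⟩, h1⟩

theorem open_preimage (aut : GWA G s k) {U : Set ((G → Fin s) × YS G k aut.q)} (hU : @IsOpen _ (ptTop G s k aut.q) U) :
    @IsOpen _ (ptTop G s k aut.q) (aut.f ⁻¹' U) := by
  have h := aut.cont
  let := ptTop G s k aut.q
  exact hU.preimage h

theorem yshift_mul (g h : G) (y : YS G k q) : yshift g (yshift h y) = yshift (g * h) y := by
  refine Subtype.ext ?_
  funext i a
  simp [yshift, shiftC, mul_assoc]

theorem shiftC_mul {α : Type*} (g h : G) (y : G → α) : shiftC g (shiftC h y) = shiftC (g * h) y := by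
  funext a
  simp [shiftC, mul_assoc]

theorem yshift_one (y : YS G k q) : yshift 1 y = y := by
  refine Subtype.ext ?_
  funext i a
  simp [yshift, shiftC]

theorem iter_equivar (aut : GWA G s k) (g : G) (n : ℕ) (x : G → Fin s) (y : YS G k aut.q) :
    aut.f^[n] (shiftC g x, yshift g y) = (shiftC g x, yshift g (aut.f^[n] (x, y)).2) ∧
    (aut.f^[n] (x, y)).1 = x := by
  induction n with
  | zero => exact ⟨rfl, rfl⟩
  | succ n ih =>
    rw [Function.iterate_succ_apply', Function.iterate_succ_apply']
    refine ⟨?_, by rw [aut.fst_eq, ih.2]⟩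
    rw [ih.1]
    have h := aut.equivar g (aut.f^[n] (x, y))
    rw [ih.2] at h
    rw [h, aut.fst_eq, ih.2]

/-- a reformulation of membership -/
theorem notMem_autSet (aut : GWA G s k) (x : G → Fin s) : x ∉ autSet aut ↔
    ∃ (y : YS G k aut.q) (n : ℕ), (∃ β, yshift β y ∈ aut.Ini) ∧ ∃ β, yshift β (aut.f^[n] (x, y)).2 ∈ aut.Fini := by
  simp only [autSet, Set.mem_setOf_eq]
  push Not
  constructor
  · rintro ⟨g, h, y, n, hy, hF⟩
    refine ⟨yshift g⁻¹ y, n, ⟨g, by rwa [yshift_mul, mul_inv_cancel, yshift_one]⟩, h * g, ?_⟩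
    have := (iter_equivar aut g n x (yshift g⁻¹ y)).1
    rw [yshift_mul, mul_inv_cancel, yshift_one] at this
    rw [this] at hF
    rwa [← yshift_mul]
  · rintro ⟨y, n, ⟨β, hβ⟩, β', hβ'⟩
    refine ⟨β, β' * β⁻¹, yshift β y, n, hβ, ?_⟩
    rw [(iter_equivar aut β n x y).1, yshift_mul]
    simpa using hβ'

end Topo

end FH


namespace FH

section Embed
variable {G : Type*} [Group G] {s k : ℕ} {q : Fin k → ℕ}

/-- forget the extra head -/
def downY (y : YS G (k+1) (Fin.cons 0 q : Fin (k+1) → ℕ)) : YS G k q :=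
  ⟨fun i => y.1 i.succ, fun i => y.2 i.succ⟩

/-- add an extra head -/
def upY (y : YS G k q) : YS G (k+1) (Fin.cons 0 q : Fin (k+1) → ℕ) :=
  ⟨fun i => Fin.cases (motive := fun i => G → Option (Fin ((Fin.cons 0 q : Fin (k+1) → ℕ) i))) (fun _ => none) y.1 i, fun i => by
    refine Fin.cases ?_ ?_ i
    · intro a b ha; exact absurd rfl ha
    · intro j; exact y.2 j⟩

theorem down_up (y : YS G k q) : downY (upY y) = y := rfl

theorem opt_zero (x : Option (Fin 0)) : x = none := by
  cases x with
  | none => rfl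
  | some a => exact a.elim0

theorem up_down (y : YS G (k+1) (Fin.cons 0 q : Fin (k+1) → ℕ)) : upY (downY y) = y := by
  refine Subtype.ext ?_
  funext i
  refine Fin.cases ?_ ?_ i
  · funext g
    exact (opt_zero _).symm
  · intro j; rfl

theorem ext_down {y y' : YS G (k+1) (Fin.cons 0 q : Fin (k+1) → ℕ)} (h : downY y = downY y') : y = y' := by
  rw [← up_down y, h, up_down]

theorem down_shift (g : G) (y : YS G (k+1) (Fin.cons 0 q : Fin (k+1) → ℕ)) :
    downY (yshift g y) = yshift g (downY y) := rfl

/-- add a head to an automaton -/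
def addHead (aut : GWA G s k) : GWA G s (k+1) where
  q := Fin.cons 0 aut.q
  f p := ((aut.f (p.1, downY p.2)).1, upY (aut.f (p.1, downY p.2)).2)
  cont := by
    refine continuous_of_cyl _ (fun p => aut.fst_eq _) ?_
    intro i g p
    refine Fin.cases ?_ ?_ i
    · exact ⟨∅, fun p' _ => rfl⟩
    · intro j
      have h := aut.cont
      have ho : @IsOpen _ (ptTop G s k aut.q) {r | agree {g} (aut.f (p.1, downY p.2)) (aut.f r)} :=
        open_preimage aut (cyl_open {g} (aut.f (p.1, downY p.2)))
      obtain ⟨D, hD⟩ := open_pt ho (p := (p.1, downY p.2)) (fun g _ => ⟨rfl, fun i => rfl⟩)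
      refine ⟨D, fun p' hp' => ?_⟩
      have h1 := hD (p'.1, downY p'.2) (fun g hg => ⟨(hp' g hg).1, fun i => (hp' g hg).2 i.succ⟩)
      exact ((h1 g (Finset.mem_singleton_self g)).2 j).symm
  fst_eq p := aut.fst_eq _
  equivar g p := by
    have h := aut.equivar g (p.1, downY p.2)
    refine Prod.ext ?_ ?_
    · have h1 := congrArg Prod.fst h
      exact h1
    · apply ext_down
      have h1 := congrArg Prod.snd h
      exact h1
  vanish p i := by
    refine Fin.cases ?_ ?_ i
    · constructor
      · intro _; funext g; exact opt_zero _
      · intro _; rfl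
    · intro j
      exact aut.vanish (p.1, downY p.2) j
  Ini := {y | downY y ∈ aut.Ini}
  Fini := {y | downY y ∈ aut.Fini}
  clopen_Ini := by
    obtain ⟨D, hD⟩ := clopen_det aut.clopen_Ini
    exact clopen_of_det D fun y y' h hy => hD _ _ (fun g hg i => h g hg i.succ) hy
  clopen_Fini := by
    obtain ⟨D, hD⟩ := clopen_det aut.clopen_Fini
    exact clopen_of_det D fun y y' h hy => hD _ _ (fun g hg i => h g hg i.succ) hy

theorem addHead_iter (aut : GWA G s k) (n : ℕ) (x : G → Fin s) (y : YS G (k+1) (Fin.cons 0 aut.q : Fin (k+1) → ℕ)) :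
    downY (((addHead aut).f^[n] (x, y)).2) = (aut.f^[n] (x, downY y)).2 ∧
    ((addHead aut).f^[n] (x, y)).1 = (aut.f^[n] (x, downY y)).1 := by
  induction n with
  | zero => exact ⟨rfl, rfl⟩
  | succ n ih =>
    rw [Function.iterate_succ_apply', Function.iterate_succ_apply']
    have e : (aut.f^[n] (x, downY y)) = (((addHead aut).f^[n] (x, y)).1, downY (((addHead aut).f^[n] (x, y)).2)) :=
      Prod.ext ih.2.symm ih.1.symm
    rw [e]
    exact ⟨rfl, rfl⟩

theorem addHead_set (aut : GWA G s k) : autSet (addHead aut) = autSet aut := by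
  ext x
  constructor
  · intro h g h' y n hy hF
    refine h g h' (upY y) n hy ?_
    have h4 : yshift h' (downY (((addHead aut).f^[n] (shiftC g x, upY y)).2)) =
      yshift h' (aut.f^[n] (shiftC g x, y)).2 := congrArg _ (addHead_iter aut n (shiftC g x) (upY y)).1
    have h5 := Set.mem_of_eq_of_mem h4 hF
    exact h5
  · intro h g h' y n hy hF
    refine h g h' (downY y) n hy ?_
    have h4 : yshift h' (downY (((addHead aut).f^[n] (shiftC g x, y)).2)) =
      yshift h' (aut.f^[n] (shiftC g x, downY y)).2 := congrArg _ (addHead_iter aut n (shiftC g x) y).1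
    exact Set.mem_of_eq_of_mem h4.symm hF

end Embed

section Extract
variable {G : Type*} [Group G]

/-- window of a configuration -/
theorem window (aut : GWA G 3 3) : ∃ D : Finset G, (1 : G) ∈ D ∧
    (∀ i (p p' : (G → Fin 3) × YS G 3 aut.q), agree D p p' → p.2.1 i 1 ≠ none →
      (aut.f p').2.1 i = (aut.f p).2.1 i) ∧
    (∀ y y' : YS G 3 aut.q, (∀ g ∈ D, ∀ i, y.1 i g = y'.1 i g) → y ∈ aut.Ini → y' ∈ aut.Ini) ∧
    (∀ y y' : YS G 3 aut.q, (∀ g ∈ D, ∀ i, y.1 i g = y'.1 i g) → y ∈ aut.Fini → y' ∈ aut.Fini) := by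
  classical
  have h1 : ∀ i : Fin 3, ∃ D : Finset G, ∀ (p p' : (G → Fin 3) × YS G 3 aut.q), agree D p p' →
      p.2.1 i 1 ≠ none → (aut.f p').2.1 i = (aut.f p).2.1 i := by
    intro i
    obtain ⟨D, hD⟩ := finite_det (fun p : (G → Fin 3) × YS G 3 aut.q =>
        if p.2.1 i 1 = none then none else some ((aut.f p).2.1 i)) (by
      intro p
      by_cases hp : p.2.1 i 1 = none
      · refine ⟨{1}, fun p' h => ?_⟩
        have : p'.2.1 i 1 = none := by rw [← (h 1 (Finset.mem_singleton_self 1)).2 i, hp]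
        simp [hp, this]
      · have hv : ¬ ((aut.f p).2.1 i = fun _ => none) := by
          rw [aut.vanish]
          intro h
          exact hp (congrFun h 1)
        obtain ⟨g, hg⟩ := Function.ne_iff.1 hv
        have ho : @IsOpen _ (ptTop G 3 3 aut.q) {r | agree {g} (aut.f p) (aut.f r)} :=
          open_preimage aut (cyl_open {g} (aut.f p))
        obtain ⟨D, hD⟩ := open_pt ho (p := p) (fun g _ => ⟨rfl, fun i => rfl⟩)
        refine ⟨insert 1 D, fun p' h => ?_⟩
        have h1 : p'.2.1 i 1 ≠ none := by rwa [← (h 1 (Finset.mem_insert_self 1 _)).2 i]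
        rw [if_neg h1, if_neg hp]
        have h2 := (hD p' (h.mono (Finset.subset_insert _ _)) g (Finset.mem_singleton_self g)).2 i
        congr 1
        funext a
        by_cases ha : a = g
        · rw [ha, h2]
        · have e1 : (aut.f p).2.1 i a = none := by
            by_contra hc
            exact ha ((aut.f p).2.2 i _ _ hc hg)
          have e2 : (aut.f p').2.1 i a = none := by
            by_contra hc
            exact ha ((aut.f p').2.2 i _ _ hc (by rwa [← h2]))
          rw [e1, e2])
    refine ⟨insert 1 D, fun p p' h hp => ?_⟩
    have := hD p p' (h.mono (Finset.subset_insert _ _))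
    have h1 : p'.2.1 i 1 ≠ none := by rwa [← (h 1 (Finset.mem_insert_self 1 _)).2 i]
    rw [if_neg h1, if_neg hp] at this
    exact Option.some.inj this
  choose D hD using h1
  obtain ⟨DI, hI⟩ := clopen_det aut.clopen_Ini
  obtain ⟨DF, hF⟩ := clopen_det aut.clopen_Fini
  refine ⟨insert 1 (Finset.univ.biUnion D ∪ (DI ∪ DF)), Finset.mem_insert_self _ _, ?_, ?_, ?_⟩
  · intro i p p' h hp
    refine hD i p p' (h.mono ?_) hp
    intro g hg
    exact Finset.mem_insert_of_mem (Finset.mem_union_left _ (Finset.mem_biUnion.2 ⟨i, Finset.mem_univ _, hg⟩))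
  · intro y y' h hy
    refine hI y y' (fun g hg => h g ?_) hy
    exact Finset.mem_insert_of_mem (Finset.mem_union_right _ (Finset.mem_union_left _ hg))
  · intro y y' h hy
    refine hF y y' (fun g hg => h g ?_) hy
    exact Finset.mem_insert_of_mem (Finset.mem_union_right _ (Finset.mem_union_right _ hg))

/-- decoding of states -/
def decS {M : ℕ} (n : ℕ) (x : Option (Fin M)) : Option (Fin n) :=
  x.bind fun m => if h : m.1 < n then some ⟨m.1, h⟩ else none

theorem decS_castLE {M n : ℕ} (h : n ≤ M) (a : Fin n) : decS n (some (Fin.castLE h a)) = some a := by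
  simp [decS]

variable (aut : GWA G 3 3) (π : PG →* G)

open Classical in
/-- the head configuration -/
noncomputable def YC {M : ℕ} (c : Fin 3 → PG × Option (Fin M)) : YS G 3 aut.q :=
  ⟨fun i g => if g = π (c i).1 then decS (aut.q i) (c i).2 else none, fun i a b ha hb => by
    have h1 : a = π (c i).1 := by
      by_contra h
      exact ha (if_neg h)
    have h2 : b = π (c i).1 := by
      by_contra h
      exact hb (if_neg h)
    rw [h1, h2]⟩

/-- consistency of a configuration with what is seen -/
def cons {M w : ℕ} (W : Fin w → PG) (i : Fin 3) (st : Option (Fin M))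
    (v : (Fin w → Fin 3) × (Fin 3 → Fin w → Option (Fin M))) (p : (G → Fin 3) × YS G 3 aut.q) : Prop :=
  p.2.1 i 1 = decS (aut.q i) st ∧ decS (aut.q i) st ≠ none ∧
  ∀ b, p.1 (π (W b)) = v.1 b ∧ ∀ j, p.2.1 j (π (W b)) = decS (aut.q j) (v.2 j b)

theorem extract (hπ : Function.Surjective π) (hG : Infinite G) (N : Subgroup PG) (hker : ∀ x, π x = 1 ↔ x ∈ N)
    (x : ℕ → G → Fin 3) (hx : ∀ d g, x d (π g) = env d g) :
    ∃ (K : Mach) (I Fi : K.Obs → Prop), ∀ d, x d ∉ autSet aut ↔ K.Rej I Fi N d := by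
  classical
  obtain ⟨D, h1D, hD, hDI, hDF⟩ := window aut
  let E : Finset G := D ∪ (D.product D).image fun p => p.1⁻¹ * p.2
  let W : Fin E.card → PG := fun b => (hπ (E.equivFin.symm b).1).choose
  have hW : ∀ b, π (W b) = (E.equivFin.symm b).1 := fun b => (hπ (E.equivFin.symm b).1).choose_spec
  have hWE : ∀ g ∈ E, ∃ b, π (W b) = g := fun g hg => ⟨E.equivFin ⟨g, hg⟩, by rw [hW]; simp⟩
  let M : ℕ := Finset.univ.sup aut.q
  have hM : ∀ i, aut.q i ≤ M := fun i => Finset.le_sup (f := aut.q) (Finset.mem_univ i)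
  let F : Fin 3 → Option (Fin M) → (Fin E.card → Fin 3) × (Fin 3 → Fin E.card → Option (Fin M)) →
      PG × Option (Fin M) := fun i st v =>
    if h : ∃ r : ((G → Fin 3) × YS G 3 aut.q) × PG × Fin (aut.q i),
      cons aut π W i st v r.1 ∧ (aut.f r.1).2.1 i (π r.2.1) = some r.2.2 then
      (h.choose.2.1, some (Fin.castLE (hM i) h.choose.2.2)) else (1, none)
  let K : Mach := ⟨M, E.card, W, F⟩
  -- views
  have hview : ∀ (d : ℕ) (c : K.Cfg) (i j : Fin 3) (b : Fin E.card),
      (YC aut π c).1 j (π (c i).1 * π (W b)) = decS (aut.q j) ((K.view N (fun _ => 0) d c i).2 j b) := by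
    intro d c i j b
    have e : K.see N (fun _ => 0) c i j b ↔ π (c i).1 * π (W b) = π (c j).1 := by
      simp only [Mach.see, true_and]
      rw [← hker]
      simp only [map_mul, map_inv]
      constructor
      · intro h
        have : π (c j).1 = π (c i).1 * (π (W b) * ((π (W b))⁻¹ * ((π (c i).1)⁻¹ * π (c j).1))) := by group
        rw [this]
        erw [h]; simp
      · intro h
        rw [← h]
        show (π (W b))⁻¹ * _ = 1
        group
    by_cases hs : K.see N (fun _ => 0) c i j b
    · simp only [YC, Mach.view, if_pos hs, if_pos (e.1 hs)]
    · simp only [YC, Mach.view, if_neg hs, if_neg (fun h => hs (e.2 h))]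
      rfl
  have hcons : ∀ (d : ℕ) (c : K.Cfg) (i : Fin 3), decS (aut.q i) (c i).2 ≠ none →
      cons aut π W i (c i).2 (K.view N (fun _ => 0) d c i)
        (shiftC (π (c i).1)⁻¹ (x d), yshift (π (c i).1)⁻¹ (YC aut π c)) := by
    intro d c i hi
    refine ⟨?_, hi, fun b => ⟨?_, fun j => ?_⟩⟩
    · simp [yshift, shiftC, YC]
    · show x d _ = env d _
      rw [← hx]; simp; rfl
    · rw [← hview d c i j b]
      simp [yshift, shiftC]
  have hcons2 : ∀ i st v p p', cons aut π W (M := M) i st v p → cons aut π W i st v p' →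
      (aut.f p').2.1 i = (aut.f p).2.1 i := by
    intro i st v p p' h h'
    refine hD i p p' ?_ (by rw [h.1]; exact h.2.1)
    intro g hg
    obtain ⟨b, hb⟩ := hWE g (Finset.mem_union_left _ hg)
    rw [← hb]
    exact ⟨by rw [(h.2.2 b).1, (h'.2.2 b).1], fun j => by rw [(h.2.2 b).2, (h'.2.2 b).2]⟩
  have hstep : ∀ (d : ℕ) (c : K.Cfg), YC aut π (K.step N (fun _ => 0) d c) = (aut.f (x d, YC aut π c)).2 := by
    intro d c
    refine Subtype.ext ?_
    funext i
    by_cases hi : decS (aut.q i) (c i).2 = none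
    · have e1 : (YC aut π c).1 i = fun _ => none := by
        funext g
        simp [YC, hi]
      have e2 := (aut.vanish (x d, YC aut π c) i).2 e1
      rw [e2]
      funext g
      have : F i (c i).2 (K.view N (fun _ => 0) d c i) = (1, none) := dif_neg (by
        rintro ⟨r, hr, _⟩; exact hr.2.1 hi)
      have h2 : K.step N (fun _ => 0) d c i = ((c i).1 * 1, none) := by
        show ((c i).1 * (F i (c i).2 (K.view N (fun _ => 0) d c i)).1, (F i (c i).2 (K.view N (fun _ => 0) d c i)).2) = _
        rw [this]
      simp [YC, h2, decS]
    · set p : (G → Fin 3) × YS G 3 aut.q := (shiftC (π (c i).1)⁻¹ (x d), yshift (π (c i).1)⁻¹ (YC aut π c)) with hp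
      have hpc := hcons d c i hi
      have hv : ¬ ((aut.f p).2.1 i = fun _ => none) := by
        rw [aut.vanish]
        intro h
        have := congrFun h 1
        rw [hpc.1] at this
        exact hi this
      obtain ⟨g, hg⟩ := Function.ne_iff.1 hv
      obtain ⟨a, ha⟩ := Option.ne_none_iff_exists'.1 hg
      obtain ⟨g', rfl⟩ := hπ g
      have hex : ∃ r : ((G → Fin 3) × YS G 3 aut.q) × PG × Fin (aut.q i),
        cons aut π W i (c i).2 (K.view N (fun _ => 0) d c i) r.1 ∧ (aut.f r.1).2.1 i (π r.2.1) = some r.2.2 :=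
        ⟨(p, g', a), hpc, ha⟩
      obtain ⟨r, hr, hF⟩ : ∃ r : ((G → Fin 3) × YS G 3 aut.q) × PG × Fin (aut.q i),
        (cons aut π W i (c i).2 (K.view N (fun _ => 0) d c i) r.1 ∧ (aut.f r.1).2.1 i (π r.2.1) = some r.2.2) ∧
        F i (c i).2 (K.view N (fun _ => 0) d c i) = (r.2.1, some (Fin.castLE (hM i) r.2.2)) :=
        ⟨hex.choose, hex.choose_spec, dif_pos hex⟩
      have h2 : K.step N (fun _ => 0) d c i = ((c i).1 * r.2.1, some (Fin.castLE (hM i) r.2.2)) := by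
        show ((c i).1 * (F i (c i).2 (K.view N (fun _ => 0) d c i)).1, (F i (c i).2 (K.view N (fun _ => 0) d c i)).2) = _
        rw [hF]
      have h3 : (aut.f p).2.1 i (π r.2.1) = some r.2.2 := by
        rw [← hcons2 i _ _ _ _ hpc hr.1]; exact hr.2
      have h4 : (aut.f (x d, YC aut π c)).2 = yshift (π (c i).1) (aut.f p).2 := by
        have := aut.equivar (π (c i).1) p
        have e : (shiftC (π (c i).1) p.1, yshift (π (c i).1) p.2) = (x d, YC aut π c) := by
          rw [hp]; simp only [yshift_mul, shiftC_mul, mul_inv_cancel, yshift_one]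
          congr 1
          funext g; simp [shiftC]
        rw [e] at this
        rw [this]
      rw [h4]
      funext g
      show (if g = π (K.step N (fun _ => 0) d c i).1 then decS (aut.q i) (K.step N (fun _ => 0) d c i).2 else none) =
        (aut.f p).2.1 i ((π (c i).1)⁻¹ * g)
      rw [h2]
      simp only [map_mul]
      by_cases hgg : g = π (c i).1 * π r.2.1
      · rw [if_pos hgg, decS_castLE, hgg, inv_mul_cancel_left, h3]
      · rw [if_neg hgg]
        by_contra hc
        have := (aut.f p).2.2 i _ _ (Ne.symm hc) (by rw [h3]; simp : (aut.f p).2.1 i (π r.2.1) ≠ none)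
        exact hgg (by rw [← this]; simp)
  have hrun : ∀ (d : ℕ) (c : K.Cfg) (n : ℕ), YC aut π (K.run N (fun _ => 0) d c n) =
      (aut.f^[n] (x d, YC aut π c)).2 := by
    intro d c n
    induction n with
    | zero => rfl
    | succ n ih =>
      rw [Mach.run_succ, hstep, ih, Function.iterate_succ_apply']
      congr 1
      rw [← (iter_equivar aut 1 n (x d) (YC aut π c)).2]
      rw [(iter_equivar aut 1 n (x d) (YC aut π c)).2]
      congr 1
      exact Prod.ext (iter_equivar aut 1 n (x d) (YC aut π c)).2.symm rfl
  have hsurj : ∀ y : YS G 3 aut.q, ∃ c : K.Cfg, YC aut π c = y := by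
    intro y
    have : ∀ i, ∃ ci : PG × Option (Fin M), ∀ g, y.1 i g = if g = π ci.1 then decS (aut.q i) ci.2 else none := by
      intro i
      by_cases hy : ∃ g, y.1 i g ≠ none
      · obtain ⟨g, hg⟩ := hy
        obtain ⟨a, ha⟩ := Option.ne_none_iff_exists'.1 hg
        obtain ⟨g', rfl⟩ := hπ g
        refine ⟨(g', some (Fin.castLE (hM i) a)), fun h => ?_⟩
        by_cases hh : h = π g'
        · rw [if_pos hh, decS_castLE, hh, ha]
        · rw [if_neg hh]
          by_contra hc
          exact hh (y.2 i _ _ hc hg)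
      · push Not at hy
        exact ⟨(1, none), fun g => by simp [hy, decS]⟩
    choose c hc using this
    refine ⟨c, Subtype.ext ?_⟩
    funext i g
    exact (hc i g).symm
  have hobs : ∀ (S : Set (YS G 3 aut.q)), (∀ y y' : YS G 3 aut.q, (∀ g ∈ D, ∀ i, y.1 i g = y'.1 i g) → y ∈ S → y' ∈ S) →
      ∀ (d d' : ℕ) (c c' : K.Cfg), K.obs N (fun _ => 0) d c = K.obs N (fun _ => 0) d' c' →
      (∃ β, yshift β (YC aut π c) ∈ S) → ∃ β, yshift β (YC aut π c') ∈ S := by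
    rintro S hS d d' c c' ho ⟨β, hβ⟩
    by_cases hl : ∃ i, decS (aut.q i) (c i).2 ≠ none ∧ β * π (c i).1 ∈ D
    · obtain ⟨i, hi, hiD⟩ := hl
      refine ⟨β * π (c i).1 * (π (c' i).1)⁻¹, hS _ _ ?_ hβ⟩
      intro g hg j
      obtain ⟨b, hb⟩ := hWE ((β * π (c i).1)⁻¹ * g) (Finset.mem_union_right _ (Finset.mem_image.2
        ⟨(_, g), Finset.mem_product.2 ⟨hiD, hg⟩, rfl⟩))
      show (YC aut π c).1 j (β⁻¹ * g) = (YC aut π c').1 j ((β * π (c i).1 * (π (c' i).1)⁻¹)⁻¹ * g)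
      have e1 : β⁻¹ * g = π (c i).1 * π (W b) := by rw [hb]; group
      have e2 : (β * π (c i).1 * (π (c' i).1)⁻¹)⁻¹ * g = π (c' i).1 * π (W b) := by rw [hb]; group
      rw [e1, e2, hview d, hview d']
      have e3 : K.view N (fun _ => 0) d c i = K.view N (fun _ => 0) d' c' i := congrArg Prod.snd (congrFun ho i)
      rw [e3]
    · push Not at hl
      have hfin : (⋃ j : Fin 3, (fun a => a * (π (c' j).1)⁻¹) '' (D : Set G)).Finite :=
        Set.finite_iUnion fun j => D.finite_toSet.image _
      obtain ⟨β', hβ'⟩ := hfin.exists_notMem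
      refine ⟨β', hS _ _ ?_ hβ⟩
      intro g hg j
      show (if β⁻¹ * g = π (c j).1 then decS (aut.q j) (c j).2 else none) =
        (if β'⁻¹ * g = π (c' j).1 then decS (aut.q j) (c' j).2 else none)
      have e2 : ¬ (β'⁻¹ * g = π (c' j).1) := by
        intro h
        apply hβ'
        refine Set.mem_iUnion.2 ⟨j, g, hg, ?_⟩
        simp only [← h]; group
      rw [if_neg e2]
      by_cases e1 : β⁻¹ * g = π (c j).1
      · rw [if_pos e1]
        by_contra hc
        exact hl j hc (by rw [← e1]; simpa using hg)
      · rw [if_neg e1]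
  refine ⟨K, fun o => ∃ d c, K.obs N (fun _ => 0) d c = o ∧ ∃ β, yshift β (YC aut π c) ∈ aut.Ini,
    fun o => ∃ d c, K.obs N (fun _ => 0) d c = o ∧ ∃ β, yshift β (YC aut π c) ∈ aut.Fini, fun d => ?_⟩
  rw [notMem_autSet]
  constructor
  · rintro ⟨y, n, hI, hF⟩
    obtain ⟨c, rfl⟩ := hsurj y
    refine ⟨c, n, ⟨d, c, rfl, hI⟩, ⟨d, _, rfl, ?_⟩⟩
    rwa [hrun]
  · rintro ⟨c, n, ⟨d1, c1, ho, hI⟩, ⟨d2, c2, ho', hF⟩⟩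
    refine ⟨YC aut π c, n, hobs _ hDI _ _ _ _ ho hI, ?_⟩
    rw [← hrun]
    exact hobs _ hDF _ _ _ _ ho' hF

end Extract

end FH


namespace FH

section Make
variable {G : Type*} [Group G] {s k Q : ℕ}

open Classical in
/-- head configurations from positions -/
noncomputable def mkY (c : Fin k → Option (G × Fin Q)) : YS G k (fun _ => Q) :=
  ⟨fun i g => (c i).bind fun r => if g = r.1 then some r.2 else none, fun i a b ha hb => by
    rcases hc : c i with _ | r
    · simp [hc] at ha
    · simp only [hc, Option.bind_some, ne_eq] at ha hb
      have h1 : a = r.1 := by by_contra h; exact ha (if_neg h)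
      have h2 : b = r.1 := by by_contra h; exact hb (if_neg h)
      rw [h1, h2]⟩

theorem mkY_eq_some {c : Fin k → Option (G × Fin Q)} {i : Fin k} {g : G} {a : Fin Q} :
    (mkY c).1 i g = some a ↔ c i = some (g, a) := by
  rcases hc : c i with _ | ⟨r, b⟩
  · simp [mkY, hc]
  · by_cases h : g = r
    · simp [mkY, hc, h]
    · simp [mkY, hc, h, Ne.symm h]

open Classical in
/-- positions from head configurations -/
noncomputable def rdY (y : YS G k (fun _ => Q)) : Fin k → Option (G × Fin Q) := fun i =>
  if h : ∃ r : G × Fin Q, y.1 i r.1 = some r.2 then some h.choose else none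

theorem rdY_eq_some {y : YS G k (fun _ => Q)} {i : Fin k} {g : G} {a : Fin Q} :
    rdY y i = some (g, a) ↔ y.1 i g = some a := by
  classical
  unfold rdY
  by_cases h : ∃ r : G × Fin Q, y.1 i r.1 = some r.2
  · rw [dif_pos h]
    constructor
    · intro h1
      have := h.choose_spec
      rw [Option.some.inj h1] at this
      exact this
    · intro h1
      have h2 := h.choose_spec
      have h3 : h.choose.1 = g := y.2 i _ _ (by rw [h2]; simp) (by rw [h1]; simp)
      rw [h3, h1] at h2
      congr 1
      exact Prod.ext h3 (Option.some.inj h2).symm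
  · rw [dif_neg h]
    constructor
    · intro h1; simp at h1
    · intro h1; exact absurd ⟨(g, a), h1⟩ h

theorem ys_ext {y y' : YS G k (fun _ => Q)} (h : ∀ i g a, y.1 i g = some a ↔ y'.1 i g = some a) : y = y' := by
  refine Subtype.ext ?_
  funext i g
  exact Option.ext (h i g)

theorem mkY_rdY (y : YS G k (fun _ => Q)) : mkY (rdY y) = y :=
  ys_ext fun i g a => by rw [mkY_eq_some, rdY_eq_some]

theorem rdY_mkY (c : Fin k → Option (G × Fin Q)) : rdY (mkY c) = c := by
  funext i
  refine Option.ext ?_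
  rintro ⟨g, a⟩
  rw [rdY_eq_some, mkY_eq_some]

/-- the type of rules -/
abbrev Rule (G : Type*) (s k Q : ℕ) := Fin k → Fin Q → Fin s → (Fin k → Option (Fin Q)) → G × Fin Q

/-- one step -/
noncomputable def stepO (rule : Rule G s k Q) (x : G → Fin s) (y : YS G k (fun _ => Q)) (i : Fin k) (r : G × Fin Q) : G × Fin Q :=
  (r.1 * (rule i r.2 (x r.1) fun j => y.1 j r.1).1, (rule i r.2 (x r.1) fun j => y.1 j r.1).2)

/-- one step -/
noncomputable def stepY (rule : Rule G s k Q) (x : G → Fin s) (y : YS G k (fun _ => Q)) : YS G k (fun _ => Q) :=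
  mkY fun i => (rdY y i).map (stepO rule x y i)

theorem stepY_eq_some {rule : Rule G s k Q} {x : G → Fin s} {y : YS G k (fun _ => Q)} {i : Fin k} {g : G} {a : Fin Q} :
    (stepY rule x y).1 i g = some a ↔ ∃ r : G × Fin Q, y.1 i r.1 = some r.2 ∧ stepO rule x y i r = (g, a) := by
  rw [stepY, mkY_eq_some, Option.map_eq_some_iff]
  constructor
  · rintro ⟨r, h1, h2⟩
    exact ⟨r, rdY_eq_some.1 h1, h2⟩
  · rintro ⟨r, h1, h2⟩
    exact ⟨r, rdY_eq_some.2 h1, h2⟩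

theorem opt_none_iff {α : Type*} {o o' : Option α} (h : ∀ a, o = some a ↔ o' = some a) : o = o' := Option.ext h

/-- automata from local rules -/
noncomputable def mkGWA (rule : Rule G s k Q) (Ini Fini : Set (YS G k (fun _ => Q)))
    (hI : @IsClopen _ (ysTop G k (fun _ => Q)) Ini) (hF : @IsClopen _ (ysTop G k (fun _ => Q)) Fini) : GWA G s k where
  q := fun _ => Q
  f p := (p.1, stepY rule p.1 p.2)
  cont := by
    classical
    refine continuous_of_cyl _ (fun p => rfl) ?_
    intro i g p
    by_cases hp : ∃ r : G × Fin Q, p.2.1 i r.1 = some r.2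
    · obtain ⟨r, hr⟩ := hp
      refine ⟨{r.1}, fun p' hp' => ?_⟩
      have h1 := hp' r.1 (Finset.mem_singleton_self _)
      have e : stepO rule p'.1 p'.2 i r = stepO rule p.1 p.2 i r := by
        simp only [stepO, h1.1, h1.2]
      have key : ∀ p'' : (G → Fin s) × YS G k (fun _ => Q), p''.2.1 i r.1 = some r.2 → ∀ a,
          (stepY rule p''.1 p''.2).1 i g = some a ↔ stepO rule p''.1 p''.2 i r = (g, a) := by
        intro p'' h'' a
        rw [stepY_eq_some]
        constructor
        · rintro ⟨r', h2, h3⟩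
          have h4 : r'.1 = r.1 := p''.2.2 i _ _ (by rw [h2]; simp) (by rw [h'']; simp)
          have h5 : r' = r := by
            refine Prod.ext h4 ?_
            rw [h4, h''] at h2
            exact (Option.some.inj h2).symm
          rw [← h5, h3]
        · intro h; exact ⟨r, h'', h⟩
      refine opt_none_iff fun a => ?_
      show (stepY rule p'.1 p'.2).1 i g = some a ↔ (stepY rule p.1 p.2).1 i g = some a
      rw [key p hr, key p' (by rw [← h1.2 i, hr]), e]
    · push Not at hp
      let Mv : Finset G := Finset.univ.image fun u : Fin Q × Fin s × (Fin k → Option (Fin Q)) =>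
        g * (rule i u.1 u.2.1 u.2.2).1⁻¹
      refine ⟨Mv, fun p' hp' => ?_⟩
      refine opt_none_iff fun a => ?_
      show (stepY rule p'.1 p'.2).1 i g = some a ↔ (stepY rule p.1 p.2).1 i g = some a
      rw [stepY_eq_some, stepY_eq_some]
      constructor
      · rintro ⟨r, h1, h2⟩
        exfalso
        refine hp r ?_
        rw [(hp' r.1 ?_).2 i, h1]
        refine Finset.mem_image.2 ⟨(r.2, p'.1 r.1, fun j => p'.2.1 j r.1), Finset.mem_univ _, ?_⟩
        have := (Prod.ext_iff.1 h2).1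
        simp only [stepO] at this
        rw [← this]; simp
      · rintro ⟨r, h1, h2⟩
        exact absurd h1 (hp r)
  fst_eq p := rfl
  equivar g p := by
    refine Prod.ext rfl ?_
    refine ys_ext fun i h a => ?_
    show (stepY rule (shiftC g p.1) (yshift g p.2)).1 i h = some a ↔ (stepY rule p.1 p.2).1 i (g⁻¹ * h) = some a
    rw [stepY_eq_some, stepY_eq_some]
    constructor
    · rintro ⟨r, h1, h2⟩
      refine ⟨(g⁻¹ * r.1, r.2), h1, ?_⟩
      simp only [stepO, yshift, shiftC, Prod.mk.injEq] at h2 ⊢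
      rw [← h2.1]
      exact ⟨by group, h2.2⟩
    · rintro ⟨r, h1, h2⟩
      refine ⟨(g * r.1, r.2), by simpa [yshift, shiftC] using h1, ?_⟩
      simp only [stepO, yshift, shiftC, Prod.mk.injEq, inv_mul_cancel_left] at h2 ⊢
      exact ⟨by rw [mul_assoc, h2.1]; group, h2.2⟩
  vanish p i := by
    constructor
    · intro h
      funext g
      by_contra hc
      obtain ⟨a, ha⟩ := Option.ne_none_iff_exists'.1 hc
      have := stepY_eq_some (rule := rule) (x := p.1).2 ⟨(g, a), ha, rfl⟩
      have h2 := congrFun h (stepO rule p.1 p.2 i (g, a)).1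
      have h3 := this.symm.trans h2
      cases h3
    · intro h
      funext g
      by_contra hc
      obtain ⟨a, ha⟩ := Option.ne_none_iff_exists'.1 hc
      obtain ⟨r, h1, h2⟩ := stepY_eq_some.1 ha
      rw [h] at h1
      cases h1
  Ini := Ini
  Fini := Fini
  clopen_Ini := hI
  clopen_Fini := hF

/-- total configurations -/
noncomputable def totY (c : Fin k → G × Fin Q) : YS G k (fun _ => Q) := mkY fun i => some (c i)

theorem totY_eq_some {c : Fin k → G × Fin Q} {i : Fin k} {g : G} {a : Fin Q} :
    (totY c).1 i g = some a ↔ c i = (g, a) := by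
  rw [totY, mkY_eq_some]; simp

theorem stepY_totY (rule : Rule G s k Q) (x : G → Fin s) (c : Fin k → G × Fin Q) :
    stepY rule x (totY c) = totY fun i => stepO rule x (totY c) i (c i) := by
  refine ys_ext fun i g a => ?_
  rw [stepY_eq_some, totY_eq_some]
  constructor
  · rintro ⟨r, h1, h2⟩
    rw [totY_eq_some] at h1
    rw [h1]; exact h2
  · intro h
    exact ⟨c i, totY_eq_some.2 rfl, h⟩

end Make

section MakeSt
variable {G : Type*} [Group G] {s k : ℕ} {St : Type} [Finite St]

open Classical in
/-- one step of a machine with arbitrary state set -/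
noncomputable def stepL (rule : Fin k → St → Fin s → (Fin k → Option St) → G × St) (x : G → Fin s)
    (c : Fin k → G × St) (i : Fin k) : G × St :=
  ((c i).1 * (rule i (c i).2 (x (c i).1) fun j => if (c j).1 = (c i).1 then some (c j).2 else none).1,
    (rule i (c i).2 (x (c i).1) fun j => if (c j).1 = (c i).1 then some (c j).2 else none).2)

theorem exists_aut (rule : Fin k → St → Fin s → (Fin k → Option St) → G × St) (ini fin : St) (i0 : Fin k) :
    ∃ aut : GWA G s k, ∀ x, x ∉ autSet aut ↔
      ∃ g n, ((stepL rule x)^[n] (fun _ => (g, ini)) i0).2 = fin := by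
  classical
  obtain ⟨Q, ⟨e⟩⟩ := Finite.exists_equiv_fin St
  let rule' : Rule G s k Q := fun i st sy v =>
    let r := rule i (e.symm st) sy (fun j => (v j).map e.symm)
    (r.1, e r.2)
  let aut : GWA G s k := mkGWA rule' {y | ∀ i, y.1 i 1 = some (e ini)} {y | y.1 i0 1 = some (e fin)}
    (clopen_of_det {1} (fun y y' h hy i => by rw [← h 1 (Finset.mem_singleton_self 1) i]; exact hy i))
    (clopen_of_det {1} (fun y y' h hy => by
      show y'.1 i0 1 = some (e fin)
      rw [← h 1 (Finset.mem_singleton_self 1) i0]; exact hy))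
  let E : (Fin k → G × St) → YS G k (fun _ => Q) := fun c => totY fun i => ((c i).1, e (c i).2)
  have hstep : ∀ x c, stepY rule' x (E c) = E (stepL rule x c) := by
    intro x c
    have hv : ∀ j g, (((E c).1 j g).map e.symm) = if (c j).1 = g then some (c j).2 else none := by
      intro j g
      by_cases h : (c j).1 = g
      · rw [if_pos h]
        have : (E c).1 j g = some (e (c j).2) := totY_eq_some.2 (by rw [h])
        rw [this]; simp
      · rw [if_neg h]
        have : (E c).1 j g = none := by
          by_contra hc
          obtain ⟨a, ha⟩ := Option.ne_none_iff_exists'.1 hc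
          exact h (congrArg Prod.fst (totY_eq_some.1 ha))
        rw [this]; rfl
    show stepY rule' x (totY _) = totY _
    rw [stepY_totY]
    congr 1
    funext i
    have hv' : (fun j => (((E c).1 j (c i).1).map e.symm)) = fun j => if (c j).1 = (c i).1 then some (c j).2 else none := by
      funext j; exact hv j _
    show ((c i).1 * (rule i (e.symm (e (c i).2)) (x (c i).1) (fun j => (((E c).1 j (c i).1).map e.symm))).1,
      e (rule i (e.symm (e (c i).2)) (x (c i).1) (fun j => (((E c).1 j (c i).1).map e.symm))).2) = _
    rw [hv', Equiv.symm_apply_apply]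
    rfl
  have hiter : ∀ n x c, aut.f^[n] (x, E c) = (x, E ((stepL rule x)^[n] c)) := by
    intro n x c
    induction n with
    | zero => rfl
    | succ n ih =>
      rw [Function.iterate_succ_apply', Function.iterate_succ_apply', ih, ← hstep]
      rfl
  have hfin : ∀ c, (∃ β, yshift β (E c) ∈ aut.Fini) ↔ (c i0).2 = fin := by
    intro c
    constructor
    · rintro ⟨β, h⟩
      have h1 : (E c).1 i0 (β⁻¹ * 1) = some (e fin) := h
      exact e.injective (congrArg Prod.snd (totY_eq_some.1 h1))
    · intro h
      refine ⟨(c i0).1⁻¹, ?_⟩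
      show (E c).1 i0 (((c i0).1⁻¹)⁻¹ * 1) = some (e fin)
      refine totY_eq_some.2 ?_
      rw [inv_inv, mul_one, h]
  have hini : ∀ y : YS G k (fun _ => Q), (∃ β : G, ∀ i, y.1 i (β⁻¹ * 1) = some (e ini)) ↔ ∃ g : G, y = E (fun _ => (g, ini)) := by
    intro y
    constructor
    · rintro ⟨β, h⟩
      refine ⟨β⁻¹, ys_ext fun i g a => ?_⟩
      have h1 : y.1 i (β⁻¹ * 1) = some (e ini) := h i
      rw [mul_one] at h1
      have h0 : (E (fun _ => (β⁻¹, ini))).1 i g = some a ↔ (β⁻¹, e ini) = (g, a) := totY_eq_some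
      rw [h0]
      constructor
      · intro h2
        have h3 : g = β⁻¹ := y.2 i _ _ (by rw [h2]; simp) (by rw [h1]; simp)
        rw [h3, h1] at h2
        exact Prod.ext h3.symm (Option.some.inj h2)
      · intro h2
        have h3 : β⁻¹ = g := congrArg Prod.fst h2
        have h4 : e ini = a := congrArg Prod.snd h2
        subst h3
        exact h1.trans (congrArg some h4)
    · rintro ⟨g, rfl⟩
      refine ⟨g⁻¹, fun i => ?_⟩
      refine totY_eq_some.2 ?_
      simp
  refine ⟨aut, fun x => ?_⟩
  rw [notMem_autSet]
  constructor
  · rintro ⟨y, n, hI, hF⟩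
    obtain ⟨g, rfl⟩ := (hini y).1 hI
    refine ⟨g, n, (hfin _).1 ?_⟩
    rw [hiter] at hF
    exact hF
  · rintro ⟨g, n, h⟩
    refine ⟨E (fun _ => (g, ini)), n, (hini _).2 ⟨g, rfl⟩, ?_⟩
    rw [hiter]
    exact (hfin _).2 h

end MakeSt

end FH


namespace FH

/-- the states of the four-headed machine -/
inductive St4
  | start0 | wait | out | back | stay | run (p : ZMod 11) | R (p : ZMod 11) (s : Fin 6) | L (p : ZMod 11) | dead | rej

/-- numbering of the states -/
def St4.num : St4 → Fin 10 × ZMod 11 × Fin 6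
  | .start0 => (0, 0, 0) | .wait => (1, 0, 0) | .out => (2, 0, 0) | .back => (3, 0, 0) | .stay => (4, 0, 0)
  | .run p => (5, p, 0) | .R p s => (6, p, s) | .L p => (7, p, 0) | .dead => (8, 0, 0) | .rej => (9, 0, 0)

instance : Finite St4 := Finite.of_injective St4.num (by
  intro a b h
  cases a <;> cases b <;> simp_all [St4.num])

section Machine
variable {G : Type*} [Group G]

/-- the digit encoded in a phase -/
def dig (p : ZMod 11) : Fin 6 := Fin.ofNat 6 (p.val / 2)

open Classical in
/-- first head -/
noncomputable def ruleA (t : G) (lam : Fin 6 → G) (st : St4) (sy : Fin 3) (v : Fin 4 → Option St4) : G × St4 :=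
  match st with
  | .start0 => (1, if sy = 1 then .wait else .dead)
  | .wait => if v 1 = some .back then (1, .run 0) else (1, .wait)
  | .run p => if ∃ p', v 1 = some (.L p') then (if dig p = 5 then (1, .dead) else (lam (dig p), .run 0))
      else (if p.val % 2 = 1 then t else 1, .run (p + 1))
  | s => (1, s)

open Classical in
/-- second head -/
noncomputable def ruleB (t : G) (lam : Fin 6 → G) (st : St4) (sy : Fin 3) (v : Fin 4 → Option St4) : G × St4 :=
  match st with
  | .start0 => (1, if sy = 1 then .out else .dead)
  | .out => if sy = 2 then (1, .back) else (t, .out)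
  | .back => if v 0 = some .wait then (1, .R 0 0) else (t⁻¹, .back)
  | .R p s => if v 2 = none then (if p.val % 2 = 0 then t else 1, .R (p + 1) s)
      else (if s = 5 then (1, .dead) else (lam s * (if p.val % 2 = 0 then t⁻¹ else 1), .L (p + 1)))
  | .L p => if v 0 = none then (if p.val % 2 = 0 then t⁻¹ else 1, .L (p + 1)) else (1, .R 0 (dig p))
  | s => (1, s)

open Classical in
/-- third head -/
noncomputable def ruleC (t : G) (lam : Fin 6 → G) (st : St4) (sy : Fin 3) (v : Fin 4 → Option St4) : G × St4 :=
  match st with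
  | .start0 => (1, if sy = 1 then .out else .dead)
  | .out => if sy = 2 then (1, .stay) else (t, .out)
  | .stay => match v 1 with
    | some (.R _ s) => if s = 5 then (1, if v 3 = none then .rej else .stay) else (lam s, .stay)
    | _ => (1, .stay)
  | s => (1, s)

open Classical in
/-- fourth head -/
noncomputable def ruleD (t : G) (st : St4) (sy : Fin 3) : G × St4 :=
  match st with
  | .start0 => (1, if sy = 1 then .out else .dead)
  | .out => if sy = 2 then (1, .stay) else (t, .out)
  | s => (1, s)

/-- the four-headed machine -/
noncomputable def rule4 (t : G) (lam : Fin 6 → G) (i : Fin 4) (st : St4) (sy : Fin 3) (v : Fin 4 → Option St4) : G × St4 :=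
  match i with
  | 0 => ruleA t lam st sy v
  | 1 => ruleB t lam st sy v
  | 2 => ruleC t lam st sy v
  | 3 => ruleD t st sy

open Classical in
/-- what is seen at a position -/
noncomputable def seeF (c : Fin 4 → G × St4) (p : G) (j : Fin 4) : Option St4 :=
  if (c j).1 = p then some (c j).2 else none

theorem seeF_eq {c : Fin 4 → G × St4} {p q : G} {j : Fin 4} {s : St4} (h : c j = (q, s)) (e : q = p) : seeF c p j = some s := by
  simp [seeF, h, e]

theorem seeF_ne {c : Fin 4 → G × St4} {p q : G} {j : Fin 4} {s : St4} (h : c j = (q, s)) (e : q ≠ p) : seeF c p j = none := by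
  simp [seeF, h, e]

theorem seeF_or {c : Fin 4 → G × St4} {p q : G} {j : Fin 4} {s : St4} (h : c j = (q, s)) : seeF c p j = none ∨ seeF c p j = some s := by
  by_cases e : q = p
  · exact Or.inr (seeF_eq h e)
  · exact Or.inl (seeF_ne h e)

variable {t : G} {lam : Fin 6 → G} {x : G → Fin 3} {c : Fin 4 → G × St4}

theorem stepL_see (i : Fin 4) : stepL (rule4 t lam) x c i =
    ((c i).1 * (rule4 t lam i (c i).2 (x (c i).1) (seeF c (c i).1)).1,
      (rule4 t lam i (c i).2 (x (c i).1) (seeF c (c i).1)).2) := rfl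

theorem step0 {p : G} {st : St4} (h : c 0 = (p, st)) : stepL (rule4 t lam) x c 0 =
    (p * (ruleA t lam st (x p) (seeF c p)).1, (ruleA t lam st (x p) (seeF c p)).2) := by
  rw [stepL_see, h]; rfl

theorem step1 {p : G} {st : St4} (h : c 1 = (p, st)) : stepL (rule4 t lam) x c 1 =
    (p * (ruleB t lam st (x p) (seeF c p)).1, (ruleB t lam st (x p) (seeF c p)).2) := by
  rw [stepL_see, h]; rfl

theorem step2 {p : G} {st : St4} (h : c 2 = (p, st)) : stepL (rule4 t lam) x c 2 =
    (p * (ruleC t lam st (x p) (seeF c p)).1, (ruleC t lam st (x p) (seeF c p)).2) := by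
  rw [stepL_see, h]; rfl

theorem step3 {p : G} {st : St4} (h : c 3 = (p, st)) : stepL (rule4 t lam) x c 3 =
    (p * (ruleD t st (x p)).1, (ruleD t st (x p)).2) := by
  rw [stepL_see, h]; rfl

theorem rej_step {p : G} (h : c 2 = (p, .rej)) : stepL (rule4 t lam) x c 2 = (p, .rej) := by
  rw [step2 h]; simp [ruleC]

theorem deadB_step {p : G} (h : c 1 = (p, .dead)) : stepL (rule4 t lam) x c 1 = (p, .dead) := by
  rw [step1 h]; simp [ruleB]

theorem deadC_step {p : G} (h : c 2 = (p, .dead)) : stepL (rule4 t lam) x c 2 = (p, .dead) := by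
  rw [step2 h]; simp [ruleC]

theorem stayD_step {p : G} (h : c 3 = (p, .stay)) : stepL (rule4 t lam) x c 3 = (p, .stay) := by
  rw [step3 h]; simp [ruleD]

theorem deadBC_step {p q : G} (h : c 1 = (p, .dead)) (h2 : c 2 = (q, .stay)) : stepL (rule4 t lam) x c 2 = (q, .stay) := by
  rw [step2 h2]
  rcases seeF_or (p := q) h with h' | h' <;> simp [ruleC, h']

theorem C_noR {p q : G} {st : St4} (h : c 1 = (p, st)) (h2 : c 2 = (q, .stay)) (hs : p = q → ∀ a b, st ≠ .R a b) :
    stepL (rule4 t lam) x c 2 = (q, .stay) := by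
  rw [step2 h2]
  by_cases e : p = q
  · have h' := seeF_eq h e
    have := hs e
    cases st <;> simp_all [ruleC]
  · simp [ruleC, seeF_ne h e]

/-! clocks -/

/-- slow clock -/
def cka (T : ℕ) : ℕ := 5 * (T / 11) + (T % 11) / 2

/-- fast clock -/
def ckb (T : ℕ) : ℕ := 6 * (T / 11) + (T % 11 + 1) / 2

theorem cka_odd {T : ℕ} (h : T % 11 % 2 = 1) : cka (T + 1) = cka T + 1 := by unfold cka; omega
theorem cka_even {T : ℕ} (h : T % 11 % 2 ≠ 1) : cka (T + 1) = cka T := by unfold cka; omega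
theorem ckb_even {T : ℕ} (h : T % 11 % 2 = 0) : ckb (T + 1) = ckb T + 1 := by unfold ckb; omega
theorem ckb_odd {T : ℕ} (h : T % 11 % 2 ≠ 0) : ckb (T + 1) = ckb T := by unfold ckb; omega
theorem ck_add (T : ℕ) : cka T + ckb T = T := by unfold cka ckb; omega

theorem val11 (T : ℕ) : ((T : ℕ) : ZMod 11).val = T % 11 := ZMod.val_natCast 11 T

theorem tmul (ht : ∀ n : ℤ, t ^ n = 1 → n = 0) (h : G) {a b : ℤ} : h * t ^ a = h * t ^ b ↔ a = b := by
  constructor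
  · intro e
    have e1 := mul_left_cancel e
    have := ht (a - b) (by rw [zpow_sub, e1, mul_inv_cancel])
    omega
  · rintro rfl; rfl

theorem tA {u : G} {e : ℤ} {T : ℕ} : u * t ^ (e + (cka T : ℤ)) * (if T % 11 % 2 = 1 then t else 1) = u * t ^ (e + (cka (T + 1) : ℤ)) := by
  by_cases h : T % 11 % 2 = 1
  · rw [if_pos h, cka_odd h, mul_assoc, ← zpow_add_one]; push_cast; rw [add_assoc]
  · rw [if_neg h, cka_even h, mul_one]

theorem tB {u : G} {e : ℤ} {T : ℕ} : u * t ^ (e + (ckb T : ℤ)) * (if T % 11 % 2 = 0 then t else 1) = u * t ^ (e + (ckb (T + 1) : ℤ)) := by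
  by_cases h : T % 11 % 2 = 0
  · rw [if_pos h, ckb_even h, mul_assoc, ← zpow_add_one]; push_cast; rw [add_assoc]
  · rw [if_neg h, ckb_odd h, mul_one]

theorem tB' {u : G} {e : ℤ} {T : ℕ} : u * t ^ (e - (ckb T : ℤ)) * (if T % 11 % 2 = 0 then t⁻¹ else 1) = u * t ^ (e - (ckb (T + 1) : ℤ)) := by
  by_cases h : T % 11 % 2 = 0
  · rw [if_pos h, ckb_even h, mul_assoc, ← zpow_sub_one]; push_cast; rw [sub_sub]
  · rw [if_neg h, ckb_odd h, mul_one]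

theorem zc (hc : ∀ g : G, t * g = g * t) (e : ℤ) (g : G) : t ^ e * g = g * t ^ e :=
  (Commute.zpow_left (hc g : Commute t g) e).eq


/-- beginning of a block -/
def Bo (t : G) (lam : Fin 6 → G) (g : G) (d : ℕ) (c : Fin 4 → G × St4) (h : G) (n : ℕ) (s : Fin 6) : Prop :=
  (s ≠ 5 → c 0 = (h * lam s * t ^ ((d : ℤ) - n), .run 0)) ∧ c 1 = (h * t ^ ((d : ℤ) - n), .R 0 s) ∧
    c 2 = (h * t ^ (d : ℤ), .stay) ∧ c 3 = (g * t ^ (d : ℤ), .stay)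

theorem up_BCD (ht : ∀ n : ℤ, t ^ n = 1 → n = 0) {g h : G} {d n : ℕ} {s : Fin 6}
    (hB : Bo t lam g d c h n s) (T : ℕ) (hT : ∀ T' < T, ckb T' < n) :
    (stepL (rule4 t lam) x)^[T] c 1 = (h * t ^ ((d : ℤ) - n + ckb T), .R (T : ZMod 11) s) ∧
    (stepL (rule4 t lam) x)^[T] c 2 = (h * t ^ (d : ℤ), .stay) ∧
    (stepL (rule4 t lam) x)^[T] c 3 = (g * t ^ (d : ℤ), .stay) := by
  induction T with
  | zero => simpa [ckb] using hB.2
  | succ T ih =>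
    obtain ⟨h1, h2, h3⟩ := ih fun T' hT' => hT T' (by omega)
    have hlt := hT T (by omega)
    rw [Function.iterate_succ_apply']
    have hne : h * t ^ ((d : ℤ) - n + ckb T) ≠ h * t ^ (d : ℤ) := by
      rw [Ne, tmul ht]; omega
    refine ⟨?_, C_noR h1 h2 (fun e => absurd e hne), stayD_step h3⟩
    rw [step1 h1]
    simp only [ruleB, seeF_ne h2 hne.symm, if_true, val11, tB]
    push_cast; rfl

theorem up_A (ht : ∀ n : ℤ, t ^ n = 1 → n = 0) {g h : G} {d n : ℕ} {s : Fin 6} (hs : s ≠ 5)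
    (hB : Bo t lam g d c h n s) (T : ℕ) (hT : ∀ T' < T, ckb T' < n ∨ ckb T' = n ∧ T' + 1 = T) :
    (stepL (rule4 t lam) x)^[T] c 0 = (h * lam s * t ^ ((d : ℤ) - n + cka T), .run (T : ZMod 11)) := by
  induction T with
  | zero => simpa [cka] using hB.1 hs
  | succ T ih =>
    have h0 := ih fun T' hT' => by
      rcases hT T' (by omega) with h | h
      · exact Or.inl h
      · omega
    obtain ⟨h1, h2, h3⟩ := up_BCD (x := x) ht hB T fun T' hT' => by
      rcases hT T' (by omega) with h | h
      · exact h
      · omega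
    rw [Function.iterate_succ_apply', step0 h0]
    have : ¬ ∃ p', seeF ((stepL (rule4 t lam) x)^[T] c) (h * lam s * t ^ ((d : ℤ) - n + cka T)) 1 = some (.L p') := by
      rcases seeF_or (p := h * lam s * t ^ ((d : ℤ) - n + cka T)) h1 with e | e <;> simp [e]
    simp only [ruleA, if_neg this, val11, tA]
    push_cast; rfl

theorem exists_T1 {n : ℕ} (hn : 1 ≤ n) : ∃ T, ckb T = n ∧ ∀ T' < T, ckb T' < n := by
  have hex : ∃ T, n ≤ ckb T := ⟨2 * n, by unfold ckb; omega⟩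
  refine ⟨Nat.find hex, ?_, fun T' hT' => not_le.1 (Nat.find_min hex hT')⟩
  have h1 := Nat.find_spec hex
  rcases h : Nat.find hex with _ | T
  · rw [h] at h1
    simp [ckb] at h1; omega
  · have h2 := Nat.find_min hex (m := T) (by omega)
    rw [h] at h1
    unfold ckb at *; omega

theorem stop_lem (ht : ∀ n : ℤ, t ^ n = 1 → n = 0) {g h : G} {d n : ℕ} (hn : 1 ≤ n)
    (hB : Bo t lam g d c h n 5) :
    ∃ T, (∃ p, (stepL (rule4 t lam) x)^[T] c 1 = (p, .dead)) ∧
      (h = g → ∃ q, (stepL (rule4 t lam) x)^[T] c 2 = (q, .stay)) ∧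
      (h ≠ g → ∃ q, (stepL (rule4 t lam) x)^[T] c 2 = (q, .rej)) := by
  obtain ⟨T, hT, hT'⟩ := exists_T1 hn
  obtain ⟨h1, h2, h3⟩ := up_BCD (x := x) ht hB T hT'
  have e : h * t ^ ((d : ℤ) - n + ckb T) = h * t ^ (d : ℤ) := by
    rw [tmul ht]; omega
  refine ⟨T + 1, ?_⟩
  rw [Function.iterate_succ_apply', step1 h1, step2 h2]
  refine ⟨?_, fun hg => ?_, fun hg => ?_⟩
  · simp [ruleB, seeF_eq h2 e.symm]
  · have e3 : g * t ^ (d : ℤ) = h * t ^ (d : ℤ) := by rw [hg]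
    simp only [ruleC, seeF_eq h1 e, seeF_eq h3 e3, reduceCtorEq, if_true, if_false]
    exact ⟨_, rfl⟩
  · have e3 : g * t ^ (d : ℤ) ≠ h * t ^ (d : ℤ) := fun h => hg (mul_right_cancel h).symm
    simp only [ruleC, seeF_eq h1 e, seeF_ne h3 e3, if_true]
    exact ⟨_, rfl⟩

theorem down_lem (ht : ∀ n : ℤ, t ^ n = 1 → n = 0) (hc : ∀ g : G, t * g = g * t) {g h : G} {d n : ℕ} {s : Fin 6} (hs : s ≠ 5) (hn : 11 ≤ n)
    (hB : Bo t lam g d c h n s) :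
    ∃ T1, T1 + 1 ≤ 2 * n ∧ ∀ k, T1 + 1 + k ≤ 2 * n →
    (stepL (rule4 t lam) x)^[T1 + 1 + k] c 0 = (h * lam s * t ^ ((d : ℤ) - n + cka (T1 + 1 + k)), .run ((T1 + 1 + k : ℕ) : ZMod 11)) ∧
    (stepL (rule4 t lam) x)^[T1 + 1 + k] c 1 = (h * lam s * t ^ ((d : ℤ) + n - ckb (T1 + 1 + k)), .L ((T1 + 1 + k : ℕ) : ZMod 11)) ∧
    (stepL (rule4 t lam) x)^[T1 + 1 + k] c 2 = (h * lam s * t ^ (d : ℤ), .stay) ∧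
    (stepL (rule4 t lam) x)^[T1 + 1 + k] c 3 = (g * t ^ (d : ℤ), .stay) := by
  obtain ⟨T, hT, hT'⟩ := exists_T1 (n := n) (by omega)
  obtain ⟨h1, h2, h3⟩ := up_BCD (x := x) ht hB T hT'
  have e : h * t ^ ((d : ℤ) - n + ckb T) = h * t ^ (d : ℤ) := by
    rw [tmul ht]; omega
  refine ⟨T, by unfold ckb at hT; omega, fun k => ?_⟩
  induction k with
  | zero =>
    intro _
    rw [add_zero]
    have hA := up_A (x := x) ht hs hB (T + 1) (fun T' h' => by
      by_cases hh : T' < T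
      · exact Or.inl (hT' _ hh)
      · have : T' = T := by omega
        subst this; exact Or.inr ⟨hT, rfl⟩)
    refine ⟨hA, ?_, ?_, ?_⟩
    · rw [Function.iterate_succ_apply', step1 h1]
      simp only [ruleB, seeF_eq h2 e.symm, if_neg hs, reduceCtorEq, if_false, val11]
      refine Prod.ext ?_ (by push_cast; rfl)
      show h * t ^ ((d : ℤ) - n + ckb T) * (lam s * _) = _
      rw [← tB', e, mul_assoc h, ← mul_assoc (t ^ _), zc hc]
      have : (d : ℤ) + n - ckb T = d := by omega
      rw [this]; simp only [mul_assoc]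
    · rw [Function.iterate_succ_apply', step2 h2]
      simp only [ruleC, seeF_eq h1 e, if_neg hs]
      rw [mul_assoc, zc hc, mul_assoc]
    · rw [Function.iterate_succ_apply', stayD_step h3]
  | succ k ih =>
    intro hk
    obtain ⟨k0, k1, k2, k3⟩ := ih (by omega)
    have hne : h * lam s * t ^ ((d : ℤ) - n + cka (T + 1 + k)) ≠ h * lam s * t ^ ((d : ℤ) + n - ckb (T + 1 + k)) := by
      rw [Ne, tmul ht]
      have := ck_add (T + 1 + k)
      omega
    rw [← add_assoc, Function.iterate_succ_apply']
    refine ⟨?_, ?_, C_noR k1 k2 (fun _ a b => by simp), stayD_step k3⟩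
    · rw [step0 k0]
      simp only [ruleA, seeF_ne k1 hne.symm, reduceCtorEq, exists_false, if_false, val11, tA]
      push_cast; rfl
    · rw [step1 k1]
      simp only [ruleB, seeF_ne k0 hne, if_true, val11, tB']
      push_cast; rfl

theorem block (ht : ∀ n : ℤ, t ^ n = 1 → n = 0) (hc : ∀ g : G, t * g = g * t) {g h : G} {d n : ℕ} {s σ : Fin 6} (hs : s ≠ 5) (hn : 1 ≤ n)
    (hB : Bo t lam g d c h (11 * n + σ) s) : ∃ T, Bo t lam g d ((stepL (rule4 t lam) x)^[T] c) (h * lam s) n σ := by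
  obtain ⟨T1, hT1, H⟩ := down_lem (x := x) ht hc hs (by omega) hB
  obtain ⟨k, hk⟩ := Nat.exists_eq_add_of_le hT1
  obtain ⟨k0, k1, k2, k3⟩ := H k (by omega)
  rw [← hk] at k0 k1 k2 k3
  have hσ := σ.2
  have ea : cka (2 * (11 * n + σ)) = 10 * n + σ := by unfold cka; omega
  have eb : ckb (2 * (11 * n + σ)) = 12 * n + σ := by unfold ckb; omega
  have e1 : (d : ℤ) - ((11 * n + σ : ℕ) : ℤ) + cka (2 * (11 * n + σ)) = d - n := by rw [ea]; push_cast; ring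
  have e2 : (d : ℤ) + ((11 * n + σ : ℕ) : ℤ) - ckb (2 * (11 * n + σ)) = d - n := by rw [eb]; push_cast; ring
  rw [e1] at k0
  rw [e2] at k1
  have hd : dig ((2 * (11 * n + σ) : ℕ) : ZMod 11) = σ := by
    unfold dig
    rw [val11]
    apply Fin.ext
    show (2 * (11 * n + σ.val)) % 11 / 2 % 6 = σ.val
    have h1 : 2 * (11 * n + σ.val) % 11 = 2 * σ.val := by
      rw [show 2 * (11 * n + σ.val) = 2 * σ.val + 11 * (2 * n) by ring, Nat.add_mul_mod_self_left]
      exact Nat.mod_eq_of_lt (by omega)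
    rw [h1]
    omega
  refine ⟨2 * (11 * n + σ) + 1, ?_⟩
  rw [Function.iterate_succ_apply']
  refine ⟨fun hσ5 => ?_, ?_, C_noR k1 k2 (fun _ a b => by simp), stayD_step k3⟩
  · rw [step0 k0]
    have : ∃ p', seeF ((stepL (rule4 t lam) x)^[2 * (11 * n + σ)] c) (h * lam s * t ^ ((d : ℤ) - n)) 1 = some (.L p') :=
      ⟨_, seeF_eq k1 rfl⟩
    simp only [ruleA, if_pos this, hd, if_neg hσ5]
    rw [mul_assoc, zc hc, ← mul_assoc]
  · rw [step1 k1]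
    simp only [ruleB, seeF_eq k0 rfl, reduceCtorEq, if_false, hd, mul_one]

/-- encoding of digit lists -/
def dcode (l : List (Fin 6)) : ℕ := l.foldr (fun (σ : Fin 6) (n : ℕ) => 11 * n + σ.val) 16

theorem dcode_pos (l : List (Fin 6)) : 1 ≤ dcode l := by
  induction l with
  | nil => simp [dcode]
  | cons a l ih =>
    have : dcode (a :: l) = 11 * dcode l + a := rfl
    omega

theorem blocks (ht : ∀ n : ℤ, t ^ n = 1 → n = 0) (hc : ∀ g : G, t * g = g * t) {g h : G} {d : ℕ} {s : Fin 6} (hs : s ≠ 5) (l : List (Fin 6))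
    (hl : ∀ a ∈ l, a ≠ 5) (hB : Bo t lam g d c h (dcode l) s) :
    ∃ T, (∃ p, (stepL (rule4 t lam) x)^[T] c 1 = (p, .dead)) ∧
      (h * lam s * (l.map lam).prod = g → ∃ q, (stepL (rule4 t lam) x)^[T] c 2 = (q, .stay)) ∧
      (h * lam s * (l.map lam).prod ≠ g → ∃ q, (stepL (rule4 t lam) x)^[T] c 2 = (q, .rej)) := by
  induction l generalizing c h s with
  | nil =>
    obtain ⟨T, hT⟩ := block (x := x) (n := 1) (σ := 5) ht hc hs le_rfl hB
    obtain ⟨T', hT'⟩ := stop_lem (x := x) ht le_rfl hT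
    refine ⟨T' + T, ?_⟩
    rw [Function.iterate_add_apply]
    simpa using hT'
  | cons a l ih =>
    obtain ⟨T, hT⟩ := block (x := x) (n := dcode l) (σ := a) ht hc hs (dcode_pos l) hB
    obtain ⟨T', hT'⟩ := ih (hl a (by simp)) (fun b hb => hl b (by simp [hb])) hT
    refine ⟨T' + T, ?_⟩
    rw [Function.iterate_add_apply]
    simpa [mul_assoc] using hT'


theorem init_out {g : G} {d : ℕ} (hx1 : x g = 1) (hx : ∀ j < d, x (g * t ^ (j : ℤ)) ≠ 2) (j : ℕ) (hj : j ≤ d) :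
    (stepL (rule4 t lam) x)^[j + 1] (fun _ => (g, .start0)) = fun i => if i = 0 then (g, .wait) else (g * t ^ (j : ℤ), .out) := by
  induction j with
  | zero =>
    funext i
    rw [Function.iterate_succ_apply']
    fin_cases i
    · show stepL (rule4 t lam) x _ 0 = _
      rw [step0 rfl]; simp [ruleA, hx1]
    · show stepL (rule4 t lam) x _ 1 = _
      rw [step1 rfl]; simp [ruleB, hx1]
    · show stepL (rule4 t lam) x _ 2 = _
      rw [step2 rfl]; simp [ruleC, hx1]
    · show stepL (rule4 t lam) x _ 3 = _
      rw [step3 rfl]; simp [ruleD, hx1]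
  | succ j ih =>
    have h0 := ih (by omega)
    have e : g * t ^ (j : ℤ) * t = g * t ^ ((j + 1 : ℕ) : ℤ) := by
      rw [mul_assoc, ← zpow_add_one]; push_cast; rfl
    have hx' := hx j (by omega)
    funext i
    rw [Function.iterate_succ_apply', h0]
    let c0 : Fin 4 → G × St4 := fun i => if i = 0 then (g, St4.wait) else (g * t ^ (j : ℤ), St4.out)
    have hb : c0 1 = (g * t ^ (j : ℤ), St4.out) := rfl
    have hc : (fun i : Fin 4 => if i = 0 then (g, St4.wait) else (g * t ^ (j : ℤ), St4.out)) 2 = (g * t ^ (j : ℤ), St4.out) := rfl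
    have hd : (fun i : Fin 4 => if i = 0 then (g, St4.wait) else (g * t ^ (j : ℤ), St4.out)) 3 = (g * t ^ (j : ℤ), St4.out) := rfl
    fin_cases i
    · show stepL (rule4 t lam) x _ 0 = _
      rw [step0 rfl]
      rcases seeF_or (c := c0) (j := 1) (p := g) hb with h' | h' <;> simp [ruleA, c0, h'] at h' ⊢ <;> simp [h']
    · show stepL (rule4 t lam) x _ 1 = (g * t ^ ((j + 1 : ℕ) : ℤ), St4.out)
      rw [step1 hb, ← e]; simp only [ruleB, if_neg hx']
    · show stepL (rule4 t lam) x _ 2 = (g * t ^ ((j + 1 : ℕ) : ℤ), St4.out)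
      rw [step2 hc, ← e]; simp only [ruleC, if_neg hx']
    · show stepL (rule4 t lam) x _ 3 = (g * t ^ ((j + 1 : ℕ) : ℤ), St4.out)
      rw [step3 hd, ← e]; simp only [ruleD, if_neg hx']

theorem init_back (ht : ∀ n : ℤ, t ^ n = 1 → n = 0) {g : G} {d : ℕ} (hx1 : x g = 1) (hx : ∀ j < d, x (g * t ^ (j : ℤ)) ≠ 2)
    (hx2 : x (g * t ^ (d : ℤ)) = 2) (j : ℕ) (hj : j ≤ d) :
    (stepL (rule4 t lam) x)^[d + 2 + j] (fun _ => (g, .start0)) 0 = (g, .wait) ∧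
    (stepL (rule4 t lam) x)^[d + 2 + j] (fun _ => (g, .start0)) 1 = (g * t ^ ((d : ℤ) - j), .back) ∧
    (stepL (rule4 t lam) x)^[d + 2 + j] (fun _ => (g, .start0)) 2 = (g * t ^ (d : ℤ), .stay) ∧
    (stepL (rule4 t lam) x)^[d + 2 + j] (fun _ => (g, .start0)) 3 = (g * t ^ (d : ℤ), .stay) := by
  induction j with
  | zero =>
    have h0 := init_out (lam := lam) hx1 hx d le_rfl
    let c0 : Fin 4 → G × St4 := fun i => if i = 0 then (g, St4.wait) else (g * t ^ (d : ℤ), St4.out)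
    have hb : c0 1 = (g * t ^ (d : ℤ), St4.out) := rfl
    have hc : (fun i : Fin 4 => if i = 0 then (g, St4.wait) else (g * t ^ (d : ℤ), St4.out)) 2 = (g * t ^ (d : ℤ), St4.out) := rfl
    have hd : (fun i : Fin 4 => if i = 0 then (g, St4.wait) else (g * t ^ (d : ℤ), St4.out)) 3 = (g * t ^ (d : ℤ), St4.out) := rfl
    rw [add_zero, Function.iterate_succ_apply', h0]
    refine ⟨?_, ?_, ?_, ?_⟩
    · rw [step0 rfl]
      rcases seeF_or (c := c0) (j := 1) (p := g) hb with h' | h' <;> simp [ruleA, c0, h'] at h' ⊢ <;> simp [h']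
    · rw [step1 hb]; simp only [ruleB, hx2, if_true]; simp
    · rw [step2 hc]; simp only [ruleC, hx2, if_true]; simp
    · rw [step3 hd]; simp only [ruleD, hx2, if_true]; simp
  | succ j ih =>
    obtain ⟨h0, h1, h2, h3⟩ := ih (by omega)
    have hne : g ≠ g * t ^ ((d : ℤ) - j) := by
      intro h
      have := (tmul ht g (a := 0) (b := (d : ℤ) - j)).1 (by simpa using h)
      omega
    rw [← add_assoc, Function.iterate_succ_apply']
    refine ⟨?_, ?_, C_noR h1 h2 (fun _ a b => by simp), stayD_step h3⟩
    · rw [step0 h0]; simp [ruleA, seeF_ne h1 hne.symm]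
    · rw [step1 h1]; simp only [ruleB, seeF_ne h0 hne, reduceCtorEq, if_false]
      rw [mul_assoc, ← zpow_sub_one, sub_sub]; push_cast; rfl

theorem init_Bo (ht : ∀ n : ℤ, t ^ n = 1 → n = 0) (h1 : lam 0 = 1) {g : G} {d : ℕ} (hx1 : x g = 1) (hx : ∀ j < d, x (g * t ^ (j : ℤ)) ≠ 2)
    (hx2 : x (g * t ^ (d : ℤ)) = 2) :
    Bo t lam g d ((stepL (rule4 t lam) x)^[d + 2 + d + 1] (fun _ => (g, .start0))) g d 0 := by
  obtain ⟨k0, k1, k2, k3⟩ := init_back (lam := lam) ht hx1 hx hx2 d le_rfl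
  rw [sub_self, zpow_zero, mul_one] at k1
  rw [Function.iterate_succ_apply']
  refine ⟨fun _ => ?_, ?_, C_noR k1 k2 (fun _ a b => by simp), stayD_step k3⟩
  · rw [step0 k0]; simp [ruleA, seeF_eq k1 rfl, h1]
  · rw [step1 k1]; simp [ruleB, seeF_eq k0 rfl]

theorem iter_C_rej {T k : ℕ} (h : ((stepL (rule4 t lam) x)^[T] c 2).2 = .rej) : ((stepL (rule4 t lam) x)^[k + T] c 2).2 = .rej := by
  induction k with
  | zero => rwa [zero_add]
  | succ k ih =>
    rw [add_right_comm, Function.iterate_succ_apply', rej_step (Prod.ext rfl ih)]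

theorem rejects_iff (ht : ∀ n : ℤ, t ^ n = 1 → n = 0) (hc : ∀ g : G, t * g = g * t) (h1 : lam 0 = 1) (l : List (Fin 6))
    (hl : ∀ a ∈ l, a ≠ 5) (hex : ∃ g, x g = 1)
    (hx : ∀ g, x g = 1 → (∀ j < dcode l, x (g * t ^ (j : ℤ)) ≠ 2) ∧ x (g * t ^ (dcode l : ℤ)) = 2) :
    (∃ g n, ((stepL (rule4 t lam) x)^[n] (fun _ => (g, .start0)) 2).2 = .rej) ↔ (l.map lam).prod ≠ 1 := by
  have main : ∀ g, x g = 1 → ∃ T, (∃ p, (stepL (rule4 t lam) x)^[T] (fun _ => (g, .start0)) 1 = (p, .dead)) ∧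
      ((l.map lam).prod = 1 → ∃ q, (stepL (rule4 t lam) x)^[T] (fun _ => (g, .start0)) 2 = (q, .stay)) ∧
      ((l.map lam).prod ≠ 1 → ∃ q, (stepL (rule4 t lam) x)^[T] (fun _ => (g, .start0)) 2 = (q, .rej)) := by
    intro g hg
    have hB := init_Bo (lam := lam) ht h1 hg (hx g hg).1 (hx g hg).2
    obtain ⟨T, hT⟩ := blocks (x := x) ht hc (by decide) l hl hB
    refine ⟨T + (dcode l + 2 + dcode l + 1), ?_⟩
    rw [Function.iterate_add_apply]
    simpa [h1] using hT
  constructor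
  · rintro ⟨g, n, hn⟩ hp
    by_cases hg : x g = 1
    · obtain ⟨T, ⟨p, hT1⟩, hT2, -⟩ := main g hg
      obtain ⟨q, hq⟩ := hT2 hp
      have hs : ∀ k, (stepL (rule4 t lam) x)^[k + T] (fun _ => (g, .start0)) 1 = (p, .dead) ∧
          (stepL (rule4 t lam) x)^[k + T] (fun _ => (g, .start0)) 2 = (q, .stay) := by
        intro k
        induction k with
        | zero => rw [zero_add]; exact ⟨hT1, hq⟩
        | succ k ih =>
          rw [add_right_comm, Function.iterate_succ_apply']
          exact ⟨deadB_step ih.1, deadBC_step ih.1 ih.2⟩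
      have h2 := iter_C_rej (k := T) hn
      rw [add_comm, (hs n).2] at h2
      cases h2
    · have : ∀ n, (stepL (rule4 t lam) x)^[n + 1] (fun _ => (g, .start0)) 2 = (g, .dead) := by
        intro n
        induction n with
        | zero =>
          rw [Function.iterate_succ_apply']
          rw [step2 rfl]; simp [ruleC, hg]
        | succ n ih =>
          rw [Function.iterate_succ_apply', deadC_step ih]
      have h2 := iter_C_rej (k := 1) hn
      rw [add_comm, this n] at h2
      cases h2
  · intro hp
    obtain ⟨g, hg⟩ := hex
    obtain ⟨T, -, -, hT⟩ := main g hg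
    obtain ⟨q, hq⟩ := hT hp
    exact ⟨g, T, by rw [hq]⟩

end Machine
end FH


namespace FH

theorem primrec_pi {n : ℕ} {α β : Type*} [Primcodable α] [Primcodable β] {f : α → Fin n → β}
    (h : ∀ i, Primrec fun a => f a i) : Primrec f := by
  have h1 : Primrec fun a => List.Vector.ofFn (f a) := Primrec.vector_ofFn h
  have h2 : Primrec fun v : List.Vector β n => (v.get : Fin n → β) := Primrec.vector_get'
  refine (h2.comp h1).of_eq fun a => ?_
  funext i; simp

theorem primrec_app {n : ℕ} {α β : Type*} [Primcodable α] [Primcodable β] {f : α → Fin n → β}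
    (h : Primrec f) (i : Fin n) : Primrec fun a => f a i :=
  Primrec.fin_app.comp h (Primrec.const i)

theorem primrecPred_all {α : Type*} [Primcodable α] {n : ℕ} {P : Fin n → α → Prop} (h : ∀ i, PrimrecPred (P i)) :
    PrimrecPred fun a => ∀ i, P i a := by
  induction n with
  | zero => exact (PrimrecPred.of_eq (p := fun _ : α => True) ⟨inferInstance, Primrec.const true⟩ fun a => by simp)
  | succ n ih =>
    exact ((h 0).and (ih fun i => h i.succ)).of_eq fun a => by rw [Fin.forall_fin_succ]

theorem primrecPred_fin {α : Type*} [Primcodable α] [Finite α] (p : α → Prop) : PrimrecPred p := by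
  classical
  exact ⟨inferInstance, Primrec.dom_finite _⟩

theorem re_ex {α β : Type*} [Primcodable α] [Primcodable β] {P : α → β → Prop} (h : PrimrecRel P) :
    ∃ f : α →. ℕ, Partrec f ∧ ∀ a, (f a).Dom ↔ ∃ b, P a b := by
  classical
  let q : α → ℕ → Bool := fun a n => ((Encodable.decode (α := β) n).map fun b => decide (P a b)).getD false
  have h0 : Primrec₂ fun a b => decide (P a b) := PrimrecRel.decide h
  have hq : Primrec₂ q := by
    refine Primrec.option_getD.comp (Primrec.option_map (Primrec.decode.comp Primrec.snd) ?_) (Primrec.const false)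
    exact (h0.comp (Primrec.fst.comp Primrec.fst) Primrec.snd).to₂
  let r : α → ℕ →. Bool := fun a n => Part.some (q a n)
  refine ⟨fun a => Nat.rfind (r a), Partrec.rfind (hq.to_comp.partrec₂), fun a => ?_⟩
  show (Nat.rfind (r a)).Dom ↔ _
  rw [Nat.rfind_dom]
  simp only [r]
  simp only [Part.mem_some_iff, Part.some_dom, implies_true, and_true]
  constructor
  · rintro ⟨n, hn⟩
    simp only [q] at hn
    rcases hd : (Encodable.decode (α := β) n) with _ | b
    · simp [hd] at hn
    · exact ⟨b, by simpa [hd] using hn⟩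
  · rintro ⟨b, hb⟩
    exact ⟨Encodable.encode b, by simp [q, hb]⟩

/-- removal of the central letter -/
def strip (w : W5) : W5 := w.filter fun l => decide (l.1 ≠ 4)

theorem primrec_strip : Primrec strip := by
  have h : PrimrecPred fun l : Fin 5 × Bool => l.1 ≠ 4 := primrecPred_fin _
  exact Primrec.listFilter h

theorem evW_strip (w : W5) : evW (strip w) = ((evW w).1, 1) := by
  have hc : ∀ (l : Fin 5 × Bool) (w : W5), evW (l :: w) = evW [l] * evW w := fun l w =>
    evW_append [l] w
  induction w with
  | nil => rfl
  | cons l w ih =>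
    obtain ⟨i, b⟩ := l
    by_cases h : i = 4
    · have : strip ((i, b) :: w) = strip w := by simp [strip, h]
      rw [this, ih, hc (i, b) w]
      subst h
      have : (evW [((4 : Fin 5), b)]).1 = 1 := by cases b <;> simp [evW, evalWord, genP]
      rw [Prod.fst_mul, this, one_mul]
    · have : strip ((i, b) :: w) = (i, b) :: strip w := by simp [strip, h]
      rw [this, hc (i, b) (strip w), hc (i, b) w, ih]
      refine Prod.ext rfl ?_
      have : (evW [(i, b)]).2 = 1 := by
        fin_cases i <;> cases b <;> simp [evW, evalWord, genP] at h ⊢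
      rw [Prod.snd_mul, this, one_mul]

theorem primrecPred_fst (X : Set HH) (hX : X.Finite) : PrimrecPred fun w : W5 => (evW w).1 ∈ X := by
  have := (primrecPred_finite ((fun h => ((h, 1) : PG)) '' X) (hX.image _)).comp primrec_strip
  refine this.of_eq fun w => ?_
  rw [evW_strip]
  constructor
  · rintro ⟨h, h1, h2⟩
    rw [← (Prod.ext_iff.1 h2).1]; exact h1
  · intro h; exact ⟨_, h, rfl⟩

namespace Mach
variable (K : Mach)

/-- word configurations -/
abbrev WC := Fin 3 → W5 × Option (Fin K.M)

/-- value of a word configuration -/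
noncomputable def val (c : K.WC) : K.Cfg := fun i => (evW (c i).1, (c i).2)

/-- words of the windows -/
noncomputable def WWd (b : Fin K.w) : W5 := (evW_surj (K.W b)).choose

theorem evW_WWd (b : Fin K.w) : evW (K.WWd b) = K.W b := (evW_surj (K.W b)).choose_spec

/-- words of the moves -/
noncomputable def FWd (i : Fin 3) (x : Option (Fin K.M) × K.View) : W5 := (evW_surj (K.F i x.1 x.2).1).choose

theorem evW_FWd (i : Fin 3) (x : Option (Fin K.M) × K.View) : evW (K.FWd i x) = (K.F i x.1 x.2).1 :=
  (evW_surj (K.F i x.1 x.2).1).choose_spec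

theorem view_primrec (N : Subgroup PG) (hN : (N : Set PG).Finite) (i : Fin 3) :
    Primrec fun s : ℕ × (Fin 3 → Fin 3) × K.WC => K.view N s.2.1 s.1 (K.val s.2.2) i := by
  classical
  have hκ : Primrec fun s : ℕ × (Fin 3 → Fin 3) × K.WC => s.2.1 := Primrec.fst.comp Primrec.snd
  have hc : Primrec fun s : ℕ × (Fin 3 → Fin 3) × K.WC => s.2.2 := Primrec.snd.comp Primrec.snd
  have hw : ∀ j, Primrec fun s : ℕ × (Fin 3 → Fin 3) × K.WC => (s.2.2 j).1 := fun j => Primrec.fst.comp (primrec_app hc j)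
  refine Primrec.pair (primrec_pi fun b => ?_) (primrec_pi fun j => primrec_pi fun b => ?_)
  · have : Primrec fun s : ℕ × (Fin 3 → Fin 3) × K.WC => env s.1 (evW ((s.2.2 i).1 ++ K.WWd b)) :=
      primrec_env.comp Primrec.fst (Primrec.list_append.comp (hw i) (Primrec.const _))
    refine this.of_eq fun s => ?_
    rw [evW_append, evW_WWd]; rfl
  · have h1 : PrimrecPred fun s : ℕ × (Fin 3 → Fin 3) × K.WC => s.2.1 i = s.2.1 j :=
      PrimrecRel.comp (Primrec.eq (α := Fin 3)) (primrec_app hκ i) (primrec_app hκ j)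
    have h2 : PrimrecPred fun s : ℕ × (Fin 3 → Fin 3) × K.WC =>
        evW (inv5 (K.WWd b) ++ (inv5 (s.2.2 i).1 ++ (s.2.2 j).1)) ∈ (N : Set PG) :=
      (primrecPred_finite _ hN).comp (Primrec.list_append.comp (Primrec.const _)
        (Primrec.list_append.comp (primrec_inv5.comp (hw i)) (hw j)))
    have h3 : PrimrecPred fun s : ℕ × (Fin 3 → Fin 3) × K.WC => K.see N s.2.1 (K.val s.2.2) i j b := by
      refine (h1.and h2).of_eq fun s => ?_
      rw [evW_append, evW_append, evW_inv, evW_inv, evW_WWd]; rfl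
    have h4 : Primrec fun s : ℕ × (Fin 3 → Fin 3) × K.WC => (s.2.2 j).2 := Primrec.snd.comp (primrec_app hc j)
    refine (Primrec.ite h3 h4 (Primrec.const none)).of_eq fun s => ?_
    simp only [view, val]

/-- steps of word configurations -/
noncomputable def wstep (N : Subgroup PG) (κ : Fin 3 → Fin 3) (d : ℕ) (c : K.WC) : K.WC := fun i =>
  ((c i).1 ++ K.FWd i ((c i).2, K.view N κ d (K.val c) i), (K.F i (c i).2 (K.view N κ d (K.val c) i)).2)

theorem val_wstep (N : Subgroup PG) (κ : Fin 3 → Fin 3) (d : ℕ) (c : K.WC) :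
    K.val (K.wstep N κ d c) = K.step N κ d (K.val c) := by
  funext i
  show (evW ((c i).1 ++ K.FWd i _), _) = _
  rw [evW_append, evW_FWd]; rfl

theorem val_iter (N : Subgroup PG) (κ : Fin 3 → Fin 3) (d : ℕ) (c : K.WC) (t : ℕ) :
    K.val ((K.wstep N κ d)^[t] c) = K.run N κ d (K.val c) t := by
  induction t with
  | zero => rfl
  | succ t ih => rw [Function.iterate_succ_apply', val_wstep, ih, run_succ]

theorem wstep_primrec (N : Subgroup PG) (hN : (N : Set PG).Finite) :
    Primrec fun s : ℕ × (Fin 3 → Fin 3) × K.WC => K.wstep N s.2.1 s.1 s.2.2 := by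
  have hc : Primrec fun s : ℕ × (Fin 3 → Fin 3) × K.WC => s.2.2 := Primrec.snd.comp Primrec.snd
  refine primrec_pi fun i => ?_
  have h1 : Primrec fun s : ℕ × (Fin 3 → Fin 3) × K.WC => ((s.2.2 i).2, K.view N s.2.1 s.1 (K.val s.2.2) i) :=
    Primrec.pair (Primrec.snd.comp (primrec_app hc i)) (K.view_primrec N hN i)
  have h2 : Primrec fun x : Option (Fin K.M) × K.View => K.FWd i x := Primrec.dom_finite _
  have h3 : Primrec fun x : Option (Fin K.M) × K.View => (K.F i x.1 x.2).2 := Primrec.dom_finite _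
  exact Primrec.pair (Primrec.list_append.comp (Primrec.fst.comp (primrec_app hc i)) (h2.comp h1)) (h3.comp h1)

theorem witer_primrec (N : Subgroup PG) (hN : (N : Set PG).Finite) :
    Primrec fun s : ℕ × ((Fin 3 → Fin 3) × K.WC × ℕ) => (K.wstep N s.2.1 s.1)^[s.2.2.2] s.2.2.1 := by
  let Φ : ℕ × (Fin 3 → Fin 3) × K.WC → ℕ × (Fin 3 → Fin 3) × K.WC := fun s => (s.1, s.2.1, K.wstep N s.2.1 s.1 s.2.2)
  have hΦ : Primrec Φ := Primrec.pair Primrec.fst (Primrec.pair (Primrec.fst.comp Primrec.snd) (K.wstep_primrec N hN))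
  have h2 := Primrec.snd (α := ℕ) (β := (Fin 3 → Fin 3) × K.WC × ℕ)
  have h3 := Primrec.snd.comp h2
  have h : Primrec fun s : ℕ × ((Fin 3 → Fin 3) × K.WC × ℕ) => Φ^[s.2.2.2] (s.1, s.2.1, s.2.2.1) :=
    Primrec.nat_iterate (Primrec.snd.comp h3)
      (Primrec.pair Primrec.fst (Primrec.pair (Primrec.fst.comp h2) (Primrec.fst.comp h3)))
      (hΦ.comp Primrec.snd).to₂
  refine (Primrec.snd.comp (Primrec.snd.comp h)).of_eq fun s => ?_
  have : ∀ n d κ c, Φ^[n] (d, κ, c) = (d, κ, (K.wstep N κ d)^[n] c) := by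
    intro n d κ c
    induction n with
    | zero => rfl
    | succ n ih => rw [Function.iterate_succ_apply', ih, Function.iterate_succ_apply']
  rw [this]

theorem obs_primrec (N : Subgroup PG) (hN : (N : Set PG).Finite) :
    Primrec fun s : ℕ × (Fin 3 → Fin 3) × K.WC => K.obs N s.2.1 s.1 (K.val s.2.2) := by
  have hc : Primrec fun s : ℕ × (Fin 3 → Fin 3) × K.WC => s.2.2 := Primrec.snd.comp Primrec.snd
  have h1 : ∀ i, Primrec fun s : ℕ × (Fin 3 → Fin 3) × K.WC => (s.2.2 i).2 := fun i =>
    Primrec.snd.comp (primrec_app hc i)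
  exact primrec_pi fun i => Primrec.pair (h1 i) (K.view_primrec N hN i)

theorem Rej'_re (I Fi : K.Obs → Prop) (N : Subgroup PG) (hN : (N : Set PG).Finite) :
    ∃ P : ℕ → ((Fin 3 → Fin 3) × K.WC × ℕ) → Prop, PrimrecRel P ∧ ∀ d, K.Rej' I Fi N d ↔ ∃ b, P d b := by
  have h2 := Primrec.snd (α := ℕ) (β := (Fin 3 → Fin 3) × K.WC × ℕ)
  have h3 := Primrec.snd.comp h2
  have hκ : Primrec fun s : ℕ × ((Fin 3 → Fin 3) × K.WC × ℕ) => s.2.1 := Primrec.fst.comp h2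
  have hc : Primrec fun s : ℕ × ((Fin 3 → Fin 3) × K.WC × ℕ) => s.2.2.1 := Primrec.fst.comp h3
  have hw : ∀ j, Primrec fun s : ℕ × ((Fin 3 → Fin 3) × K.WC × ℕ) => (s.2.2.1 j).1 := fun j => Primrec.fst.comp (primrec_app hc j)
  have hC : PrimrecPred fun s : ℕ × ((Fin 3 → Fin 3) × K.WC × ℕ) =>
      ∀ i j, s.2.1 i = s.2.1 j → (K.rel (K.val s.2.2.1) i j).1 ∈ K.SL1 := by
    refine primrecPred_all fun i => primrecPred_all fun j => ?_
    have h1 : PrimrecPred fun s : ℕ × ((Fin 3 → Fin 3) × K.WC × ℕ) => s.2.1 i = s.2.1 j :=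
      PrimrecRel.comp (Primrec.eq (α := Fin 3)) (primrec_app hκ i) (primrec_app hκ j)
    have h2 : PrimrecPred fun s : ℕ × ((Fin 3 → Fin 3) × K.WC × ℕ) =>
        (evW (inv5 (s.2.2.1 i).1 ++ (s.2.2.1 j).1)).1 ∈ K.SL1 :=
      (primrecPred_fst _ K.SL1_finite).comp (Primrec.list_append.comp (primrec_inv5.comp (hw i)) (hw j))
    refine (h1.not.or h2).of_eq fun s => ?_
    rw [evW_append, evW_inv, ← imp_iff_not_or]; rfl
  have hI : PrimrecPred fun s : ℕ × ((Fin 3 → Fin 3) × K.WC × ℕ) => I (K.obs N s.2.1 s.1 (K.val s.2.2.1)) :=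
    (primrecPred_fin I).comp ((K.obs_primrec N hN).comp (Primrec.pair Primrec.fst (Primrec.pair hκ hc)))
  have hF : PrimrecPred fun s : ℕ × ((Fin 3 → Fin 3) × K.WC × ℕ) =>
      Fi (K.obs N s.2.1 s.1 (K.val ((K.wstep N s.2.1 s.1)^[s.2.2.2] s.2.2.1))) :=
    (primrecPred_fin Fi).comp ((K.obs_primrec N hN).comp (Primrec.pair Primrec.fst (Primrec.pair hκ (K.witer_primrec N hN))))
  refine ⟨fun d b => (∀ i j, b.1 i = b.1 j → (K.rel (K.val b.2.1) i j).1 ∈ K.SL1) ∧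
    (I (K.obs N b.1 d (K.val b.2.1)) ∧ Fi (K.obs N b.1 d (K.val ((K.wstep N b.1 d)^[b.2.2] b.2.1)))),
    hC.and (hI.and hF), fun d => ?_⟩
  constructor
  · rintro ⟨κ, c, t, h1, h2, h3⟩
    choose w hw using fun i => evW_surj (c i).1
    have e : K.val (fun i => (w i, (c i).2)) = c := by
      funext i; exact Prod.ext (hw i) rfl
    refine ⟨(κ, fun i => (w i, (c i).2), t), ?_, ?_, ?_⟩
    · rw [e]; exact h1
    · rw [e]; exact h2
    · rw [val_iter, e]; exact h3
  · rintro ⟨⟨κ, c, t⟩, h1, h2, h3⟩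
    exact ⟨κ, K.val c, t, h1, h2, by rw [← val_iter]; exact h3⟩

end Mach
end FH


namespace FH

/-- the halting set -/
def HaltS : Set ℕ := {n | ((Denumerable.ofNat Nat.Partrec.Code n).eval 0).Dom}

/-- the set of killed central elements -/
def AA : Set ℕ := {m | ∃ n ∈ HaltS, m = 2 * n}

theorem AA_odd (n : ℕ) : 2 * n + 1 ∉ AA := by
  rintro ⟨k, _, hk⟩; omega

theorem AA_even (n : ℕ) : 2 * n ∈ AA ↔ n ∈ HaltS := by
  constructor
  · rintro ⟨k, h, hk⟩
    have : n = k := by omega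
    rw [this]; exact h
  · intro h; exact ⟨n, h, rfl⟩

instance NN_normal (A : Set ℕ) : (NN A).Normal := ⟨fun n hn g => by
  rw [← ZP_comm n g (NN_le A hn), mul_assoc, mul_inv_cancel, mul_one]; exact hn⟩

/-- the group -/
abbrev GG := PG ⧸ NN AA

/-- the projection -/
noncomputable def pr : PG →* GG := QuotientGroup.mk' (NN AA)

theorem pr_surj : Function.Surjective pr := QuotientGroup.mk'_surjective _

theorem pr_one (x : PG) : pr x = 1 ↔ x ∈ NN AA := QuotientGroup.eq_one_iff x

/-- the generators -/
noncomputable def genG (i : Fin 5) : GG := pr (genP i)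

theorem evalWord_genG (w : W5) : evalWord genG w = pr (evW w) := by
  unfold evW evalWord
  rw [map_list_prod, List.map_map]
  congr 1
  refine List.map_congr_left fun l _ => ?_
  simp only [Function.comp]
  split_ifs
  · rfl
  · rw [map_inv]; rfl

theorem evalWord_mem {K : Type*} [Group K] {m : ℕ} (gen : Fin m → K) (w : List (Fin m × Bool)) :
    evalWord gen w ∈ Subgroup.closure (Set.range gen) := by
  unfold evalWord
  refine Subgroup.list_prod_mem _ fun x hx => ?_
  obtain ⟨l, _, rfl⟩ := List.mem_map.1 hx
  have := Subgroup.subset_closure (k := Set.range gen) ⟨l.1, rfl⟩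
  split_ifs
  · exact this
  · exact Subgroup.inv_mem _ this

theorem gen_top : Subgroup.closure (Set.range genG) = ⊤ := by
  rw [eq_top_iff]
  intro g _
  obtain ⟨p, rfl⟩ := pr_surj g
  obtain ⟨w, rfl⟩ := evW_surj p
  rw [← evalWord_genG]
  exact evalWord_mem _ _

theorem primrec_wordCode : Primrec (wordCode : W5 → ℕ) := by
  unfold wordCode
  have h : Primrec fun l : Fin 5 × Bool => 2 * l.1.val + (if l.2 then 1 else 0) + 1 := Primrec.dom_finite _
  exact Primrec.list_foldl Primrec.id (Primrec.const 0)
    (Primrec.nat_add.comp (Primrec.nat_mul.comp (Primrec.fst.comp Primrec.snd) (Primrec.const _))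
      (h.comp (Primrec.snd.comp Primrec.snd))).to₂

theorem evW_flat (l : List (ℕ × ℕ)) : evW (l.flatMap fun p => uw (2 * p.1)) = (l.map fun p => uu (2 * p.1)).prod := by
  induction l with
  | nil => rfl
  | cons a l ih => rw [List.flatMap_cons, evW_append, ih, evW_uw, List.map_cons, List.prod_cons]

theorem haltS_iff (n : ℕ) : n ∈ HaltS ↔ ∃ k, (Nat.Partrec.Code.evaln k (Denumerable.ofNat Nat.Partrec.Code n) 0).isSome = true := by
  constructor
  · intro h
    obtain ⟨y, hy⟩ := Part.dom_iff_mem.1 (show ((Denumerable.ofNat Nat.Partrec.Code n).eval 0).Dom from h)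
    obtain ⟨k, hk⟩ := Nat.Partrec.Code.evaln_complete.1 hy
    exact ⟨k, by rw [Option.mem_def.1 hk]; rfl⟩
  · rintro ⟨k, hk⟩
    obtain ⟨y, hy⟩ := Option.isSome_iff_exists.1 hk
    exact Part.dom_iff_mem.2 ⟨y, Nat.Partrec.Code.evaln_sound hy⟩

theorem wp_re : IsSigma01 (WordProblem genG) := by
  let P : ℕ → W5 × List (ℕ × ℕ) → Prop := fun n b => wordCode b.1 = n ∧
    ((∀ p ∈ b.2, (Nat.Partrec.Code.evaln p.2 (Denumerable.ofNat Nat.Partrec.Code p.1) 0).isSome = true) ∧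
      evW (b.1 ++ b.2.flatMap fun p => uw (2 * p.1)) = 1)
  have hP : PrimrecRel P := by
    have h1 : PrimrecRel fun (n : ℕ) (b : W5 × List (ℕ × ℕ)) => wordCode b.1 = n :=
      PrimrecRel.comp (Primrec.eq (α := ℕ)) (primrec_wordCode.comp (Primrec.fst.comp Primrec.snd)) Primrec.fst
    have h20 : Primrec fun p : ℕ × ℕ => (Nat.Partrec.Code.evaln p.2 (Denumerable.ofNat Nat.Partrec.Code p.1) 0).isSome := by
      have e := Nat.Partrec.Code.primrec_evaln.comp (Primrec.pair (Primrec.pair (Primrec.snd (α := ℕ) (β := ℕ))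
        ((Primrec.ofNat Nat.Partrec.Code).comp Primrec.fst)) (Primrec.const 0))
      exact Primrec.option_isSome.comp e
    have h21 : PrimrecRel fun (p : ℕ × ℕ) (_ : Unit) => (Nat.Partrec.Code.evaln p.2 (Denumerable.ofNat Nat.Partrec.Code p.1) 0).isSome = true :=
      PrimrecRel.comp (Primrec.eq (α := Bool)) (h20.comp Primrec.fst) (Primrec.const true)
    have h22 := PrimrecRel.forall_mem_list h21
    have h2 : PrimrecRel fun (n : ℕ) (b : W5 × List (ℕ × ℕ)) => ∀ p ∈ b.2, (Nat.Partrec.Code.evaln p.2 (Denumerable.ofNat Nat.Partrec.Code p.1) 0).isSome = true :=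
      PrimrecRel.comp h22 (Primrec.snd.comp Primrec.snd) (Primrec.const ())
    have h30 : Primrec fun s : ℕ × W5 × List (ℕ × ℕ) => s.2.2.flatMap fun p => uw (2 * p.1) :=
      Primrec.list_flatMap (Primrec.snd.comp Primrec.snd)
        (primrec_uw.comp (Primrec.nat_mul.comp (Primrec.const 2) (Primrec.fst.comp Primrec.snd))).to₂
    have h3 : PrimrecPred fun s : ℕ × W5 × List (ℕ × ℕ) => evW (s.2.1 ++ s.2.2.flatMap fun p => uw (2 * p.1)) = 1 :=
      primrecPred_evW.comp (Primrec.list_append.comp (Primrec.fst.comp Primrec.snd) h30)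
    exact PrimrecPred.and h1 (PrimrecPred.and h2 h3)
  obtain ⟨f, hf, hfd⟩ := re_ex hP
  refine ⟨f, hf, fun n => ?_⟩
  rw [hfd]
  constructor
  · rintro ⟨w, hw, h1⟩
    rw [evalWord_genG, pr_one, NN_list] at h1
    obtain ⟨l, hl, hp⟩ := h1
    have : ∀ l : List ℕ, (∀ n ∈ l, n ∈ AA) → ∃ l' : List (ℕ × ℕ),
        (∀ p ∈ l', (Nat.Partrec.Code.evaln p.2 (Denumerable.ofNat Nat.Partrec.Code p.1) 0).isSome = true) ∧
        (l'.map fun p => uu (2 * p.1)).prod = (l.map uu).prod := by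
      intro l
      induction l with
      | nil => intro _; exact ⟨[], by simp, rfl⟩
      | cons a l ih =>
        intro h
        obtain ⟨l', h1, h2⟩ := ih fun n hn => h n (by simp [hn])
        obtain ⟨m, hm, rfl⟩ := h a (by simp)
        obtain ⟨k, hk⟩ := (haltS_iff m).1 hm
        refine ⟨(m, k) :: l', ?_, by simp [h2]⟩
        intro p hp
        rcases List.mem_cons.1 hp with rfl | hp
        · exact hk
        · exact h1 p hp
    obtain ⟨l', h1, h2⟩ := this l hl
    exact ⟨(w, l'), hw, h1, by rw [evW_append, evW_flat, h2, hp]⟩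
  · rintro ⟨⟨w, l⟩, hw, h1, h2⟩
    refine ⟨w, hw, ?_⟩
    rw [evalWord_genG, pr_one, NN_list]
    refine ⟨l.map fun p => 2 * p.1, ?_, ?_⟩
    · intro n hn
      obtain ⟨p, hp, rfl⟩ := List.mem_map.1 hn
      exact (AA_even _).2 ((haltS_iff _).2 ⟨_, h1 p hp⟩)
    · rw [List.map_map, ← h2, evW_append, evW_flat]; rfl

/-- the central letter -/
noncomputable def tP : PG := (1, Multiplicative.ofAdd 1)

theorem tP_zpow (n : ℤ) : tP ^ n = (1, Multiplicative.ofAdd n) := by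
  refine Prod.ext ?_ ?_
  · simp [tP]
  · show (Multiplicative.ofAdd (1 : ℤ)) ^ n = _
    rw [← ofAdd_zsmul]; simp

theorem tP_comm (x : PG) : tP * x = x * tP :=
  Prod.ext (by simp [tP]) (mul_comm _ _)

theorem prt_inf (n : ℤ) (h : pr tP ^ n = 1) : n = 0 := by
  rw [← map_zpow, pr_one] at h
  have := ((mem_ZP _).1 (NN_le _ h)).2
  rw [tP_zpow] at this
  exact ofAdd_eq_one.1 this

theorem prt_comm (g : GG) : pr tP * g = g * pr tP := by
  obtain ⟨p, rfl⟩ := pr_surj g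
  rw [← map_mul, ← map_mul, tP_comm]

theorem inf_order : ¬ IsOfFinOrder (pr tP) := by
  rw [isOfFinOrder_iff_pow_eq_one]
  rintro ⟨n, hn, h⟩
  have := prt_inf n (by rwa [zpow_natCast])
  omega

theorem GG_inf : Infinite GG := by
  by_contra h
  rw [not_infinite_iff_finite] at h
  exact inf_order (isOfFinOrder_of_finite _)

/-- the configurations -/
noncomputable def xG (d : ℕ) (g : GG) : Fin 3 := env d (pr_surj g).choose

theorem xG_pr (d : ℕ) (p : PG) : xG d (pr p) = env d p := by
  have h := (pr_surj (pr p)).choose_spec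
  have h1 : (pr_surj (pr p)).choose * p⁻¹ ∈ NN AA := by
    rw [← pr_one, map_mul, map_inv, h, mul_inv_cancel]
  have := env_ZP (NN_le _ h1) d p
  rw [inv_mul_cancel_right] at this
  exact this

/-- moves of the four-headed machine -/
noncomputable def lamP : Fin 6 → PG := ![1, genP 0, genP 1, genP 2, genP 3, 1]

/-- digits of letters -/
def dg (l : Fin 5 × Bool) : Fin 6 := l.1.succ

theorem uw_letters (n : ℕ) : ∀ l ∈ uw n, l.2 = true ∧ l.1 ≠ 4 := by
  have key : ∀ v : List Bool, ∀ l ∈ v.map (fun b => ((if b then 3 else 2, true) : Fin 5 × Bool)), l.2 = true ∧ l.1 ≠ 4 := by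
    intro v l hl
    obtain ⟨b, _, rfl⟩ := List.mem_map.1 hl
    cases b <;> simp
  have k1 := key (gw n)
  have k2 := key (winv (gw n))
  intro l hl
  unfold uw at hl
  simp only [List.mem_cons, List.mem_append] at hl
  rcases hl with rfl | hl | rfl | hl | rfl | hl | rfl | hl
  · simp
  · exact k1 l hl
  · simp
  · exact k2 l hl
  · simp
  · exact k1 l hl
  · simp
  · exact k2 l hl

theorem lamP_dg (w : W5) (h : ∀ l ∈ w, l.2 = true ∧ l.1 ≠ 4) : ((w.map dg).map lamP).prod = evW w := by
  unfold evW evalWord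
  rw [List.map_map]
  congr 1
  refine List.map_congr_left fun l hl => ?_
  obtain ⟨h1, h2⟩ := h l hl
  obtain ⟨i, b⟩ := l
  simp only at h1 h2
  subst h1
  simp only [Function.comp, if_true, dg]
  fin_cases i
  · rfl
  · rfl
  · rfl
  · rfl
  · exact absurd rfl h2

theorem xG_props {d : ℕ} (g : GG) (hg : xG d g = 1) :
    (∀ j < d, xG d (g * pr tP ^ (j : ℤ)) ≠ 2) ∧ xG d (g * pr tP ^ (d : ℤ)) = 2 ∨ d = 0 := by
  rcases Nat.eq_zero_or_pos d with h0 | h0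
  · exact Or.inr h0
  left
  obtain ⟨p, rfl⟩ := pr_surj g
  rw [xG_pr] at hg
  have hp : p.1 ∈ HH.Z ∧ p.2 = 1 := by
    unfold env at hg
    split_ifs at hg with h1 h2 h3
    · exact ⟨h1, by simpa using h2⟩
    all_goals exact absurd hg (by decide)
  have e : ∀ j : ℕ, xG d (pr p * pr tP ^ (j : ℤ)) = env d (p.1, Multiplicative.ofAdd (j : ℤ)) := by
    intro j
    rw [← map_zpow, ← map_mul, xG_pr, tP_zpow]
    congr 1
    exact Prod.ext (mul_one _) (by simp [hp.2])
  refine ⟨fun j hj => ?_, ?_⟩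
  · rw [e]
    unfold env
    rw [if_pos hp.1]
    split_ifs with h1 h2
    · decide
    · have := Multiplicative.ofAdd.injective h2
      omega
    · decide
  · rw [e]
    unfold env
    rw [if_pos hp.1, if_neg, if_pos rfl]
    intro h
    have := Multiplicative.ofAdd.injective h
    omega

/-- the encoded distances -/
def dn (n : ℕ) : ℕ := dcode ((uw (2 * n)).map dg)

theorem primrec_dn : Primrec dn := by
  have h1 : Primrec fun l : List (Fin 6) => dcode l := by
    have h : Primrec fun a : Fin 6 => a.val := Primrec.dom_finite _
    refine (Primrec.list_foldr Primrec.id (Primrec.const 16)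
      (Primrec.nat_add.comp (Primrec.nat_mul.comp (Primrec.const 11) (Primrec.snd.comp Primrec.snd))
        (h.comp (Primrec.fst.comp Primrec.snd))).to₂).of_eq fun l => by
      simp only [dcode, id]
  have h2 : Primrec fun n : ℕ => (uw (2 * n)).map dg :=
    Primrec.list_map (primrec_uw.comp (Primrec.nat_mul.comp (Primrec.const 2) Primrec.id))
      ((Primrec.dom_finite dg).comp Primrec.snd).to₂
  exact h1.comp h2

theorem four_heads : ∃ aut : GWA GG 3 4, ∀ n, xG (dn n) ∉ autSet aut ↔ n ∉ HaltS := by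
  obtain ⟨aut, h⟩ := exists_aut (s := 3) (rule4 (pr tP) (fun i => pr (lamP i))) .start0 .rej 2
  refine ⟨aut, fun n => ?_⟩
  rw [h, dn, rejects_iff prt_inf prt_comm (by simp [lamP])]
  · have e : (List.map (fun i => pr (lamP i)) (List.map dg (uw (2 * n)))).prod = pr (evW (uw (2 * n))) := by
      rw [← lamP_dg _ (uw_letters _), map_list_prod, List.map_map (f := lamP)]; rfl
    rw [e, evW_uw, Ne, pr_one, uu_mem_NN, AA_even]
  · intro a ha
    obtain ⟨l, hl, rfl⟩ := List.mem_map.1 ha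
    intro h5
    refine (uw_letters _ l hl).2 ?_
    have := congrArg Fin.val h5
    simp only [dg, Fin.val_succ] at this
    apply Fin.ext
    show l.1.val = 4
    have h6 : ((5 : Fin 6) : ℕ) = 5 := rfl
    omega
  · refine ⟨pr 1, ?_⟩
    rw [xG_pr]
    simp [env, HH.Z.one_mem]
  · intro g hg
    rcases xG_props g hg with h1 | h1
    · exact h1
    · have := dcode_pos ((uw (2 * n)).map dg)
      omega

theorem three_heads (aut : GWA GG 3 3) : ∃ n, ¬ (xG (dn n) ∉ autSet aut ↔ n ∉ HaltS) := by
  by_contra hcon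
  push Not at hcon
  obtain ⟨K, I, Fi, hK⟩ := extract (π := pr) (aut := aut) pr_surj GG_inf (NN AA) pr_one xG xG_pr
  obtain ⟨B, hB, -, hBR⟩ := K.exists_B AA_odd
  obtain ⟨P, hP, hPR⟩ := K.Rej'_re I Fi (NN B) (NN_finite B hB)
  have key : ∀ n, n ∉ HaltS ↔ ∃ b, P (dn n) b := fun n => by
    rw [← hPR, ← hBR, ← hK]; exact (hcon n).symm
  have hP' : PrimrecRel fun (c : Nat.Partrec.Code) b => P (dn (Encodable.encode c)) b :=
    PrimrecRel.comp hP (primrec_dn.comp (Primrec.encode.comp Primrec.fst)) Primrec.snd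
  obtain ⟨f, hf, hfd⟩ := re_ex hP'
  refine ComputablePred.halting_problem_not_re 0 ?_
  refine hf.dom_re.of_eq fun c => ?_
  rw [hfd, ← key]
  simp [HaltS]

theorem heads_lt : headsLT GG 3 4 := by
  constructor
  · rintro s X ⟨aut, rfl⟩
    exact ⟨addHead aut, (addHead_set aut).symm⟩
  · obtain ⟨aut, h⟩ := four_heads
    refine ⟨3, autSet aut, ⟨aut, rfl⟩, ?_⟩
    rintro ⟨aut', h'⟩
    obtain ⟨n, hn⟩ := three_heads aut'
    exact hn (by rw [← h']; exact h n)

end FH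

theorem four_heads_better_than_three :
    ∃ (G : Type) (_ : Group G) (m : ℕ) (gen : Fin m → G),
      Subgroup.closure (Set.range gen) = ⊤ ∧
      IsSigma01 (WordProblem gen) ∧
      (∃ g : G, ¬ IsOfFinOrder g) ∧
      headsLT G 3 4 :=
  ⟨FH.GG, inferInstance, 5, FH.genG, FH.gen_top, FH.wp_re, ⟨_, FH.inf_order⟩, FH.heads_lt⟩
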